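/- Let E ⊂ ℝⁿ be uniformly d-rectifiable and f : E → ℝ L-Lipschitz, L > 0. If 1 ≤ q < 2d/(d−2) (or 1 ≤ q ≤ ∞ if d = 1), then the measure Ω^{q,2L}_f(x,r)² dσ(x) dr/r is a Carleson measure with constant C·L², i.e. ∫_B ∫_0^{r_B} Ω^{q,2L}_f(x,r)² dr/r dσ(x) ≤ C L² r_B^d for every ball B centered on E with r_B < diam E. -/

import Mathlib

open MeasureTheory Metric Set
open scoped ENNReal NNReal

noncomputable section

abbrev Eucl (n : ℕ) := EuclideanSpace ℝ (Fin n)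

def AhlforsRegular {n : ℕ} (E : Set (Eucl n)) (d : ℕ) (C : ℝ) : Prop :=
  1 ≤ C ∧ ∀ x ∈ E, ∀ r : ℝ, 0 < r → r ≤ Metric.diam E →
    ENNReal.ofReal (C⁻¹ * r ^ d) ≤ μH[d] (E ∩ Metric.ball x r) ∧
      μH[d] (E ∩ Metric.ball x r) ≤ ENNReal.ofReal (C * r ^ d)

/-- `Ω^q_f(B(c,r), A)`. -/
def Omega {n : ℕ} (σ : Measure (Eucl n)) (f : Eucl n → ℝ) (q : ℝ)
    (c : Eucl n) (r : ℝ) (A : Eucl n →ᵃ[ℝ] ℝ) : ℝ :=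
  (⨍ y in Metric.ball c r, (|f y - A y| / r) ^ q ∂σ) ^ (1 / q)

def OmegaInf {n : ℕ} (σ : Measure (Eucl n)) (f : Eucl n → ℝ) (q : ℝ)
    (c : Eucl n) (r : ℝ) : ℝ :=
  ⨅ A : Eucl n →ᵃ[ℝ] ℝ, Omega σ f q c r A

/-- Jones beta number against a fixed affine `d`-plane `P`. -/
def betaP {n : ℕ} (σ : Measure (Eucl n)) (d : ℕ) (q : ℝ) (c : Eucl n) (r : ℝ)
    (P : AffineSubspace ℝ (Eucl n)) : ℝ :=
  ((1 / r ^ d) *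
      ∫ y in Metric.ball c r, (Metric.infDist y (P : Set (Eucl n)) / r) ^ q ∂σ) ^ (1 / q)

/-- Jones beta number `β^{d,q}_E(B(c,r))`: infimum over all affine `d`-planes. -/
def betaNum {n : ℕ} (σ : Measure (Eucl n)) (d : ℕ) (q : ℝ) (c : Eucl n) (r : ℝ) : ℝ :=
  ⨅ P : {P : AffineSubspace ℝ (Eucl n) // Module.finrank ℝ P.direction = d},
    betaP σ d q c r P.1

/-- The norm `|∇A|` of the linear part of an affine map `A : ℝⁿ → ℝ`. -/
def gradNorm {n : ℕ} (A : Eucl n →ᵃ[ℝ] ℝ) : ℝ :=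
  ‖LinearMap.toContinuousLinearMap A.linear‖

/-- `γ^q_f(B, A) = Ω^q_f(B,A) + |∇A| β^{d,q}_E(B)`. -/
def gammaA {n : ℕ} (σ : Measure (Eucl n)) (f : Eucl n → ℝ) (d : ℕ) (q : ℝ)
    (c : Eucl n) (r : ℝ) (A : Eucl n →ᵃ[ℝ] ℝ) : ℝ :=
  Omega σ f q c r A + gradNorm A * betaNum σ d q c r

/-- `γ^q_f(B) = inf_A γ^q_f(B, A)`. -/
def gamma {n : ℕ} (σ : Measure (Eucl n)) (f : Eucl n → ℝ) (d : ℕ) (q : ℝ)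
    (c : Eucl n) (r : ℝ) : ℝ :=
  ⨅ A : Eucl n →ᵃ[ℝ] ℝ, gammaA σ f d q c r A

/-- `E` is uniformly `d`-rectifiable: Ahlfors `d`-regular and containing big pieces of
Lipschitz images of `ℝ^d`. -/
def UniformlyRectifiable {n : ℕ} (E : Set (Eucl n)) (d : ℕ) (C θ L : ℝ) : Prop :=
  AhlforsRegular E d C ∧ 0 < θ ∧ 0 < L ∧
    ∀ x ∈ E, ∀ r : ℝ, 0 < r → r < Metric.diam E →
      ∃ ρ : EuclideanSpace ℝ (Fin d) → Eucl n,
        LipschitzWith (Real.toNNReal L) ρ ∧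
          ENNReal.ofReal (θ * r ^ d) ≤ μH[d] (E ∩ Metric.ball x r ∩ ρ '' Metric.ball 0 r)

/-- `Ω^{q,N}_f(x,r)`: infimum of `Ω^q_f(B(x,r),A)` over affine maps with `|∇A| ≤ N`. -/
def OmegaN {n : ℕ} (σ : Measure (Eucl n)) (f : Eucl n → ℝ) (q N : ℝ)
    (c : Eucl n) (r : ℝ) : ℝ :=
  ⨅ A : {A : Eucl n →ᵃ[ℝ] ℝ // gradNorm A ≤ N}, Omega σ f q c r A.1

/-- The dyadic scale `2⁻ᵏ`. -/
def dy (k : ℕ) : ℝ := (1 / 2) ^ k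

lemma dy_pos (k : ℕ) : 0 < dy k := by unfold dy; positivity

lemma dy_ne (k : ℕ) : dy k ≠ 0 := (dy_pos k).ne'

lemma dy_zero : dy 0 = 1 := by simp [dy]

lemma dy_succ (k : ℕ) : dy (k + 1) = dy k / 2 := by unfold dy; rw [pow_succ]; ring

lemma dy_add (k l : ℕ) : dy (k + l) = dy k * dy l := by unfold dy; rw [pow_add]

lemma dy_le_one (k : ℕ) : dy k ≤ 1 := by
  unfold dy; exact pow_le_one₀ (by norm_num) (by norm_num)

lemma dy_anti {k l : ℕ} (h : k ≤ l) : dy l ≤ dy k := by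
  unfold dy; exact pow_le_pow_of_le_one (by norm_num) (by norm_num) h

section Energy

variable {V : Type*} [NormedAddCommGroup V] [NormedSpace ℝ V]

/-- `1`-Lipschitz functions vanishing outside the ball of radius `ρ`. -/
def LipSupp (ρ : ℝ) (g : V → ℝ) : Prop :=
  LipschitzWith 1 g ∧ ∀ x, ρ ≤ ‖x‖ → g x = 0

variable [MeasurableSpace V] [BorelSpace V]

/-- Stencils `ψ` whose scale-normalised square function is bounded uniformly over `LipSupp ρ`. -/
def SqBdd (ν : Measure V) (ρ : ℝ) (ψ : (V → ℝ) → ℕ → V → ℝ) : Prop :=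
  (∀ g, Continuous g → ∀ k, Continuous (ψ g k)) ∧
  ∃ C : ℝ≥0∞, C ≠ ⊤ ∧ ∀ g, LipSupp ρ g →
    ∑' k, ∫⁻ x, ENNReal.ofReal ((ψ g k x / dy k) ^ 2) ∂ν ≤ C

variable {ν : Measure V} {ρ : ℝ}

lemma SqBdd.add {ψ φ : (V → ℝ) → ℕ → V → ℝ} (h₁ : SqBdd ν ρ ψ) (h₂ : SqBdd ν ρ φ) :
    SqBdd ν ρ (fun g k x => ψ g k x + φ g k x) := by
  obtain ⟨c₁, C₁, hC₁, b₁⟩ := h₁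
  obtain ⟨c₂, C₂, hC₂, b₂⟩ := h₂
  refine ⟨fun g hg k => (c₁ g hg k).add (c₂ g hg k), 2 * C₁ + 2 * C₂, by finiteness, ?_⟩
  intro g hg
  have hgc := hg.1.continuous
  calc ∑' k, ∫⁻ x, ENNReal.ofReal (((ψ g k x + φ g k x) / dy k) ^ 2) ∂ν
      ≤ ∑' k, (2 * ∫⁻ x, ENNReal.ofReal ((ψ g k x / dy k) ^ 2) ∂ν
          + 2 * ∫⁻ x, ENNReal.ofReal ((φ g k x / dy k) ^ 2) ∂ν) := by
        refine ENNReal.tsum_le_tsum fun k => ?_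
        have m₁ : Measurable fun x => ENNReal.ofReal ((ψ g k x / dy k) ^ 2) :=
          (((c₁ g hgc k).div_const _).pow 2).measurable.ennreal_ofReal
        have m₂ : Measurable fun x => ENNReal.ofReal ((φ g k x / dy k) ^ 2) :=
          (((c₂ g hgc k).div_const _).pow 2).measurable.ennreal_ofReal
        rw [← lintegral_const_mul _ m₁, ← lintegral_const_mul _ m₂,
          ← lintegral_add_left (m₁.const_mul 2)]
        refine lintegral_mono fun x => ?_
        have e2 : (2 : ℝ≥0∞) = ENNReal.ofReal 2 := by simp
        simp only [e2]
        rw [← ENNReal.ofReal_mul (by norm_num), ← ENNReal.ofReal_mul (by norm_num),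
          ← ENNReal.ofReal_add (by positivity) (by positivity)]
        refine ENNReal.ofReal_le_ofReal ?_
        rw [add_div]
        nlinarith [sq_nonneg (ψ g k x / dy k - φ g k x / dy k)]
    _ = 2 * (∑' k, ∫⁻ x, ENNReal.ofReal ((ψ g k x / dy k) ^ 2) ∂ν)
          + 2 * ∑' k, ∫⁻ x, ENNReal.ofReal ((φ g k x / dy k) ^ 2) ∂ν := by
        rw [ENNReal.tsum_add, ENNReal.tsum_mul_left, ENNReal.tsum_mul_left]
    _ ≤ _ := by gcongr <;> [exact b₁ g hg; exact b₂ g hg]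

lemma SqBdd.smul {ψ : (V → ℝ) → ℕ → V → ℝ} (h : SqBdd ν ρ ψ) (c : ℝ) :
    SqBdd ν ρ (fun g k x => c * ψ g k x) := by
  obtain ⟨c₁, C₁, hC₁, b₁⟩ := h
  refine ⟨fun g hg k => continuous_const.mul (c₁ g hg k),
    ENNReal.ofReal (c ^ 2) * C₁, by finiteness, fun g hg => ?_⟩
  refine le_trans (le_of_eq ?_) (mul_le_mul_right (b₁ g hg) _)
  rw [← ENNReal.tsum_mul_left]
  congr 1; ext k
  rw [← lintegral_const_mul]
  · congr 1; ext x
    rw [← ENNReal.ofReal_mul (by positivity)]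
    congr 1; ring
  · exact (((c₁ g hg.1.continuous k).div_const _).pow 2).measurable.ennreal_ofReal

lemma SqBdd.neg {ψ : (V → ℝ) → ℕ → V → ℝ} (h : SqBdd ν ρ ψ) :
    SqBdd ν ρ (fun g k x => - ψ g k x) := by
  simpa using h.smul (-1)

lemma SqBdd.sub {ψ φ : (V → ℝ) → ℕ → V → ℝ} (h₁ : SqBdd ν ρ ψ) (h₂ : SqBdd ν ρ φ) :
    SqBdd ν ρ (fun g k x => ψ g k x - φ g k x) := by
  simpa [sub_eq_add_neg] using h₁.add h₂.neg

lemma sqBdd_zero : SqBdd ν ρ (fun _ _ _ => 0) :=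
  ⟨fun _ _ _ => continuous_const, 0, by simp, fun g _ => by simp⟩

lemma SqBdd.translate [ν.IsAddRightInvariant]
    {ψ : (V → ℝ) → ℕ → V → ℝ} (h : SqBdd ν ρ ψ) (b : V) :
    SqBdd ν ρ (fun g k x => ψ g k (x + dy k • b)) := by
  obtain ⟨c₁, C₁, hC₁, b₁⟩ := h
  refine ⟨fun g hg k => (c₁ g hg k).comp (continuous_id.add continuous_const), C₁, hC₁,
    fun g hg => ?_⟩
  refine le_trans (le_of_eq ?_) (b₁ g hg)
  congr 1; ext k
  exact lintegral_add_right_eq_self (fun x => ENNReal.ofReal ((ψ g k x / dy k) ^ 2)) (dy k • b)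

lemma lintegral_diff_le (g : V → ℝ) (hg : LipSupp ρ g) (a : V) {h : ℝ} (h0 : 0 < h) (h2 : h ≤ 2) :
    ∫⁻ x, ENNReal.ofReal (((g (x + h • a) - g x) / h) ^ 2) ∂ν
      ≤ ENNReal.ofReal (‖a‖ ^ 2) * ν (closedBall 0 (ρ + 2 * ‖a‖)) := by
  have : ∀ x, ENNReal.ofReal (((g (x + h • a) - g x) / h) ^ 2) ≤
      (closedBall (0 : V) (ρ + 2 * ‖a‖)).indicator (fun _ => ENNReal.ofReal (‖a‖ ^ 2)) x := by
    intro x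
    have hn : ‖h • a‖ = h * ‖a‖ := by rw [norm_smul, Real.norm_of_nonneg h0.le]
    by_cases hx : x ∈ closedBall (0 : V) (ρ + 2 * ‖a‖)
    · rw [indicator_of_mem hx]
      refine ENNReal.ofReal_le_ofReal ?_
      have h1 : |g (x + h • a) - g x| ≤ h * ‖a‖ := by
        have := hg.1.dist_le_mul (x + h • a) x
        rw [Real.dist_eq] at this
        simpa [hn] using this
      rw [div_pow, div_le_iff₀ (by positivity), ← sq_abs]
      calc |g (x + h • a) - g x| ^ 2 ≤ (h * ‖a‖) ^ 2 := by gcongr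
        _ = _ := by ring
    · rw [indicator_of_notMem hx]
      rw [mem_closedBall_zero_iff, not_le] at hx
      have e1 : g x = 0 := hg.2 x (by nlinarith [norm_nonneg a])
      have e2 : g (x + h • a) = 0 := by
        refine hg.2 _ ?_
        have := norm_sub_norm_le x (-(h • a))
        rw [norm_neg, sub_neg_eq_add, hn] at this
        nlinarith [norm_nonneg a]
      simp [e1, e2]
  calc _ ≤ ∫⁻ x, (closedBall (0 : V) (ρ + 2 * ‖a‖)).indicator
        (fun _ => ENNReal.ofReal (‖a‖ ^ 2)) x ∂ν := lintegral_mono this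
    _ = _ := by rw [lintegral_indicator_const measurableSet_closedBall]

lemma sqBdd_secondDiff [ν.IsAddRightInvariant] [ProperSpace V] [IsFiniteMeasureOnCompacts ν]
    (a : V) :
    SqBdd ν ρ (fun g k x => g (x + (2 * dy k) • a) - 2 * g (x + dy k • a) + g x) := by
  refine ⟨fun g hg k => by fun_prop,
    4 * (ENNReal.ofReal (‖a‖ ^ 2) * ν (closedBall 0 (ρ + 2 * ‖a‖))), ?_, fun g hg => ?_⟩
  · have : ν (closedBall 0 (ρ + 2 * ‖a‖)) ≠ ⊤ :=
      ((isCompact_closedBall _ _).measure_lt_top).ne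
    finiteness
  have hgc := hg.1.continuous
  set I : ℕ → ℝ≥0∞ := fun k => ∫⁻ x, ENNReal.ofReal
    (((g (x + (2 * dy k) • a) - 2 * g (x + dy k • a) + g x) / dy k) ^ 2) ∂ν with hI
  set b : ℕ → ℝ≥0∞ := fun k => ∫⁻ x, ENNReal.ofReal
    (((g (x + (2 * dy k) • a) - g x) / (2 * dy k)) ^ 2) ∂ν with hb
  have step : ∀ k, b k + I k / 4 = b (k + 1) := by
    intro k
    have hd := dy_pos k
    have e : 2 * dy (k + 1) = dy k := by rw [dy_succ]; ring
    set u : V → ℝ≥0∞ := fun x => ENNReal.ofReal (((g (x + dy k • a) - g x) / dy k) ^ 2) with hu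
    have hum : Measurable u := by
      refine Measurable.ennreal_ofReal (Continuous.measurable ?_); fun_prop
    have hum' : Measurable fun x => u (x + dy k • a) := hum.comp (measurable_add_const _)
    have hb1 : b (k + 1) = ∫⁻ x, u x ∂ν := by simp only [hb, e, hu]
    have hb2 : ∫⁻ x, u (x + dy k • a) ∂ν = ∫⁻ x, u x ∂ν := lintegral_add_right_eq_self u _
    have m1 : Measurable fun x => ENNReal.ofReal
      (((g (x + (2 * dy k) • a) - g x) / (2 * dy k)) ^ 2) := by
      refine Measurable.ennreal_ofReal (Continuous.measurable ?_); fun_prop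
    have m2 : Measurable fun x => ENNReal.ofReal
      (((g (x + (2 * dy k) • a) - 2 * g (x + dy k • a) + g x) / dy k) ^ 2) := by
      refine Measurable.ennreal_ofReal (Continuous.measurable ?_); fun_prop
    have key : 4 * b k + I k = 4 * b (k + 1) := by
      have : 4 * b (k + 1) = 2 * (∫⁻ x, u (x + dy k • a) ∂ν) + 2 * ∫⁻ x, u x ∂ν := by
        rw [hb1, hb2]; ring
      rw [this]
      simp only [hb, hI]
      rw [← lintegral_const_mul _ m1, ← lintegral_const_mul _ hum,
        ← lintegral_const_mul _ hum',
        ← lintegral_add_left (m1.const_mul 4),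
        ← lintegral_add_right _ (hum.const_mul 2)]
      congr 1; ext x
      simp only [hu]
      have e2 : (2 : ℝ≥0∞) = ENNReal.ofReal 2 := by simp
      have e4 : (4 : ℝ≥0∞) = ENNReal.ofReal 4 := by simp
      rw [e2, e4, ← ENNReal.ofReal_mul (by norm_num), ← ENNReal.ofReal_mul (by norm_num),
        ← ENNReal.ofReal_mul (by norm_num),
        ← ENNReal.ofReal_add (by positivity) (by positivity),
        ← ENNReal.ofReal_add (by positivity) (by positivity)]
      have e3 : x + dy k • a + dy k • a = x + (2 * dy k) • a := by module
      rw [e3]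
      congr 1
      field_simp
      ring
    have h4 : (4 : ℝ≥0∞) ≠ 0 := by norm_num
    have h4' : (4 : ℝ≥0∞) ≠ ⊤ := by norm_num
    rw [← ENNReal.mul_right_inj h4 h4', mul_add, ENNReal.mul_div_cancel h4 h4', key]
  have sum : ∀ N, (∑ k ∈ Finset.range N, I k / 4) ≤ b N := by
    intro N
    induction N with
    | zero => simp
    | succ N ih => rw [Finset.sum_range_succ, ← step N]; gcongr
  have hle : ∀ N, ∑ k ∈ Finset.range N, I k ≤
      4 * (ENNReal.ofReal (‖a‖ ^ 2) * ν (closedBall 0 (ρ + 2 * ‖a‖))) := by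
    intro N
    have h1 := (sum N).trans (lintegral_diff_le (ν := ν) g hg a (h := 2 * dy N)
      (by have := dy_pos N; positivity) (by have := dy_le_one N; linarith))
    have h2 : ∑ k ∈ Finset.range N, I k = 4 * ∑ k ∈ Finset.range N, I k / 4 := by
      rw [Finset.mul_sum]
      exact Finset.sum_congr rfl fun k _ =>
        (ENNReal.mul_div_cancel (by norm_num) (by norm_num)).symm
    rw [h2]
    gcongr
  exact ENNReal.tsum_le_of_sum_range_le hle

/-- The first difference at scale `2⁻ᵏ` in direction `a`. -/
def fdiff (a : V) (g : V → ℝ) (k : ℕ) (x : V) : ℝ := g (x + dy k • a) - g x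

section
variable [ν.IsAddRightInvariant] [ProperSpace V] [IsFiniteMeasureOnCompacts ν]

lemma sqBdd_fdiff_add (a b : V) :
    SqBdd ν ρ (fun g k x => fdiff (a + b) g k x - (fdiff a g k x + fdiff b g k x)) := by
  have h1 := (sqBdd_secondDiff (ν := ν) (ρ := ρ) ((1 / 2 : ℝ) • (a + b)))
  have h2 := (sqBdd_secondDiff (ν := ν) (ρ := ρ) ((1 / 2 : ℝ) • (a - b))).translate b
  convert h1.sub h2 using 4 with g k x
  simp only [fdiff]
  have e1 : x + (2 * dy k) • ((1 / 2 : ℝ) • (a + b)) = x + dy k • (a + b) := by module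
  have e2 : x + dy k • b + (2 * dy k) • ((1 / 2 : ℝ) • (a - b)) = x + dy k • a := by module
  have e3 : x + dy k • b + dy k • ((1 / 2 : ℝ) • (a - b)) =
    x + dy k • ((1 / 2 : ℝ) • (a + b)) := by module
  rw [e1, e2, e3]
  ring

lemma sqBdd_fdiff_nat (n : ℕ) (a : V) :
    SqBdd ν ρ (fun g k x => fdiff ((n : ℝ) • a) g k x - n * fdiff a g k x) := by
  induction n with
  | zero => convert sqBdd_zero (ν := ν) (ρ := ρ) using 4; simp [fdiff]
  | succ n ih =>
    have h := (sqBdd_fdiff_add (ν := ν) (ρ := ρ) ((n : ℝ) • a) a).add ih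
    convert h using 4 with g k x
    have : ((n + 1 : ℕ) : ℝ) • a = (n : ℝ) • a + a := by push_cast; module
    rw [this]; push_cast; ring

lemma sqBdd_fdiff_int (n : ℤ) (a : V) :
    SqBdd ν ρ (fun g k x => fdiff ((n : ℝ) • a) g k x - n * fdiff a g k x) := by
  obtain ⟨m, rfl | rfl⟩ := n.eq_nat_or_neg
  · exact_mod_cast sqBdd_fdiff_nat m a
  · have h := ((sqBdd_fdiff_add (ν := ν) (ρ := ρ) ((m : ℝ) • a) (-((m : ℝ) • a))).add
      (sqBdd_fdiff_nat (ν := ν) (ρ := ρ) m a)).neg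
    convert h using 4 with g k x
    have e : (((-(m : ℤ) : ℤ)) : ℝ) • a = -((m : ℝ) • a) := by push_cast; module
    rw [e]
    have e0 : fdiff ((m : ℝ) • a + -((m : ℝ) • a)) g k x = 0 := by simp [fdiff]
    rw [e0]; push_cast; ring

lemma sqBdd_fdiff_dyadic (i : ℕ) (n : ℤ) (a : V) :
    SqBdd ν ρ (fun g k x => fdiff ((dy i * n) • a) g k x - dy i * n * fdiff a g k x) := by
  have h1 := sqBdd_fdiff_nat (ν := ν) (ρ := ρ) (2 ^ i) ((dy i * n) • a)
  have h2 := sqBdd_fdiff_int (ν := ν) (ρ := ρ) n a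
  have e : ((2 ^ i : ℕ) : ℝ) * dy i = 1 := by
    push_cast; unfold dy; rw [← mul_pow]; norm_num
  have e' : ((2 ^ i : ℕ) : ℝ) • (dy i * (n : ℝ)) • a = (n : ℝ) • a := by
    rw [smul_smul, ← mul_assoc, e, one_mul]
  rw [e'] at h1
  convert ((h2.sub h1).smul (dy i)) using 4 with g k x
  linear_combination (-fdiff ((dy i * n) • a) g k x) * e

lemma sqBdd_fdiff_sum {ι : Type*} (s : Finset ι) (i : ℕ) (w : ι → ℤ) (a : ι → V) :
    SqBdd ν ρ (fun g k x => fdiff (∑ l ∈ s, (dy i * w l) • a l) g k x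
      - ∑ l ∈ s, dy i * w l * fdiff (a l) g k x) := by
  classical
  induction s using Finset.induction_on with
  | empty => convert sqBdd_zero (ν := ν) (ρ := ρ) using 4; simp [fdiff]
  | insert l s hl ih =>
    have h := ((sqBdd_fdiff_add (ν := ν) (ρ := ρ) ((dy i * w l) • a l)
      (∑ l ∈ s, (dy i * w l) • a l)).add ih).add (sqBdd_fdiff_dyadic i (w l) (a l))
    convert h using 4 with g k x
    rw [Finset.sum_insert hl, Finset.sum_insert hl]
    ring

end

end Energy

section Lattice

variable {d : ℕ}

/-- The integer vector `m` as a point of Euclidean space. -/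
def zv (m : Fin d → ℤ) : Eucl d := WithLp.toLp 2 fun i => (m i : ℝ)

@[simp] lemma zv_apply (m : Fin d → ℤ) (i : Fin d) : zv m i = m i := rfl

/-- The standard basis vector. -/
def ev (i : Fin d) : Eucl d := EuclideanSpace.single i 1

lemma ev_apply (i j : Fin d) : ev i j = if j = i then 1 else 0 := by
  simp [ev]

lemma norm_ev (i : Fin d) : ‖ev i‖ = 1 := by simp [ev]

/-- The lattice point with index `m` at generation `k`. -/
def lpt (k : ℕ) (m : Fin d → ℤ) : Eucl d := dy k • zv m

@[simp] lemma lpt_apply (k : ℕ) (m : Fin d → ℤ) (i : Fin d) : lpt k m i = dy k * m i := by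
  simp [lpt]

/-- The index of the dyadic cube of generation `k` containing `v`. -/
def idx (k : ℕ) (v : Eucl d) : Fin d → ℤ := fun i => ⌊v i / dy k⌋

lemma idx_le (k : ℕ) (v : Eucl d) (i : Fin d) : dy k * idx k v i ≤ v i := by
  have := Int.floor_le (v i / dy k)
  rw [le_div_iff₀ (dy_pos k)] at this
  unfold idx; linarith

lemma lt_idx (k : ℕ) (v : Eucl d) (i : Fin d) : v i < dy k * (idx k v i + 1) := by
  have := Int.lt_floor_add_one (v i / dy k)
  rw [div_lt_iff₀ (dy_pos k)] at this
  unfold idx; linarith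

lemma norm_le_sum_abs (v : Eucl d) : ‖v‖ ≤ ∑ i, |v i| := by
  have h : v = ∑ i, v i • ev i := by
    ext j
    simp [ev_apply]
  calc ‖v‖ = ‖∑ i, v i • ev i‖ := by rw [← h]
    _ ≤ ∑ i, ‖v i • ev i‖ := norm_sum_le _ _
    _ = _ := by simp [norm_smul, norm_ev]

lemma norm_le_of_abs_le {v : Eucl d} {c : ℝ} (h : ∀ i, |v i| ≤ c) : ‖v‖ ≤ d * c := by
  refine (norm_le_sum_abs v).trans ((Finset.sum_le_sum fun i _ => h i).trans ?_)
  simp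

lemma abs_apply_le_norm (v : Eucl d) (i : Fin d) : |v i| ≤ ‖v‖ := by
  simpa using PiLp.norm_apply_le v i

variable {W : Type*} [NormedAddCommGroup W] [NormedSpace ℝ W]

/-- The affine interpolation of `g` from the corner of the dyadic cube `(k, m)` and its
neighbours in the coordinate directions. -/
def tay (g : Eucl d → W) (k : ℕ) (m : Fin d → ℤ) (v : Eucl d) : W :=
  g (lpt k m) + ∑ i, ((v i - lpt k m i) / dy k) • (g (lpt k m + dy k • ev i) - g (lpt k m))

lemma tay_sub (g₁ g₂ : Eucl d → W) (k : ℕ) (m : Fin d → ℤ) (v : Eucl d) :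
    tay (fun x => g₁ x - g₂ x) k m v = tay g₁ k m v - tay g₂ k m v := by
  unfold tay
  rw [add_sub_add_comm, ← Finset.sum_sub_distrib]
  congr 1
  refine Finset.sum_congr rfl fun i _ => ?_
  module

lemma tay_tay (g : Eucl d → W) (k l : ℕ) (m m' : Fin d → ℤ) (v : Eucl d) :
    tay (tay g k m) l m' v = tay g k m v := by
  have hl := dy_ne l
  have key : ∀ i, tay g k m (lpt l m' + dy l • ev i) - tay g k m (lpt l m')
      = (dy l / dy k) • (g (lpt k m + dy k • ev i) - g (lpt k m)) := by
    intro i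
    unfold tay
    rw [add_sub_add_left_eq_sub, ← Finset.sum_sub_distrib, Finset.sum_eq_single i]
    · rw [← sub_smul]; congr 1
      simp [ev_apply]; ring
    · intro j _ hj
      simp [ev_apply, hj]
    · simp
  have hexp : tay (tay g k m) l m' v = tay g k m (lpt l m') + ∑ i, ((v i - lpt l m' i) / dy l) •
      (dy l / dy k) • (g (lpt k m + dy k • ev i) - g (lpt k m)) := by
    conv_lhs => rw [tay]
    simp only [key]
  rw [hexp]
  unfold tay
  rw [add_assoc, ← Finset.sum_add_distrib]
  congr 1
  refine Finset.sum_congr rfl fun i _ => ?_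
  rw [smul_smul, ← add_smul]
  congr 1
  field_simp
  ring

lemma norm_tay_le {u : Eucl d → W} {k : ℕ} {m : Fin d → ℤ} {v : Eucl d} {B c : ℝ}
    (h0 : ‖u (lpt k m)‖ ≤ B) (h1 : ∀ i, ‖u (lpt k m + dy k • ev i)‖ ≤ B)
    (hv : ∀ i, |v i - lpt k m i| ≤ c * dy k) : ‖tay u k m v‖ ≤ (2 * d * c + 1) * B := by
  have hB : 0 ≤ B := (norm_nonneg _).trans h0
  have hterm : ∀ i ∈ Finset.univ, ‖((v i - lpt k m i) / dy k) • (u (lpt k m + dy k • ev i) - u (lpt k m))‖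
      ≤ c * (2 * B) := by
    intro i _
    rw [norm_smul, Real.norm_eq_abs, abs_div, abs_of_pos (dy_pos k)]
    have e1 : |v i - lpt k m i| / dy k ≤ c := by rw [div_le_iff₀ (dy_pos k)]; exact hv i
    have e2 : ‖u (lpt k m + dy k • ev i) - u (lpt k m)‖ ≤ 2 * B := by
      refine (norm_sub_le _ _).trans ?_
      linarith [h1 i]
    exact mul_le_mul e1 e2 (norm_nonneg _) ((div_nonneg (abs_nonneg _) (dy_pos k).le).trans e1)
  unfold tay
  refine (norm_add_le _ _).trans ?_
  have := (norm_sum_le _ _).trans (Finset.sum_le_sum hterm)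
  simp only [Finset.sum_const, Finset.card_univ, Fintype.card_fin, nsmul_eq_mul] at this
  nlinarith

lemma norm_tay_diff_le {g : Eucl d → W} (hg : LipschitzWith 1 g) (k : ℕ) (m : Fin d → ℤ)
    (v v' : Eucl d) : ‖tay g k m v - tay g k m v'‖ ≤ ∑ i, |v i - v' i| := by
  unfold tay
  rw [add_sub_add_left_eq_sub, ← Finset.sum_sub_distrib]
  refine (norm_sum_le _ _).trans (Finset.sum_le_sum fun i _ => ?_)
  rw [← sub_smul, norm_smul, Real.norm_eq_abs]
  have h1 : ‖g (lpt k m + dy k • ev i) - g (lpt k m)‖ ≤ dy k := by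
    have := hg.dist_le_mul (lpt k m + dy k • ev i) (lpt k m)
    rw [dist_eq_norm, dist_eq_norm] at this
    simpa [norm_smul, norm_ev, abs_of_pos (dy_pos k)] using this
  have e : (v i - lpt k m i) / dy k - (v' i - lpt k m i) / dy k = (v i - v' i) / dy k := by ring
  rw [e, abs_div, abs_of_pos (dy_pos k)]
  calc _ ≤ |v i - v' i| / dy k * dy k := by
        gcongr
        exact div_nonneg (abs_nonneg _) (dy_pos k).le
    _ = _ := div_mul_cancel₀ _ (dy_ne k)

lemma tay_self (g : Eucl d → W) (k : ℕ) (m : Fin d → ℤ) : tay g k m (lpt k m) = g (lpt k m) := by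
  simp [tay]

/-- The crude approximation bound for a `1`-Lipschitz function. -/
lemma norm_tay_sub_le {g : Eucl d → W} (hg : LipschitzWith 1 g) {k : ℕ} {m : Fin d → ℤ}
    {v : Eucl d} {c : ℝ} (hv : ∀ i, |v i - lpt k m i| ≤ c * dy k) :
    ‖tay g k m v - g v‖ ≤ 2 * d * c * dy k := by
  have h1 := norm_tay_diff_le hg k m v (lpt k m)
  rw [tay_self] at h1
  have h2 : ‖g (lpt k m) - g v‖ ≤ d * (c * dy k) := by
    have := hg.dist_le_mul (lpt k m) v
    rw [dist_eq_norm, dist_eq_norm, NNReal.coe_one, one_mul] at this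
    refine this.trans (norm_le_of_abs_le fun i => ?_)
    rw [PiLp.sub_apply, abs_sub_comm]; exact hv i
  have h3 : ∑ i, |v i - lpt k m i| ≤ d * (c * dy k) := by
    refine (Finset.sum_le_sum fun i _ => hv i).trans ?_
    simp
  have h4 := norm_add_le (tay g k m v - g (lpt k m)) (g (lpt k m) - g v)
  rw [sub_add_sub_cancel] at h4
  linarith

/-- The stencil window: integer vectors with entries bounded by `w * 2 ^ i`. -/
def win (d i w : ℕ) : Finset (Fin d → ℤ) :=
  Fintype.piFinset fun _ => Finset.Icc (-(w * 2 ^ i : ℤ)) (w * 2 ^ i)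

lemma mem_win {i w : ℕ} {a : Fin d → ℤ} : a ∈ win d i w ↔ ∀ j, |a j| ≤ w * 2 ^ i := by
  simp [win, abs_le]

/-- The squared normalised deviation of `g` from its affine interpolation on the window. -/
def Dsq (i w : ℕ) (g : Eucl d → W) (k : ℕ) (m : Fin d → ℤ) : ℝ :=
  ∑ a ∈ win d i w, (‖g (lpt k m + (dy k * dy i) • zv a)
    - tay g k m (lpt k m + (dy k * dy i) • zv a)‖ / dy k) ^ 2

lemma Dsq_nonneg (i w : ℕ) (g : Eucl d → W) (k : ℕ) (m : Fin d → ℤ) : 0 ≤ Dsq i w g k m :=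
  Finset.sum_nonneg fun _ _ => sq_nonneg _

lemma norm_sub_tay_le_win {i w : ℕ} (g : Eucl d → W) (k : ℕ) (m : Fin d → ℤ) {a : Fin d → ℤ}
    (ha : a ∈ win d i w) :
    ‖g (lpt k m + (dy k * dy i) • zv a) - tay g k m (lpt k m + (dy k * dy i) • zv a)‖
      ≤ dy k * √(Dsq i w g k m) := by
  have h := Finset.single_le_sum (f := fun a => (‖g (lpt k m + (dy k * dy i) • zv a)
    - tay g k m (lpt k m + (dy k * dy i) • zv a)‖ / dy k) ^ 2) (fun _ _ => sq_nonneg _) ha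
  have h2 := Real.le_sqrt_of_sq_le h
  rw [div_le_iff₀ (dy_pos k)] at h2
  unfold Dsq; linarith

lemma norm_sub_tay_le_sup {i w : ℕ} {g : Eucl d → W} (hg : LipschitzWith 1 g) (k : ℕ)
    (m : Fin d → ℤ) {v : Eucl d} (hv : ∀ j, |v j - lpt k m j| ≤ w * dy k) :
    ‖g v - tay g k m v‖ ≤ dy k * (√(Dsq i w g k m) + 2 * d * dy i) := by
  have hki : 0 < dy k * dy i := mul_pos (dy_pos k) (dy_pos i)
  set a : Fin d → ℤ := fun j => ⌊(v j - lpt k m j) / (dy k * dy i)⌋ with ha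
  have h2i : (2 : ℝ) ^ i * dy i = 1 := by unfold dy; rw [← mul_pow]; norm_num
  have hwin : a ∈ win d i w := by
    rw [mem_win]
    intro j
    have hj := abs_le.1 (hv j)
    have e : (w : ℝ) * dy k = (w * 2 ^ i) * (dy k * dy i) := by
      linear_combination (-(w : ℝ) * dy k) * h2i
    rw [abs_le]
    constructor
    · rw [ha, Int.le_floor, le_div_iff₀ hki]; push_cast; linarith
    · have : (a j : ℝ) ≤ w * 2 ^ i := by
        refine (Int.floor_le _).trans ?_
        rw [div_le_iff₀ hki]; linarith
      exact_mod_cast this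
  have h1 := norm_sub_tay_le_win g k m hwin
  set q := lpt k m + (dy k * dy i) • zv a with hq
  have hvq : ∀ j, |v j - q j| ≤ dy k * dy i := by
    intro j
    have e1 := Int.floor_le ((v j - lpt k m j) / (dy k * dy i))
    have e2 := Int.lt_floor_add_one ((v j - lpt k m j) / (dy k * dy i))
    rw [le_div_iff₀ hki] at e1
    rw [div_lt_iff₀ hki] at e2
    have e3 : q j = lpt k m j + (dy k * dy i) * a j := by simp [hq]
    rw [e3, abs_le]
    constructor <;> simp only [ha] <;> linarith
  have h2 : ‖g v - g q‖ ≤ d * (dy k * dy i) := by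
    have := hg.dist_le_mul v q
    rw [dist_eq_norm, dist_eq_norm, NNReal.coe_one, one_mul] at this
    exact this.trans (norm_le_of_abs_le fun j => by simpa using hvq j)
  have h3 : ‖tay g k m q - tay g k m v‖ ≤ d * (dy k * dy i) := by
    refine (norm_tay_diff_le hg k m q v).trans ((Finset.sum_le_sum fun j _ =>
      (abs_sub_comm _ _).trans_le (hvq j)).trans ?_)
    simp
  have h4 : g v - tay g k m v = (g v - g q) + (g q - tay g k m q)
      + (tay g k m q - tay g k m v) := by abel
  rw [h4]
  refine (norm_add₃_le).trans ?_
  linarith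

/-- Telescoping along the dyadic cubes containing `v`. -/
lemma norm_tay_sub_le_sum {i w c : ℕ} (hi : 1 ≤ i) (hw : c + 2 ≤ w) {g : Eucl d → W}
    (hg : LipschitzWith 1 g) (v : Eucl d) (J : ℕ) :
    ∀ (k : ℕ) (m : Fin d → ℤ), k ≤ J → (∀ j, |idx k v j - m j| ≤ c) →
    ‖tay g k m v - g v‖ ≤ (2 * d * (c + 1) + 1) * (dy k * √(Dsq i w g k m)
      + ∑ j ∈ Finset.Ico (k + 1) (J + 1), dy j * √(Dsq i w g j (idx j v)) + dy J) := by
  intro k m hk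
  have key : ∀ l : ℕ, ∀ k m, J = k + l → (∀ j, |idx k v j - m j| ≤ c) →
      ‖tay g k m v - g v‖ ≤ (2 * d * (c + 1) + 1) * (dy k * √(Dsq i w g k m)
      + ∑ j ∈ Finset.Ico (k + 1) (J + 1), dy j * √(Dsq i w g j (idx j v)) + dy J) := by
    intro l
    induction l with
    | zero =>
      intro k m hJ hm
      have hJ' : J = k := by omega
      subst hJ'
      have hv : ∀ j, |v j - lpt J m j| ≤ (c + 1 : ℝ) * dy J := by
        intro j
        have h1 := idx_le J v j
        have h2 := lt_idx J v j
        have h3 : |((idx J v j - m j : ℤ) : ℝ)| ≤ c := by exact_mod_cast hm j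
        rw [abs_le] at h3 ⊢
        push_cast at h3
        rw [lpt_apply]
        have := dy_pos J
        constructor <;> nlinarith
      have h := norm_tay_sub_le hg hv
      have hs : (0 : ℝ) ≤ dy J * √(Dsq i w g J m) := by have := dy_pos J; positivity
      have hd := dy_pos J
      rw [Finset.Ico_eq_empty (by omega), Finset.sum_empty, add_zero]
      calc _ ≤ _ := h
        _ ≤ (2 * d * (c + 1) + 1) * dy J := by nlinarith
        _ ≤ _ := by gcongr; linarith
    | succ l ih =>
      intro k m hJ hm
      set m' := idx (k + 1) v with hm'
      have ih' := ih (k + 1) m' (by omega) (by simp [hm'])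
      have hd := dy_pos k
      have hfl : ∀ j, |(m' j : ℤ) - 2 * m j| ≤ 2 * c + 1 := by
        intro j
        have h1 := idx_le k v j
        have h2 := lt_idx k v j
        have h3 := idx_le (k + 1) v j
        have h4 := lt_idx (k + 1) v j
        rw [← hm', dy_succ] at h3 h4
        have h5 : ((2 * idx k v j : ℤ) : ℝ) < ((m' j + 1 : ℤ) : ℝ) := by
          push_cast; by_contra hc; push Not at hc; nlinarith
        have h6 : ((m' j : ℤ) : ℝ) < ((2 * idx k v j + 2 : ℤ) : ℝ) := by
          push_cast; by_contra hc; push Not at hc; nlinarith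
        have h7 := Int.cast_lt.1 h5
        have h8 := Int.cast_lt.1 h6
        have h9 := abs_le.1 (hm j)
        rw [abs_le]; constructor <;> omega
      have hpow : (2 : ℤ) ^ i = 2 * 2 ^ (i - 1) := by
        rw [← pow_succ']; congr 1; omega
      have h2i : (2 : ℝ) * (2 : ℝ) ^ (i - 1) * dy i = 1 := by
        rw [← pow_succ', Nat.sub_add_cancel hi]; unfold dy; rw [← mul_pow]; norm_num
      have hp : (0 : ℤ) < 2 ^ (i - 1) := by positivity
      have hpt : ∀ a : Fin d → ℤ, (∀ j, |a j| ≤ 2 * c + 2) →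
          ‖g (lpt k m + dy (k + 1) • zv a) - tay g k m (lpt k m + dy (k + 1) • zv a)‖
            ≤ dy k * √(Dsq i w g k m) := by
        intro a ha
        have hmem : (fun j => a j * 2 ^ (i - 1)) ∈ win d i w := by
          rw [mem_win]; intro j
          rw [abs_mul, abs_of_pos hp, hpow]
          have := ha j
          have hw' : ((c : ℤ) + 2) ≤ w := by exact_mod_cast hw
          nlinarith
        have := norm_sub_tay_le_win g k m hmem
        have e : (dy k * dy i) • zv (fun j => a j * 2 ^ (i - 1)) = dy (k + 1) • zv a := by
          ext j
          simp only [PiLp.smul_apply, zv_apply, smul_eq_mul, dy_succ]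
          push_cast
          linear_combination (dy k * a j / 2) * h2i
        rwa [e] at this
      have hmp : ∀ a : Fin d → ℤ, lpt (k + 1) (fun j => 2 * m j + a j) = lpt k m + dy (k + 1) • zv a := by
        intro a
        ext j
        simp only [lpt_apply, PiLp.add_apply, PiLp.smul_apply, zv_apply, smul_eq_mul, dy_succ]
        push_cast; ring
      have h0 : ‖tay g k m (lpt (k + 1) m') - g (lpt (k + 1) m')‖ ≤ dy k * √(Dsq i w g k m) := by
        have := hpt (fun j => m' j - 2 * m j) fun j => (hfl j).trans (by omega)
        rw [← hmp] at this
        rw [norm_sub_rev]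
        simpa using this
      have h1 : ∀ l, ‖tay g k m (lpt (k + 1) m' + dy (k + 1) • ev l)
          - g (lpt (k + 1) m' + dy (k + 1) • ev l)‖ ≤ dy k * √(Dsq i w g k m) := by
        intro l
        have := hpt (fun j => m' j - 2 * m j + if j = l then 1 else 0) fun j => by
          have := abs_le.1 (hfl j)
          rw [abs_le]; split_ifs <;> constructor <;> omega
        have e : lpt k m + dy (k + 1) • zv (fun j => m' j - 2 * m j + if j = l then 1 else 0)
            = lpt (k + 1) m' + dy (k + 1) • ev l := by
          ext j
          simp only [lpt_apply, PiLp.add_apply, PiLp.smul_apply, zv_apply, smul_eq_mul, dy_succ,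
            ev_apply]
          split_ifs <;> push_cast <;> ring
        rw [e] at this
        rw [norm_sub_rev]; exact this
      have hv : ∀ j, |v j - lpt (k + 1) m' j| ≤ (1 : ℝ) * dy (k + 1) := by
        intro j
        have h3 := idx_le (k + 1) v j
        have h4 := lt_idx (k + 1) v j
        rw [← hm'] at h3 h4
        rw [lpt_apply, abs_le]; constructor <;> nlinarith [dy_pos (k + 1)]
      have h2 := norm_tay_le (u := fun x => tay g k m x - g x) h0 h1 hv
      rw [tay_sub, tay_tay] at h2
      have h3 := norm_add_le (tay g k m v - tay g (k + 1) m' v) (tay g (k + 1) m' v - g v)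
      rw [sub_add_sub_cancel] at h3
      have hsum : ∑ j ∈ Finset.Ico (k + 1) (J + 1), dy j * √(Dsq i w g j (idx j v)) =
          dy (k + 1) * √(Dsq i w g (k + 1) m') +
          ∑ j ∈ Finset.Ico (k + 1 + 1) (J + 1), dy j * √(Dsq i w g j (idx j v)) := by
        rw [Finset.sum_eq_sum_Ico_succ_bot (by omega)]
      rw [hsum]
      have hs : (0 : ℝ) ≤ dy k * √(Dsq i w g k m) := by positivity
      have hcc : (2 * (d : ℝ) * 1 + 1) ≤ 2 * d * (c + 1) + 1 := by
        have : (0 : ℝ) ≤ d * c := by positivity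
        linarith
      have := mul_le_mul_of_nonneg_right hcc hs
      linarith
  exact key (J - k) k m (by omega)

end Lattice

section Choice

variable {d : ℕ}

/-- The stencil measuring the deviation from the affine interpolation at one window point. -/
def stencil (i : ℕ) (a : Fin d → ℤ) (g : Eucl d → ℝ) (k : ℕ) (x : Eucl d) : ℝ :=
  fdiff (∑ l, (dy i * a l) • ev l) g k x - ∑ l, dy i * a l * fdiff (ev l) g k x

lemma Dsq_eq_stencil (i w : ℕ) (g : Eucl d → ℝ) (z : Eucl d) (k : ℕ) (m : Fin d → ℤ) :
    Dsq i w (fun v => g (v + z)) k m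
      = ∑ a ∈ win d i w, (stencil i a g k (lpt k m + z) / dy k) ^ 2 := by
  unfold Dsq
  refine Finset.sum_congr rfl fun a _ => ?_
  rw [Real.norm_eq_abs, div_pow, sq_abs, ← div_pow]
  congr 2
  have e : dy k • ∑ l, (dy i * (a l : ℝ)) • (ev l : Eucl d) = (dy k * dy i) • zv a := by
    ext j
    simp [ev_apply, mul_assoc]
  unfold stencil tay fdiff
  rw [show lpt k m + z + dy k • ∑ l, (dy i * (a l : ℝ)) • (ev l : Eucl d)
    = lpt k m + (dy k * dy i) • zv a + z by rw [e]; abel, ← sub_sub]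
  congr 1
  refine Finset.sum_congr rfl fun l _ => ?_
  have : (((lpt k m + (dy k * dy i) • zv a) l - lpt k m l) / dy k) = dy i * a l := by
    simp only [PiLp.add_apply, PiLp.smul_apply, zv_apply, smul_eq_mul, add_sub_cancel_left]
    field_simp [dy_ne k]
  rw [this, smul_eq_mul, add_right_comm]

/-- The indices of generation `k` inside the cube `[-B, B)ᵈ`. -/
def box (d B k : ℕ) : Finset (Fin d → ℤ) :=
  Fintype.piFinset fun _ => Finset.Ico (-(B * 2 ^ k : ℤ)) (B * 2 ^ k)

lemma mem_box {B k : ℕ} {m : Fin d → ℤ} :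
    m ∈ box d B k ↔ ∀ j, -(B * 2 ^ k : ℤ) ≤ m j ∧ m j < B * 2 ^ k := by
  simp [box]

lemma two_pow_mul_dy (k : ℕ) : (2 : ℝ) ^ k * dy k = 1 := by
  unfold dy; rw [← mul_pow]; norm_num

lemma card_box (B k : ℕ) : ((box d B k).card : ℝ) * dy k ^ d = (2 * B) ^ d := by
  unfold box
  rw [Fintype.card_piFinset]
  simp only [Int.card_Ico, Finset.prod_const, Finset.card_univ, Fintype.card_fin]
  have : ((B * 2 ^ k - -(B * 2 ^ k) : ℤ)).toNat = 2 * B * 2 ^ k := by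
    have : ((B * 2 ^ k - -(B * 2 ^ k) : ℤ)) = ((2 * B * 2 ^ k : ℕ) : ℤ) := by push_cast; ring
    rw [this, Int.toNat_natCast]
  rw [this]
  push_cast
  rw [← mul_pow, mul_assoc, two_pow_mul_dy, mul_one]

lemma abs_lpt_le {B k : ℕ} {m : Fin d → ℤ} (hm : m ∈ box d B k) (j : Fin d) :
    |lpt k m j| ≤ B := by
  rw [mem_box] at hm
  have h1 : (-(B * 2 ^ k) : ℝ) ≤ m j := by exact_mod_cast (hm j).1
  have h2 : (m j : ℝ) ≤ B * 2 ^ k := by exact_mod_cast (hm j).2.le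
  have h3 := two_pow_mul_dy k
  have h4 := dy_pos k
  rw [lpt_apply, abs_le]
  constructor <;> nlinarith

/-- Truncation of a function to one supported in a ball. -/
def clampFn (R : ℝ) (g : Eucl d → ℝ) (x : Eucl d) : ℝ :=
  max (min (g x - g 0) (max (2 * R - ‖x‖) 0)) (-(max (2 * R - ‖x‖) 0))

lemma clampFn_lipSupp {R : ℝ} {g : Eucl d → ℝ} (hg : LipschitzWith 1 g) :
    LipSupp (2 * R) (clampFn R g) := by
  have hphi : LipschitzWith 1 fun x : Eucl d => max (2 * R - ‖x‖) 0 := by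
    refine LipschitzWith.max_const ?_ 0
    simpa using (LipschitzWith.const (2 * R)).sub (lipschitzWith_one_norm (E := Eucl d))
  constructor
  · have h1 : LipschitzWith 1 fun x => g x - g 0 := by
      simpa using hg.sub (LipschitzWith.const (g 0))
    have h := (h1.min hphi).max hphi.neg
    rw [max_self, max_self] at h
    exact h
  · intro x hx
    have : max (2 * R - ‖x‖) 0 = 0 := max_eq_right (by linarith)
    simp [clampFn, this]

lemma clampFn_eq {R : ℝ} {g : Eucl d → ℝ} (hg : LipschitzWith 1 g) {x : Eucl d} (hx : ‖x‖ ≤ R) :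
    clampFn R g x = g x - g 0 := by
  have h1 : |g x - g 0| ≤ ‖x‖ := by
    have := hg.dist_le_mul x 0
    simpa [Real.dist_eq] using this
  have h2 := abs_le.1 h1
  have h3 : max (2 * R - ‖x‖) 0 = 2 * R - ‖x‖ := max_eq_left (by linarith [norm_nonneg x])
  unfold clampFn
  rw [h3, min_eq_left (by linarith), max_eq_left (by linarith)]

lemma Dsq_clamp {i w B : ℕ} {g : Eucl d → ℝ} (hg : LipschitzWith 1 g) {z : Eucl d}
    (hz : ‖z‖ ≤ 1) {k : ℕ} {m : Fin d → ℤ} (hm : m ∈ box d B k) :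
    Dsq i w (fun v => g (v + z)) k m
      = Dsq i w (fun v => clampFn (d * (B + w + 1) + 1) g (v + z)) k m := by
  have hd := dy_pos k
  have hd1 := dy_le_one k
  have key : ∀ u : Eucl d, (∀ j, |u j| ≤ w + 1) →
      clampFn (d * (B + w + 1) + 1) g (lpt k m + u + z) = g (lpt k m + u + z) - g 0 := by
    intro u hu
    refine clampFn_eq hg ?_
    have h1 : ‖lpt k m + u‖ ≤ d * (B + (w + 1)) := norm_le_of_abs_le fun j => by
      rw [PiLp.add_apply]
      exact (abs_add_le _ _).trans (add_le_add (abs_lpt_le hm j) (hu j))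
    linarith [norm_add_le (lpt k m + u) z]
  have k0 : clampFn (d * (B + w + 1) + 1) g (lpt k m + z) = g (lpt k m + z) - g 0 := by
    simpa using key 0 (by intro j; simp; positivity)
  have k1 : ∀ l, clampFn (d * (B + w + 1) + 1) g (lpt k m + dy k • ev l + z)
      = g (lpt k m + dy k • ev l + z) - g 0 := by
    intro l
    refine key _ fun j => ?_
    rw [PiLp.smul_apply, ev_apply, smul_eq_mul]
    split_ifs
    · rw [mul_one, abs_of_pos hd]; linarith [(Nat.cast_nonneg w : (0 : ℝ) ≤ w)]
    · simp; positivity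
  unfold Dsq
  refine Finset.sum_congr rfl fun a ha => ?_
  have k2 : clampFn (d * (B + w + 1) + 1) g (lpt k m + (dy k * dy i) • zv a + z)
      = g (lpt k m + (dy k * dy i) • zv a + z) - g 0 := by
    refine key _ fun j => ?_
    have h1 : |(a j : ℝ)| ≤ w * 2 ^ i := by exact_mod_cast mem_win.1 ha j
    have h2 := two_pow_mul_dy i
    have h3 := dy_pos i
    rw [PiLp.smul_apply, zv_apply, smul_eq_mul, abs_mul, abs_of_pos (mul_pos hd h3)]
    have h4 : dy i * |(a j : ℝ)| ≤ w := by nlinarith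
    have h5 : (0 : ℝ) ≤ dy i * |(a j : ℝ)| := by positivity
    nlinarith
  simp only [k2, tay, k0, k1]
  simp only [sub_sub_sub_cancel_right]
  congr 3
  abel

variable {ν : Measure (Eucl d)} [ν.IsAddHaarMeasure]

lemma exists_lintegral_Dsq_le (i w B : ℕ) : ∃ C : ℝ≥0∞, C ≠ ⊤ ∧ ∀ g : Eucl d → ℝ,
    LipschitzWith 1 g → ∫⁻ z in closedBall 0 1, ∑' k, ∑ m ∈ box d B k,
      ENNReal.ofReal (dy k ^ d * Dsq i w (fun v => g (v + z)) k m) ∂ν ≤ C := by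
  set R : ℝ := d * (B + w + 1) + 1
  have hs : ∀ a : Fin d → ℤ, SqBdd ν (2 * R) (stencil (d := d) i a) := fun a =>
    sqBdd_fdiff_sum Finset.univ i a ev
  choose hc C hC hb using hs
  refine ⟨ENNReal.ofReal ((2 * B) ^ d) * ∑ a ∈ win d i w, C a, ?_, fun g hg => ?_⟩
  · have : ∑ a ∈ win d i w, C a ≠ ⊤ := by simp [ENNReal.sum_eq_top, hC]
    finiteness
  set G := clampFn R g
  have hG : LipSupp (2 * R) G := clampFn_lipSupp hg
  have hGc := hG.1.continuous
  set φ : (Fin d → ℤ) → ℕ → Eucl d → ℝ≥0∞ := fun a k x =>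
    ENNReal.ofReal ((stencil i a G k x / dy k) ^ 2) with hφ
  have hφm : ∀ a k, Measurable (φ a k) := fun a k =>
    (((hc a G hGc k).div_const _).pow 2).measurable.ennreal_ofReal
  have hterm : ∀ z ∈ closedBall (0 : Eucl d) 1, (∑' k, ∑ m ∈ box d B k,
      ENNReal.ofReal (dy k ^ d * Dsq i w (fun v => g (v + z)) k m)) =
      ∑' k, ∑ m ∈ box d B k, ENNReal.ofReal (dy k ^ d) * ∑ a ∈ win d i w, φ a k (lpt k m + z) := by
    intro z hz
    refine tsum_congr fun k => Finset.sum_congr rfl fun m hm => ?_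
    rw [Dsq_clamp hg (by simpa using hz) hm, Dsq_eq_stencil,
      ENNReal.ofReal_mul (pow_nonneg (dy_pos k).le _),
      ENNReal.ofReal_sum_of_nonneg fun _ _ => sq_nonneg _]
  rw [setLIntegral_congr_fun measurableSet_closedBall hterm]
  have hm0 : ∀ k m a, Measurable fun z => φ a k (lpt k m + z) := fun k m a =>
    (hφm a k).comp (measurable_const_add _)
  have hm1 : ∀ k m, Measurable fun z => ∑ a ∈ win d i w, φ a k (lpt k m + z) := fun k m =>
    Finset.measurable_sum _ fun a _ => hm0 k m a
  rw [lintegral_tsum fun k => (Finset.measurable_sum _ fun m _ =>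
    (hm1 k m).const_mul _).aemeasurable]
  calc _ ≤ ∑' k, ∑ m ∈ box d B k, ENNReal.ofReal (dy k ^ d) *
        ∑ a ∈ win d i w, ∫⁻ x, φ a k x ∂ν := by
        refine ENNReal.tsum_le_tsum fun k => ?_
        rw [lintegral_finsetSum _ fun m _ => (hm1 k m).const_mul _]
        refine Finset.sum_le_sum fun m _ => ?_
        rw [lintegral_const_mul _ (hm1 k m)]
        gcongr
        rw [lintegral_finsetSum _ fun a _ => hm0 k m a]
        refine Finset.sum_le_sum fun a _ => (setLIntegral_le_lintegral _ _).trans ?_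
        exact (lintegral_add_left_eq_self (φ a k) (lpt k m)).le
    _ = ∑' k, ENNReal.ofReal ((2 * B) ^ d) * ∑ a ∈ win d i w, ∫⁻ x, φ a k x ∂ν := by
        refine tsum_congr fun k => ?_
        rw [Finset.sum_const, nsmul_eq_mul, ← mul_assoc]
        congr 1
        rw [← card_box B k, ENNReal.ofReal_mul (by positivity), ENNReal.ofReal_natCast]
    _ = ENNReal.ofReal ((2 * B) ^ d) * ∑ a ∈ win d i w, ∑' k, ∫⁻ x, φ a k x ∂ν := by
        rw [ENNReal.tsum_mul_left]
        congr 1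
        exact Summable.tsum_finsetSum fun _ _ => ENNReal.summable
    _ ≤ _ := by
        gcongr with a _
        exact hb a G hG

lemma tay_apply {n : ℕ} (g : Eucl d → Eucl n) (k : ℕ) (m : Fin d → ℤ) (v : Eucl d) (j : Fin n) :
    tay g k m v j = tay (fun x => g x j) k m v := by
  simp [tay]

lemma Dsq_eq_sum {n : ℕ} (i w : ℕ) (g : Eucl d → Eucl n) (k : ℕ) (m : Fin d → ℤ) :
    Dsq i w g k m = ∑ j, Dsq i w (fun x => g x j) k m := by
  unfold Dsq
  rw [Finset.sum_comm]
  refine Finset.sum_congr rfl fun a _ => ?_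
  rw [div_pow, EuclideanSpace.norm_sq_eq, Finset.sum_div]
  refine Finset.sum_congr rfl fun j _ => ?_
  rw [div_pow, PiLp.sub_apply, tay_apply]

/-- There is a translate for which the lattice square function of the two maps is bounded. -/
lemma exists_translate (n i w B : ℕ) : ∃ C : ℝ, 0 < C ∧ ∀ (g : Eucl d → Eucl n) (f : Eucl d → ℝ),
    LipschitzWith 1 g → LipschitzWith 1 f → ∃ z : Eucl d, ‖z‖ ≤ 1 ∧
      ∑' k, ∑ m ∈ box d B k, ENNReal.ofReal (dy k ^ d * (Dsq i w (fun v => g (v + z)) k m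
        + Dsq i w (fun v => f (v + z)) k m)) ≤ ENNReal.ofReal C := by
  obtain ⟨C, hC, hb⟩ := exists_lintegral_Dsq_le (d := d) (ν := volume) i w B
  set b := (volume : Measure (Eucl d)) (closedBall 0 1) with hbdef
  have hb0 : b ≠ 0 := (measure_closedBall_pos volume 0 one_pos).ne'
  have hbt : b ≠ ⊤ := (isCompact_closedBall _ _).measure_lt_top.ne
  refine ⟨((n + 1) * C / b).toReal + 1, by positivity, fun g f hg hf => ?_⟩
  have hgj : ∀ j, LipschitzWith 1 fun x => g x j := fun j => by
    refine LipschitzWith.of_dist_le_mul fun x y => ?_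
    refine le_trans ?_ (hg.dist_le_mul x y)
    rw [Real.dist_eq, dist_eq_norm]
    exact abs_apply_le_norm (g x - g y) j
  set T : (Eucl d → ℝ) → Eucl d → ℝ≥0∞ := fun f z => ∑' k, ∑ m ∈ box d B k,
    ENNReal.ofReal (dy k ^ d * Dsq i w (fun v => f (v + z)) k m) with hT
  have hTm : ∀ f, Continuous f → Measurable (T f) := by
    intro f hf
    refine Measurable.tsum fun k => Finset.measurable_sum _ fun m _ => ?_
    refine Measurable.ennreal_ofReal (Continuous.measurable ?_)
    unfold Dsq tay
    fun_prop
  have hsum : ∀ z, (∑' k, ∑ m ∈ box d B k, ENNReal.ofReal (dy k ^ d *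
      (Dsq i w (fun v => g (v + z)) k m + Dsq i w (fun v => f (v + z)) k m)))
      = ∑ j, T (fun x => g x j) z + T f z := by
    intro z
    simp only [hT]
    rw [← Summable.tsum_finsetSum fun _ _ => ENNReal.summable, ← ENNReal.tsum_add]
    refine tsum_congr fun k => ?_
    rw [Finset.sum_comm, ← Finset.sum_add_distrib]
    refine Finset.sum_congr rfl fun m _ => ?_
    have hd : 0 ≤ dy k ^ d := pow_nonneg (dy_pos k).le _
    rw [mul_add, ENNReal.ofReal_add (mul_nonneg hd (Dsq_nonneg ..))
      (mul_nonneg hd (Dsq_nonneg ..)), Dsq_eq_sum, Finset.mul_sum,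
      ENNReal.ofReal_sum_of_nonneg fun _ _ => mul_nonneg hd (Dsq_nonneg ..)]
  have hint : ∫⁻ z in closedBall 0 1, (∑ j, T (fun x => g x j) z + T f z) ≤ (n + 1) * C := by
    rw [lintegral_add_right _ (hTm f hf.continuous),
      lintegral_finsetSum _ fun j _ => hTm _ (hgj j).continuous, add_mul, one_mul]
    refine add_le_add ((Finset.sum_le_sum fun j _ => hb _ (hgj j)).trans ?_) (hb f hf)
    simp
  have hfin : ∫⁻ z in closedBall (0 : Eucl d) 1, (∑ j, T (fun x => g x j) z + T f z) ≠ ⊤ :=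
    ne_top_of_le_ne_top (by finiteness) hint
  obtain ⟨z, hz, hle⟩ := exists_le_setLAverage (μ := volume) hb0 hbt
    ((Finset.measurable_sum _ fun j _ => hTm _ (hgj j).continuous).add
      (hTm f hf.continuous)).aemeasurable (f := fun z => ∑ j, T (fun x => g x j) z + T f z)
  refine ⟨z, by simpa using hz, ?_⟩
  rw [hsum]
  refine hle.trans ?_
  rw [setLAverage_eq]
  have hne : (n + 1) * C / b ≠ ⊤ := ENNReal.div_ne_top (by finiteness) hb0
  calc _ ≤ (n + 1) * C / b := by gcongr
    _ = ENNReal.ofReal ((n + 1) * C / b).toReal := (ENNReal.ofReal_toReal hne).symm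
    _ ≤ _ := ENNReal.ofReal_le_ofReal (by linarith)

end Choice

section Coloring

variable {V Γ : Type*} [MeasurableSpace V] {ν : Measure V} [Fintype Γ] [Nonempty Γ]

open Classical in
/-- The cardinality of the colour set to the number of bad generations below `k`. -/
def colWt (Γ : Type*) [Fintype Γ] (bad : ℕ → Set V) (k : ℕ) (v : V) : ℝ≥0∞ :=
  ∏ j ∈ Finset.range k, if v ∈ bad j then (Fintype.card Γ : ℝ≥0∞) else 1

lemma measurable_colWt {bad : ℕ → Set V} (hb : ∀ k, MeasurableSet (bad k)) (k : ℕ) :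
    Measurable (colWt Γ bad k) := by
  classical
  unfold colWt
  exact Finset.measurable_prod _ fun j _ => Measurable.ite (hb j) measurable_const measurable_const

lemma colWt_le {bad : ℕ → Set V} {M : ℕ} {v : V}
    (hM : ∀ F : Finset ℕ, (∀ k ∈ F, v ∈ bad k) → F.card ≤ M) (k : ℕ) :
    colWt Γ bad k v ≤ (Fintype.card Γ : ℝ≥0∞) ^ M := by
  classical
  unfold colWt
  rw [← Finset.prod_filter, Finset.prod_const]
  refine pow_le_pow_right₀ ?_ (hM _ (by simp))
  exact_mod_cast (Fintype.card_pos : 0 < Fintype.card Γ)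

/-- The part of `A` whose colour in a bad generation is `γ`. -/
def colPart (bad : Set V) (col : V → Γ) (A : Set V) (γ : Γ) : Set V :=
  {v ∈ A | v ∈ bad → col v = γ}

lemma measurableSet_colPart {bad A : Set V} {col : V → Γ} (hb : MeasurableSet bad)
    (hc : ∀ γ, MeasurableSet {v | col v = γ}) (hA : MeasurableSet A) (γ : Γ) :
    MeasurableSet (colPart bad col A γ) := by
  have : colPart bad col A γ = A ∩ (badᶜ ∪ {v | col v = γ}) := by
    ext v
    simp only [colPart, imp_iff_not_or, mem_ofPred_eq, mem_inter_iff, mem_union, mem_compl_iff]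
  rw [this]
  exact hA.inter (hb.compl.union (hc γ))

lemma exists_color_step {bad : ℕ → Set V} {col : ℕ → V → Γ} (hb : ∀ k, MeasurableSet (bad k))
    (hc : ∀ k γ, MeasurableSet {v | col k v = γ}) (k : ℕ) {A : Set V} (hA : MeasurableSet A) :
    ∃ γ, ∫⁻ v in A, colWt Γ bad k v ∂ν
      ≤ ∫⁻ v in colPart (bad k) (col k) A γ, colWt Γ bad (k + 1) v ∂ν := by
  classical
  by_contra! hcon
  have hcard : (Fintype.card Γ : ℝ≥0∞) ≠ 0 := by exact_mod_cast Fintype.card_ne_zero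
  have hsum : ∑ γ, ∫⁻ v in colPart (bad k) (col k) A γ, colWt Γ bad (k + 1) v ∂ν
      = Fintype.card Γ * ∫⁻ v in A, colWt Γ bad k v ∂ν := by
    have hm := measurable_colWt (Γ := Γ) hb
    have hP := fun γ => measurableSet_colPart (hb k) (hc k) hA γ
    simp_rw [← lintegral_indicator (hP _)]
    rw [← lintegral_indicator hA, ← lintegral_finsetSum _ fun γ _ => (hm _).indicator (hP γ),
      ← lintegral_const_mul _ ((hm k).indicator hA)]
    congr 1
    ext v
    by_cases hvA : v ∈ A
    · rw [indicator_of_mem hvA]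
      by_cases hvb : v ∈ bad k
      · rw [Finset.sum_eq_single (col k v)]
        · rw [indicator_of_mem (by simp [colPart, hvA])]
          simp only [colWt]
          rw [Finset.prod_range_succ, if_pos hvb, mul_comm]
        · intro γ _ hγ
          exact indicator_of_notMem (fun h => hγ (h.2 hvb).symm) _
        · simp
      · have : ∀ γ, (colPart (bad k) (col k) A γ).indicator (colWt Γ bad (k + 1)) v
            = colWt Γ bad k v := by
          intro γ
          have hv : v ∈ colPart (bad k) (col k) A γ := ⟨hvA, fun h => absurd h hvb⟩
          rw [indicator_of_mem hv]
          simp only [colWt]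
          rw [Finset.prod_range_succ, if_neg hvb, mul_one]
        simp [this]
    · rw [indicator_of_notMem hvA, mul_zero]
      exact Finset.sum_eq_zero fun γ _ => indicator_of_notMem (fun h => hvA h.1) _
  have hlt : ∑ γ, ∫⁻ v in colPart (bad k) (col k) A γ, colWt Γ bad (k + 1) v ∂ν
      < ∑ _γ : Γ, ∫⁻ v in A, colWt Γ bad k v ∂ν :=
    ENNReal.sum_lt_sum_of_nonempty Finset.univ_nonempty fun γ _ => hcon γ
  rw [hsum] at hlt
  simp at hlt

/-- If every point of `S` is bad in at most `M` generations, one can prescribe the colours of the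
bad generations while keeping a fixed proportion of `S`. -/
lemma exists_coloring {bad : ℕ → Set V} {col : ℕ → V → Γ} (hb : ∀ k, MeasurableSet (bad k))
    (hc : ∀ k γ, MeasurableSet {v | col k v = γ}) {S : Set V} (hS : MeasurableSet S)
    (hSf : ν S ≠ ⊤) {M : ℕ}
    (hM : ∀ v ∈ S, ∀ F : Finset ℕ, (∀ k ∈ F, v ∈ bad k) → F.card ≤ M) :
    ∃ ω : ℕ → Γ, MeasurableSet {v ∈ S | ∀ k, v ∈ bad k → col k v = ω k} ∧
      ν S ≤ (Fintype.card Γ : ℝ≥0∞) ^ M * ν {v ∈ S | ∀ k, v ∈ bad k → col k v = ω k} := by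
  choose! γ hγ using fun (k : ℕ) (A : Set V) (hA : MeasurableSet A) =>
    exists_color_step (ν := ν) hb hc k hA
  let A : ℕ → Set V := fun k => Nat.rec S (fun k A => colPart (bad k) (col k) A (γ k A)) k
  have hAs : ∀ k, A (k + 1) = colPart (bad k) (col k) (A k) (γ k (A k)) := fun _ => rfl
  have hAm : ∀ k, MeasurableSet (A k) := by
    intro k
    induction k with
    | zero => exact hS
    | succ k ih => rw [hAs]; exact measurableSet_colPart (hb k) (hc k) ih _
  have hI : ∀ k, ν S ≤ ∫⁻ v in A k, colWt Γ bad k v ∂ν := by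
    intro k
    induction k with
    | zero => simp [A, colWt]
    | succ k ih => rw [hAs]; exact ih.trans (hγ k (A k) (hAm k))
  have hanti : Antitone A := antitone_nat_of_succ_le fun k => by
    rw [hAs]; exact fun v hv => hv.1
  have hAS : ∀ k, A k ⊆ S := fun k => hanti (Nat.zero_le k)
  have heq : {v ∈ S | ∀ k, v ∈ bad k → col k v = γ k (A k)} = ⋂ k, A k := by
    ext v
    simp only [mem_ofPred_eq, mem_iInter]
    constructor
    · rintro ⟨hv, h⟩ k
      induction k with
      | zero => exact hv
      | succ k ih => rw [hAs]; exact ⟨ih, h k⟩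
    · intro h
      refine ⟨h 0, fun k hk => ?_⟩
      have := h (k + 1)
      rw [hAs] at this
      exact this.2 hk
  refine ⟨fun k => γ k (A k), ?_, ?_⟩
  · rw [heq]; exact MeasurableSet.iInter hAm
  rw [heq, hanti.measure_iInter (fun k => (hAm k).nullMeasurableSet) ⟨0, hSf⟩, ENNReal.mul_iInf_of_ne
    (by simp) (by finiteness)]
  refine le_iInf fun k => (hI k).trans ?_
  calc ∫⁻ v in A k, colWt Γ bad k v ∂ν ≤ ∫⁻ _ in A k, (Fintype.card Γ : ℝ≥0∞) ^ M ∂ν :=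
        setLIntegral_mono' (hAm k) fun v hv => colWt_le (hM v (hAS k hv)) k
    _ = _ := by simp

end Coloring

section BigPieces

lemma sum_le_of_eventually_le {f g : ℕ → ℝ≥0∞} {C N : ℝ≥0∞} {A : Finset ℕ} {l e b : ℕ}
    (hA : ∀ k ∈ A, l ≤ k + b) (hf : ∀ k ∈ A, f k ≤ C) (hfg : ∀ k, l + e + k ∈ A → f (l + e + k) ≤ g k)
    (hg : ∑' k, g k ≤ N) : ∑ k ∈ A, f k ≤ (e + b : ℕ) * C + N := by
  classical
  rw [← Finset.sum_filter_add_sum_filter_not A (fun k => k < l + e)]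
  refine add_le_add ?_ ?_
  · have hc : (A.filter fun k => k < l + e).card ≤ e + b := by
      have hsub : (A.filter fun k => k < l + e) ⊆ Finset.Ico (l - b) (l + e) := by
        intro k hk
        rw [Finset.mem_filter] at hk
        have := hA k hk.1
        rw [Finset.mem_Ico]; omega
      have := Finset.card_le_card hsub
      rw [Nat.card_Ico] at this
      omega
    calc _ ≤ ∑ k ∈ A.filter fun k => k < l + e, C :=
          Finset.sum_le_sum fun k hk => hf k (Finset.mem_filter.1 hk).1
      _ = (A.filter fun k => k < l + e).card * C := by rw [Finset.sum_const, nsmul_eq_mul]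
      _ ≤ _ := by gcongr
  · refine le_trans ?_ hg
    calc _ ≤ ∑ k ∈ A.filter fun k => ¬ k < l + e, g (k - (l + e)) := by
          refine Finset.sum_le_sum fun k hk => ?_
          rw [Finset.mem_filter] at hk
          have := hfg (k - (l + e)) (by rw [Nat.add_sub_cancel' (by omega)]; exact hk.1)
          rwa [Nat.add_sub_cancel' (by omega)] at this
      _ = ∑ k ∈ (A.filter fun k => ¬ k < l + e).image (fun k => k - (l + e)), g k := by
          rw [Finset.sum_image]
          intro a ha b hb h
          simp only [Finset.coe_filter, mem_ofPred_eq] at ha hb h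
          omega
      _ ≤ _ := ENNReal.sum_le_tsum _

variable {X : Type*} [MetricSpace X] [MeasurableSpace X] [BorelSpace X]

open Classical in
/-- The generations below `N` whose ball around `x` is contained in `U`. -/
def admGen (t : ℕ → ℝ) (N : ℕ) (U : Set X) (x : X) : Finset ℕ :=
  (Finset.range N).filter fun k => ball x (t k) ⊆ U

lemma mem_admGen {t : ℕ → ℝ} {N : ℕ} {U : Set X} {x : X} {k : ℕ} :
    k ∈ admGen t N U x ↔ k < N ∧ ball x (t k) ⊆ U := by
  simp [admGen]

variable {σ : Measure X} {E : Set X} {Φ : X → ℕ → ℝ≥0∞} {R : ℝ}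

/-- Hypotheses of the big-pieces iteration: `Φ` is bounded, almost monotone in the ball, and
every surface ball contains a compact big piece on which the sum of `Φ` is bounded. -/
structure BigPieces (σ : Measure X) (E : Set X) (Φ : X → ℕ → ℝ≥0∞) (R : ℝ) (l₀ c₀ : ℕ)
    (Q M C : ℝ≥0∞) : Prop where
  radius_pos : 0 < R
  carried : ∀ A B : Set X, MeasurableSet A → MeasurableSet B → A ∩ E ⊆ B → σ A ≤ σ B
  bdd : ∀ x k, Φ x k ≤ C
  comp : ∀ x y k, dist x y < R * dy (k + 1) → Φ x (k + 1) ≤ C * Φ y k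
  piece : ∀ x ∈ E, ∀ l, l₀ ≤ l → ∃ G, IsCompact G ∧ G ⊆ closedBall x (R * dy l) ∧
    σ (closedBall x (5 * (R * dy l))) ≤ Q * σ G ∧ ∀ y ∈ G, ∑' k, Φ y (l + c₀ + k) ≤ M

/-- The constant of one iteration step. -/
def stepConst (l₀ c₀ : ℕ) (M C : ℝ≥0∞) : ℝ≥0∞ :=
  (c₀ + (l₀ + 2) : ℕ) * C + M + (((c₀ + 1) + (l₀ + 2) : ℕ) * C + C * M + C)

section Step

variable {l₀ c₀ : ℕ} {Q M C : ℝ≥0∞}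

lemma BigPieces.exists_finite_pieces [TopologicalSpace.SeparableSpace X]
    (h : BigPieces σ E Φ R l₀ c₀ Q M C) {U : Set X} (hU : IsOpen U) (hUf : σ U ≠ ⊤) :
    ∃ G, IsCompact G ∧ G ⊆ U ∧ σ U ≤ 2 * Q * σ G ∧
      ∀ y ∈ G, ∃ l, (∀ k, ball y (R * dy (k + 1)) ⊆ U → l ≤ k + (l₀ + 2)) ∧
        (∀ k, ball y (R * dy k) ⊆ U → l ≤ k + (l₀ + 2)) ∧ ∑' k, Φ y (l + c₀ + k) ≤ M := by
  classical
  have hR := h.radius_pos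
  have hex : ∀ x ∈ E ∩ U, ∃ l, l₀ ≤ l ∧ closedBall x (R * dy l) ⊆ U := by
    rintro x ⟨_, hx⟩
    obtain ⟨ε, hε, hb⟩ := Metric.isOpen_iff.1 hU x hx
    obtain ⟨l, hl⟩ := exists_pow_lt_of_lt_one (div_pos hε hR) (show (1 / 2 : ℝ) < 1 by norm_num)
    refine ⟨max l₀ l, le_max_left _ _, (closedBall_subset_ball ?_).trans hb⟩
    have h1 : dy (max l₀ l) ≤ dy l := dy_anti (le_max_right _ _)
    have h2 : dy l < ε / R := hl
    calc R * dy (max l₀ l) ≤ R * dy l := by gcongr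
      _ < R * (ε / R) := by gcongr
      _ = ε := by field_simp
  let L : X → ℕ := fun x => if hx : x ∈ E ∩ U then Nat.find (hex x hx) else 0
  have hL : ∀ x ∈ E ∩ U, l₀ ≤ L x ∧ closedBall x (R * dy (L x)) ⊆ U := by
    intro x hx
    simp only [L, dif_pos hx]
    exact Nat.find_spec (hex x hx)
  have hLmin : ∀ x ∈ E ∩ U, ∀ l, l < L x → l₀ ≤ l → ¬ closedBall x (R * dy l) ⊆ U := by
    intro x hx l hl h0 hs
    simp only [L, dif_pos hx] at hl
    exact Nat.find_min (hex x hx) hl ⟨h0, hs⟩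
  obtain ⟨u, huE, hdisj, hcov⟩ := Vitali.exists_disjoint_subfamily_covering_enlargement_closedBall
    (E ∩ U) (fun x => x) (fun x => R * dy (L x)) R
    (fun x _ => by nlinarith [dy_le_one (L x)]) 5 (by norm_num)
  have hpos : ∀ x, 0 < R * dy (L x) := fun x => mul_pos hR (dy_pos _)
  have hcount : u.Countable := hdisj.countable_of_nonempty_interior fun x _ =>
    ⟨x, ball_subset_interior_closedBall (mem_ball_self (hpos x))⟩
  choose! G hGc hGb hGQ hGM using fun x (hx : x ∈ E ∩ U) => h.piece x hx.1 (L x) (hL x hx).1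
  have hGm : ∀ x ∈ u, MeasurableSet (G x) := fun x hx => (hGc x (huE hx)).measurableSet
  have hGd : u.PairwiseDisjoint G := fun x hx y hy hxy =>
    (hdisj hx hy hxy).mono (hGb x (huE hx)) (hGb y (huE hy))
  have hle : σ U ≤ Q * ∑' x : u, σ (G x) := by
    calc σ U ≤ σ (⋃ x ∈ u, closedBall x (5 * (R * dy (L x)))) := by
          refine h.carried _ _ hU.measurableSet
            (MeasurableSet.biUnion hcount fun _ _ => measurableSet_closedBall) ?_
          rintro x ⟨hxU, hxE⟩
          obtain ⟨b, hb, hs⟩ := hcov x ⟨hxE, hxU⟩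
          exact mem_biUnion hb (hs (mem_closedBall_self (hpos x).le))
      _ ≤ ∑' x : u, σ (closedBall x (5 * (R * dy (L x)))) := measure_biUnion_le σ hcount _
      _ ≤ ∑' x : u, Q * σ (G x) := ENNReal.tsum_le_tsum fun x => hGQ x (huE x.2)
      _ = _ := ENNReal.tsum_mul_left
  have hsumU : ∑' x : u, σ (G x) ≤ σ U := by
    rw [← measure_biUnion hcount hGd hGm]
    exact measure_mono (iUnion₂_subset fun x hx => (hGb x (huE hx)).trans (hL x (huE hx)).2)
  have hfinset : ∃ F : Finset u, ∑' x : u, σ (G x) ≤ 2 * ∑ x ∈ F, σ (G x) := by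
    set T := ∑' x : u, σ (G x) with hT
    by_cases hT0 : T = 0
    · exact ⟨∅, by simp [hT0]⟩
    have hTf : T ≠ ⊤ := ne_top_of_le_ne_top hUf hsumU
    have hlt : T / 2 < ∑' x : u, σ (G x) := ENNReal.half_lt_self hT0 hTf
    rw [ENNReal.tsum_eq_iSup_sum] at hlt
    obtain ⟨F, hF⟩ := lt_iSup_iff.1 hlt
    refine ⟨F, ?_⟩
    rw [← ENNReal.div_le_iff' (by norm_num) (by norm_num)]
    exact hF.le
  obtain ⟨F, hF⟩ := hfinset
  refine ⟨⋃ x ∈ F, G x, F.isCompact_biUnion fun x _ => hGc x (huE x.2),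
    iUnion₂_subset fun x _ => (hGb x (huE x.2)).trans (hL x (huE x.2)).2, ?_, ?_⟩
  · rw [measure_biUnion_finset]
    · calc σ U ≤ Q * ∑' x : u, σ (G x) := hle
        _ ≤ Q * (2 * ∑ x ∈ F, σ (G x)) := by gcongr
        _ = _ := by ring
    · intro x _ y _ hxy
      exact hGd x.2 y.2 fun e => hxy (Subtype.ext e)
    · exact fun x _ => hGm x x.2
  · intro y hy
    obtain ⟨b, hb, hyb⟩ := mem_iUnion₂.1 hy
    have hbE := huE b.2
    have hmain : ∀ k, ball (y : X) (R * dy (k + 1)) ⊆ U → L b ≤ k + (l₀ + 2) := by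
      intro k hk
      by_contra hcon
      push Not at hcon
      refine hLmin b hbE (L b - 1) (by omega) (by omega) fun z hz => hk ?_
      have h1 := hGb b hbE hyb
      rw [mem_closedBall] at h1 hz
      rw [mem_ball]
      have h2 : L b = (L b - 1) + 1 := by omega
      have h3 : dy (L b - 1) ≤ dy (k + 2) := dy_anti (by omega)
      rw [h2, dy_succ] at h1
      rw [dy_succ] at h3
      have h4 := dist_triangle_right z y b
      have h5 := mul_le_mul_of_nonneg_left h3 hR.le
      have h6 : 0 < R * dy (k + 1) := mul_pos hR (dy_pos _)
      have h7 : 0 < R * dy (L b - 1) := mul_pos hR (dy_pos _)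
      nlinarith
    refine ⟨L b, hmain, fun k hk => ?_, hGM b hbE y hyb⟩
    refine hmain k (Subset.trans (ball_subset_ball ?_) hk)
    have := dy_anti (Nat.le_succ k)
    gcongr

lemma BigPieces.step [TopologicalSpace.SeparableSpace X]
    (h : BigPieces σ E Φ R l₀ c₀ Q M C) (N : ℕ) {U : Set X} (hU : IsOpen U) (hUf : σ U ≠ ⊤) :
    ∃ U' G, IsOpen U' ∧ U' ⊆ U ∧ σ U = σ G + σ U' ∧ σ U ≤ 2 * Q * σ G ∧
      ∫⁻ x in U, ∑ k ∈ admGen (fun k => R * dy k) N U x, Φ x k ∂σ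
        ≤ stepConst l₀ c₀ M C * σ U +
          ∫⁻ x in U', ∑ k ∈ admGen (fun k => R * dy k) N U' x, Φ x k ∂σ := by
  classical
  have hR := h.radius_pos
  obtain ⟨G, hGc, hGU, hGσ, hG⟩ := h.exists_finite_pieces hU hUf
  have hsplit : σ U = σ G + σ (U \ G) := by
    rw [← measure_inter_add_sdiff U hGc.measurableSet, inter_eq_right.2 hGU]
  refine ⟨U \ G, G, hU.sdiff hGc.isClosed, sdiff_subset, hsplit, hGσ, ?_⟩
  set S : Set X → X → ℝ≥0∞ := fun U x => ∑ k ∈ admGen (fun k => R * dy k) N U x, Φ x k with hS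
  have hSG : ∀ y ∈ G, S U y ≤ stepConst l₀ c₀ M C := by
    intro y hy
    obtain ⟨l, _, hl, hM⟩ := hG y hy
    refine (sum_le_of_eventually_le (C := C) (e := c₀) (b := l₀ + 2)
      (fun k hk => hl k (mem_admGen.1 hk).2) (fun k _ => h.bdd y k) (fun k _ => le_rfl) hM).trans ?_
    unfold stepConst
    exact le_self_add
  have hSU : ∀ x ∈ U \ G, S U x ≤ stepConst l₀ c₀ M C + S (U \ G) x := by
    intro x hx
    set A := (admGen (fun k => R * dy k) N U x).filter
      fun k => k ∉ admGen (fun k => R * dy k) N (U \ G) x with hA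
    have hsub : S U x ≤ ∑ k ∈ A, Φ x k + S (U \ G) x := by
      simp only [hS]
      rw [← Finset.sum_filter_not_add_sum_filter _
        fun k => k ∈ admGen (fun k => R * dy k) N (U \ G) x]
      gcongr
      intro k hk
      exact (Finset.mem_filter.1 hk).2
    refine hsub.trans (add_le_add_left ?_ _)
    by_cases hAe : A.Nonempty
    swap
    · rw [Finset.not_nonempty_iff_eq_empty.1 hAe]; simp
    set K := A.max' hAe
    have hK : (K < N ∧ ball x (R * dy K) ⊆ U) ∧ ¬(K < N ∧ ball x (R * dy K) ⊆ U \ G) := by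
      have := Finset.mem_filter.1 (A.max'_mem hAe)
      rwa [mem_admGen, mem_admGen] at this
    obtain ⟨⟨hKN, hKU⟩, hKG⟩ := hK
    have : ∃ y ∈ G, dist y x < R * dy K := by
      by_contra! hcon
      exact hKG ⟨hKN, fun z hz => ⟨hKU hz, fun hzG => absurd hz (not_lt.2 (hcon z hzG))⟩⟩
    obtain ⟨y, hyG, hyx⟩ := this
    obtain ⟨l, hl, _, hM⟩ := hG y hyG
    rw [show ∑ k ∈ A, Φ x k = Φ x K + ∑ k ∈ A.erase K, Φ x k from
      (Finset.add_sum_erase A (Φ x) (A.max'_mem hAe)).symm]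
    have hAprop : ∀ k ∈ A, dist x y < R * dy k ∧ ball x (R * dy k) ⊆ U := by
      intro k hk
      have hkU := (mem_admGen.1 (Finset.mem_filter.1 hk).1).2
      refine ⟨?_, hkU⟩
      rw [dist_comm]
      refine hyx.trans_le ?_
      have := dy_anti (A.le_max' k hk)
      gcongr
    have hAl : ∀ k ∈ A.erase K, l ≤ k + (l₀ + 2) := by
      intro k hk
      rw [Finset.mem_erase] at hk
      refine hl k fun z hz => (hAprop k hk.2).2 ?_
      have hkK : k < K := lt_of_le_of_ne (A.le_max' k hk.2) hk.1
      have h1 := dy_anti (show k + 1 ≤ K from hkK)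
      have h2 := mul_le_mul_of_nonneg_left h1 hR.le
      rw [mem_ball] at hz ⊢
      rw [dy_succ] at hz h2
      have := dist_triangle z y x
      linarith
    have hsum := sum_le_of_eventually_le (f := Φ x) (g := fun k => C * Φ y (l + c₀ + k))
      (N := C * M) (e := c₀ + 1) hAl (fun k _ => h.bdd x k)
      (fun k hk => ?_) (by rw [ENNReal.tsum_mul_left]; gcongr)
    · calc _ ≤ C + (((c₀ + 1) + (l₀ + 2) : ℕ) * C + C * M) := add_le_add (h.bdd _ _) hsum
        _ = ((c₀ + 1) + (l₀ + 2) : ℕ) * C + C * M + C := add_comm _ _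
        _ ≤ _ := le_add_self
    · have := hAprop _ (Finset.mem_of_mem_erase hk)
      have e : l + (c₀ + 1) + k = (l + c₀ + k) + 1 := by ring
      rw [e] at this ⊢
      exact h.comp x y _ this.1
  have hGm := hGc.measurableSet
  calc ∫⁻ x in U, S U x ∂σ = ∫⁻ x in U ∩ G, S U x ∂σ + ∫⁻ x in U \ G, S U x ∂σ :=
        (lintegral_inter_add_sdiff _ _ hGm).symm
    _ ≤ ∫⁻ _ in G, stepConst l₀ c₀ M C ∂σ
        + ∫⁻ x in U \ G, (stepConst l₀ c₀ M C + S (U \ G) x) ∂σ := by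
        rw [inter_eq_right.2 hGU]
        exact add_le_add (setLIntegral_mono' hGm hSG)
          (setLIntegral_mono' (hU.measurableSet.diff hGm) hSU)
    _ = stepConst l₀ c₀ M C * σ G + (stepConst l₀ c₀ M C * σ (U \ G)
        + ∫⁻ x in U \ G, S (U \ G) x ∂σ) := by
        rw [lintegral_add_left measurable_const]; simp
    _ = _ := by rw [hsplit]; ring

/-- Big pieces on which `Φ` is summable yield the Carleson bound for `Φ`. -/
lemma BigPieces.carleson [TopologicalSpace.SeparableSpace X]
    (h : BigPieces σ E Φ R l₀ c₀ Q M C) (hQ : 1 ≤ Q) (hQt : Q ≠ ⊤) (hCt : C ≠ ⊤) (N : ℕ)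
    {U : Set X} (hU : IsOpen U) (hUf : σ U ≠ ⊤) :
    ∫⁻ x in U, ∑ k ∈ admGen (fun k => R * dy k) N U x, Φ x k ∂σ
      ≤ 2 * Q * stepConst l₀ c₀ M C * σ U := by
  set K := stepConst l₀ c₀ M C
  set θ : ℝ≥0∞ := 1 - (2 * Q)⁻¹ with hθ
  have hQ0 : 2 * Q ≠ 0 := mul_ne_zero two_ne_zero (zero_lt_one.trans_le hQ).ne'
  have hQt2 : 2 * Q ≠ ⊤ := by finiteness
  have hθ1 : θ < 1 := ENNReal.sub_lt_self (by simp) (by simp) (by simp [hQt2])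
  have claim : ∀ p : ℕ, ∀ U : Set X, IsOpen U → σ U ≠ ⊤ →
      ∫⁻ x in U, ∑ k ∈ admGen (fun k => R * dy k) N U x, Φ x k ∂σ
        ≤ 2 * Q * K * σ U + N * C * (θ ^ p * σ U) := by
    intro p
    induction p with
    | zero =>
      intro U hU hUf
      calc _ ≤ ∫⁻ _ in U, N * C ∂σ := by
            refine lintegral_mono fun x => ?_
            calc _ ≤ ∑ _k ∈ admGen (fun k => R * dy k) N U x, C :=
                  Finset.sum_le_sum fun k _ => h.bdd x k
              _ = (admGen (fun k => R * dy k) N U x).card * C := by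
                  rw [Finset.sum_const, nsmul_eq_mul]
              _ ≤ N * C := by
                  gcongr
                  refine (Finset.card_le_card fun k hk => ?_).trans (Finset.card_range N).le
                  exact Finset.mem_range.2 (mem_admGen.1 hk).1
        _ = N * C * σ U := by simp
        _ ≤ _ := by simp
    | succ p ih =>
      intro U hU hUf
      obtain ⟨U', G, hU', hsub, hsplit, hG, hle⟩ := h.step N hU hUf
      have hUf' : σ U' ≠ ⊤ := ne_top_of_le_ne_top hUf (measure_mono hsub)
      have hθU : σ U' ≤ θ * σ U := by
        have h1 : (2 * Q)⁻¹ * σ U ≤ σ G := by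
          rw [mul_comm, ← ENNReal.div_eq_inv_mul.trans (mul_comm _ _),
            ENNReal.div_le_iff' hQ0 hQt2]
          exact hG
        have h2 : σ U' = σ U - σ G := by
          rw [hsplit, ENNReal.add_sub_cancel_left]
          exact ne_top_of_le_ne_top hUf (hsplit ▸ le_self_add)
        rw [h2, hθ, ENNReal.sub_mul (fun _ _ => hUf), one_mul]
        exact tsub_le_tsub_left h1 _
      calc _ ≤ K * σ U + ∫⁻ x in U', ∑ k ∈ admGen (fun k => R * dy k) N U' x, Φ x k ∂σ := hle
        _ ≤ K * (2 * Q * σ G) + (2 * Q * K * σ U' + N * C * (θ ^ p * σ U')) := by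
            gcongr
            exact ih U' hU' hUf'
        _ = 2 * Q * K * (σ G + σ U') + N * C * (θ ^ p * σ U') := by ring
        _ ≤ 2 * Q * K * σ U + N * C * (θ ^ p * (θ * σ U)) := by
            rw [← hsplit]; gcongr
        _ = _ := by rw [pow_succ]; ring
  have hlim : Filter.Tendsto (fun p : ℕ => 2 * Q * K * σ U + N * C * (θ ^ p * σ U)) Filter.atTop
      (nhds (2 * Q * K * σ U + N * C * (0 * σ U))) := by
    refine Filter.Tendsto.const_add _ (ENNReal.Tendsto.const_mul
      (ENNReal.Tendsto.mul_const (ENNReal.tendsto_pow_atTop_nhds_zero_of_lt_one hθ1) (Or.inr hUf))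
      (Or.inr (by finiteness)))
  rw [zero_mul, mul_zero, add_zero] at hlim
  exact ge_of_tendsto' hlim fun p => claim p U hU hUf

end Step

end BigPieces

section Cubes

variable {d : ℕ}

/-- The half-open dyadic cube of generation `k` with index `m`. -/
def cube (k : ℕ) (m : Fin d → ℤ) : Set (Eucl d) := {v | idx k v = m}

lemma idx_lpt (k : ℕ) (m : Fin d → ℤ) : idx k (lpt k m) = m := by
  funext i
  have := dy_ne k
  simp [idx, this]

lemma dy_le_mul {j k : ℕ} (h : j ≤ k) : dy k * 2 ^ (k - j) = dy j := by
  obtain ⟨e, rfl⟩ := Nat.exists_eq_add_of_le h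
  rw [Nat.add_sub_cancel_left, dy_add, mul_assoc]
  have : dy e * 2 ^ e = 1 := by unfold dy; rw [← mul_pow]; norm_num
  rw [this, mul_one]

lemma idx_eq_div {j k : ℕ} (h : j ≤ k) (v : Eucl d) (i : Fin d) :
    idx j v i = idx k v i / ((2 ^ (k - j) : ℕ) : ℤ) := by
  unfold idx
  rw [← Int.floor_div_natCast, div_div, ← dy_le_mul h]
  norm_num

lemma idx_nest {j k : ℕ} (h : j ≤ k) {v v' : Eucl d} (hv : idx k v = idx k v') :
    idx j v = idx j v' := by
  funext i
  rw [idx_eq_div h, idx_eq_div h, hv]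

lemma measurable_idx (k : ℕ) : Measurable (idx k : Eucl d → Fin d → ℤ) := by
  refine measurable_pi_iff.2 fun i => Int.measurable_floor.comp ?_
  exact Measurable.div_const (by fun_prop) _

lemma measurableSet_cube (k : ℕ) (m : Fin d → ℤ) : MeasurableSet (cube k m) :=
  measurable_idx k (measurableSet_singleton m)

lemma abs_sub_lpt_idx (k : ℕ) (v : Eucl d) (i : Fin d) :
    |v i - lpt k (idx k v) i| ≤ dy k := by
  have h1 := idx_le k v i
  have h2 := lt_idx k v i
  rw [lpt_apply, abs_le]
  constructor <;> linarith [dy_pos k]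

lemma norm_sub_lpt_idx (k : ℕ) (v : Eucl d) : ‖v - lpt k (idx k v)‖ ≤ d * dy k :=
  norm_le_of_abs_le fun i => by simpa using abs_sub_lpt_idx k v i

lemma abs_idx_sub_le {k c : ℕ} {v w : Eucl d} {i : Fin d} (h : |v i - w i| ≤ c * dy k) :
    |idx k v i - idx k w i| ≤ c + 1 := by
  have h1 := idx_le k v i
  have h2 := lt_idx k v i
  have h3 := idx_le k w i
  have h4 := lt_idx k w i
  have hk := dy_pos k
  rw [abs_le] at h
  have a1 : ((idx k v i : ℤ) : ℝ) - idx k w i < c + 1 := by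
    by_contra! hc
    nlinarith
  have a2 : ((idx k w i : ℤ) : ℝ) - idx k v i < c + 1 := by
    by_contra! hc
    nlinarith
  have b1 : idx k v i - idx k w i < c + 1 := by exact_mod_cast a1
  have b2 : idx k w i - idx k v i < c + 1 := by exact_mod_cast a2
  rw [abs_le]
  constructor <;> omega

lemma le_abs_idx_sub {k : ℕ} {v w : Eucl d} {i : Fin d} (h : 2 * dy k ≤ |v i - w i|) :
    1 ≤ |idx k v i - idx k w i| := by
  by_contra! hc
  have he : idx k v i = idx k w i := by
    have := Int.abs_lt_one_iff.1 hc
    omega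
  have h1 := idx_le k v i
  have h2 := lt_idx k v i
  have h3 := idx_le k w i
  have h4 := lt_idx k w i
  rw [he] at h1 h2
  have hk := dy_pos k
  rcases le_abs.1 h with h | h <;> nlinarith

lemma idx_mem_box {B k : ℕ} {v : Eucl d} (hv : ∀ i, |v i| < B) : idx k v ∈ box d B k := by
  rw [mem_box]
  intro j
  have h := abs_lt.1 (hv j)
  have hk := dy_pos k
  have e : dy k * 2 ^ k = 1 := by unfold dy; rw [← mul_pow]; norm_num
  have h1 := idx_le k v j
  have h2 := lt_idx k v j
  constructor
  · have : -((B : ℝ) * 2 ^ k) < idx k v j + 1 := by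
      by_contra! hc
      have := mul_le_mul_of_nonneg_left hc hk.le
      have : dy k * -((B : ℝ) * 2 ^ k) = -B := by linear_combination -(B : ℝ) * e
      linarith
    have : -((B : ℤ) * 2 ^ k) < idx k v j + 1 := by exact_mod_cast this
    omega
  · have : (idx k v j : ℝ) < (B : ℝ) * 2 ^ k := by
      by_contra! hc
      have := mul_le_mul_of_nonneg_left hc hk.le
      have : dy k * ((B : ℝ) * 2 ^ k) = B := by linear_combination (B : ℝ) * e
      linarith
    exact_mod_cast this

variable (ν : Measure (Eucl d)) [ν.IsAddHaarMeasure]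

lemma measure_ball_eq {r : ℝ} (hr : 0 < r) (x : Eucl d) :
    ν (ball x r) = ENNReal.ofReal (r ^ d) * ν (ball 0 1) := by
  rw [Measure.addHaar_ball_of_pos ν x hr]; simp

lemma measure_ball_one_ne_top : ν (ball 0 1) ≠ ⊤ := measure_ball_lt_top.ne

lemma measure_ball_one_ne_zero : ν (ball 0 1) ≠ 0 := (measure_ball_pos ν 0 one_pos).ne'

lemma measure_cube_le (k : ℕ) (m : Fin d → ℤ) :
    ν (cube k m) ≤ ENNReal.ofReal (dy k ^ d) * (ENNReal.ofReal ((d + 1) ^ d) * ν (ball 0 1)) := by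
  have hk := dy_pos k
  calc ν (cube k m) ≤ ν (ball (lpt k m) ((d + 1) * dy k)) := by
        refine measure_mono fun v hv => ?_
        have := norm_sub_lpt_idx k v
        rw [show idx k v = m from hv] at this
        rw [mem_ball, dist_eq_norm]
        linarith
    _ = _ := by
        rw [measure_ball_eq ν (by positivity), mul_pow, mul_comm ((d + 1 : ℝ) ^ d),
          ENNReal.ofReal_mul (by positivity), mul_assoc]

lemma le_measure_cube (k : ℕ) (m : Fin d → ℤ) :
    ENNReal.ofReal (dy k ^ d) * (ENNReal.ofReal ((1 / 2) ^ d) * ν (ball 0 1)) ≤ ν (cube k m) := by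
  have hk := dy_pos k
  set c : Eucl d := WithLp.toLp 2 fun i => dy k * m i + dy k / 2
  calc _ = ν (ball c (dy k * (1 / 2))) := by
        rw [measure_ball_eq ν (mul_pos hk one_half_pos), mul_pow,
          ENNReal.ofReal_mul (by positivity), mul_assoc]
    _ ≤ _ := by
        refine measure_mono fun v hv => ?_
        rw [mem_ball, dist_eq_norm] at hv
        funext i
        have h1 := (abs_apply_le_norm (v - c) i).trans_lt hv
        have h2 : (v - c) i = v i - (dy k * m i + dy k / 2) := rfl
        rw [h2, abs_lt] at h1
        unfold idx
        rw [Int.floor_eq_iff, le_div_iff₀ hk, div_lt_iff₀ hk]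
        constructor <;> linarith

end Cubes

section Degenerate

variable {d : ℕ} {W : Type*} [NormedAddCommGroup W] [NormedSpace ℝ W]

/-- The linear part of the affine interpolation `tay g k m`. -/
def tslope (g : Eucl d → W) (k : ℕ) (m : Fin d → ℤ) : Eucl d →ₗ[ℝ] W where
  toFun v := ∑ i, (v i / dy k) • (g (lpt k m + dy k • ev i) - g (lpt k m))
  map_add' v w := by
    rw [← Finset.sum_add_distrib]
    refine Finset.sum_congr rfl fun i _ => ?_
    rw [PiLp.add_apply, add_div, add_smul]
  map_smul' c v := by
    rw [Finset.smul_sum]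
    refine Finset.sum_congr rfl fun i _ => ?_
    rw [PiLp.smul_apply, smul_smul, smul_eq_mul, RingHom.id_apply, mul_div_assoc]

lemma tay_eq_add_tslope (g : Eucl d → W) (k : ℕ) (m : Fin d → ℤ) (v : Eucl d) :
    tay g k m v = g (lpt k m) + tslope g k m (v - lpt k m) := rfl

lemma tay_sub_tay (g : Eucl d → W) (k : ℕ) (m : Fin d → ℤ) (v v' : Eucl d) :
    tay g k m v - tay g k m v' = tslope g k m (v - v') := by
  rw [tay_eq_add_tslope, tay_eq_add_tslope, add_sub_add_left_eq_sub, ← map_sub, sub_sub_sub_cancel_right]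

lemma norm_tslope_le {g : Eucl d → W} (hg : LipschitzWith 1 g) (k : ℕ) (m : Fin d → ℤ) (v : Eucl d) :
    ‖tslope g k m v‖ ≤ d * ‖v‖ := by
  have h := norm_tay_diff_le hg k m v 0
  rw [tay_sub_tay, sub_zero] at h
  refine h.trans ((Finset.sum_le_sum fun i _ => ?_).trans_eq (b := ∑ _i : Fin d, ‖v‖) (by simp))
  simpa using abs_apply_le_norm v i

/-- Points of a degenerate cube with overlapping translates in the degenerate direction have
close images. -/
lemma dist_image_le_of_translates {i w : ℕ} (hw : 1 ≤ w) {g : Eucl d → W} (hg : LipschitzWith 1 g)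
    {k : ℕ} {m : Fin d → ℤ} {τ : ℝ} {u : Eucl d} (hu : ‖tslope g k m u‖ ≤ τ)
    (hD : √(Dsq i w g k m) + 2 * d * dy i ≤ τ) {v v' : Eucl d} (hv : v ∈ cube k m)
    (hv' : v' ∈ cube k m) {s : ℝ} (hs : |s| ≤ 1)
    (h : ‖v - v' + (s * dy k) • u‖ ≤ τ * dy k) :
    dist (g v) (g v') ≤ (d + 3) * (τ * dy k) := by
  have hk := dy_pos k
  have happ : ∀ x ∈ cube k m, ‖g x - tay g k m x‖ ≤ τ * dy k := by
    intro x hx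
    refine (norm_sub_tay_le_sup (i := i) (w := w) hg k m fun j => ?_).trans ?_
    · have := abs_sub_lpt_idx k x j
      rw [show idx k x = m from hx] at this
      have hw' : (1 : ℝ) ≤ w := by exact_mod_cast hw
      nlinarith
    · rw [mul_comm]; gcongr
  have e : g v - g v' = (g v - tay g k m v) - (g v' - tay g k m v')
      + (tslope g k m (v - v' + (s * dy k) • u) - (s * dy k) • tslope g k m u) := by
    rw [map_add, map_smul, add_sub_cancel_right, ← tay_sub_tay]; abel
  have h1 := happ v hv
  have h2 := happ v' hv'
  have h3 := norm_tslope_le hg k m (v - v' + (s * dy k) • u)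
  have h4 : ‖(s * dy k) • tslope g k m u‖ ≤ τ * dy k := by
    rw [norm_smul, Real.norm_eq_abs, abs_mul, abs_of_pos hk]
    calc |s| * dy k * ‖tslope g k m u‖ ≤ 1 * dy k * τ := by gcongr
      _ = _ := by ring
  have h5 : (d : ℝ) * ‖v - v' + (s * dy k) • u‖ ≤ d * (τ * dy k) := by gcongr
  rw [dist_eq_norm, e]
  have h6 := norm_add_le ((g v - tay g k m v) - (g v' - tay g k m v'))
    (tslope g k m (v - v' + (s * dy k) • u) - (s * dy k) • tslope g k m u)
  have h7 := norm_sub_le (g v - tay g k m v) (g v' - tay g k m v')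
  have h8 := norm_sub_le (tslope g k m (v - v' + (s * dy k) • u)) ((s * dy k) • tslope g k m u)
  linarith

/-- A separated family of images of points in a degenerate cube is small. -/
lemma card_mul_le_of_degenerate {i w : ℕ} (hw : 1 ≤ w) {g : Eucl d → W} (hg : LipschitzWith 1 g)
    {k : ℕ} {m : Fin d → ℤ} {τ : ℝ} (hτ : 0 < τ) (hτ1 : τ ≤ 1) {u : Eucl d} (hu1 : ‖u‖ = 1)
    (hu : ‖tslope g k m u‖ ≤ τ) (hD : √(Dsq i w g k m) + 2 * d * dy i ≤ τ) {F : Finset (Eucl d)}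
    (hF : ∀ v ∈ F, v ∈ cube k m)
    (hsep : ∀ v ∈ F, ∀ v' ∈ F, v ≠ v' → (d + 3) * (τ * dy k) < dist (g v) (g v')) :
    (F.card : ℝ) * τ ^ d ≤ 2 * (2 * (d + 3)) ^ d * τ := by
  have hk := dy_pos k
  have hτk : 0 < τ * dy k := mul_pos hτ hk
  set N := ⌊1 / τ⌋₊
  have hN1 : (N : ℝ) * τ ≤ 1 := by
    have := Nat.floor_le (show 0 ≤ 1 / τ by positivity)
    rwa [le_div_iff₀ hτ] at this
  have hN2 : 1 ≤ 2 * (N * τ) := by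
    have h1 : 1 / τ < N + 1 := Nat.lt_floor_add_one _
    have h2 : 1 ≤ N := Nat.le_floor (by rw [le_div_iff₀ hτ]; simpa using hτ1)
    have h3 : (1 : ℝ) ≤ N := by exact_mod_cast h2
    rw [div_lt_iff₀ hτ] at h1
    nlinarith
  set c : Eucl d × ℕ → Eucl d := fun x => x.1 + ((x.2 * τ) * dy k) • u
  set P := F ×ˢ Finset.range N
  have hs : ∀ a b : ℕ, a < N → b < N → |(a * τ - b * τ : ℝ)| ≤ 1 := by
    intro a b ha hb
    have h1 : (a : ℝ) ≤ N := by exact_mod_cast ha.le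
    have h2 : (b : ℝ) ≤ N := by exact_mod_cast hb.le
    rw [abs_le]
    have h3 : (0 : ℝ) ≤ a * τ := by positivity
    have h4 : (0 : ℝ) ≤ b * τ := by positivity
    constructor <;> nlinarith
  have hdisj : (P : Set (Eucl d × ℕ)).PairwiseDisjoint fun x => ball (c x) (τ * dy k / 2) := by
    rintro ⟨v, a⟩ hva ⟨v', b⟩ hvb hne
    simp only [P, Finset.coe_product, mem_prod, Finset.mem_coe, Finset.mem_range] at hva hvb
    refine ball_disjoint_ball ?_
    by_contra! hc
    have hc' : ‖v - v' + ((a * τ - b * τ) * dy k) • u‖ < τ * dy k := by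
      have e : c (v, a) - c (v', b) = v - v' + ((a * τ - b * τ) * dy k) • u := by
        simp only [c]; rw [sub_mul, sub_smul]; abel
      rw [← e, ← dist_eq_norm]; linarith
    by_cases hvv : v = v'
    · subst hvv
      have hab : a ≠ b := fun h => hne (by rw [h])
      have h1 : (1 : ℝ) ≤ |(a : ℝ) - b| := by
        have : (1 : ℤ) ≤ |(a : ℤ) - b| := Int.one_le_abs (by omega)
        exact_mod_cast this
      rw [sub_self, zero_add, norm_smul, hu1, mul_one, Real.norm_eq_abs, ← sub_mul, mul_assoc,
        abs_mul, abs_of_pos hτk] at hc'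
      nlinarith
    · exact absurd (dist_image_le_of_translates hw hg hu hD (hF v hva.1) (hF v' hvb.1)
        (hs a b hva.2 hvb.2) hc'.le) (not_le.2 (hsep v hva.1 v' hvb.1 hvv))
  have hsub : (⋃ x ∈ P, ball (c x) (τ * dy k / 2)) ⊆ ball (lpt k m) ((d + 3) * dy k) := by
    refine iUnion₂_subset fun x hx => ball_subset_ball' ?_
    simp only [P, Finset.mem_product, Finset.mem_range] at hx
    have h1 := norm_sub_lpt_idx k x.1
    rw [show idx k x.1 = m from hF _ hx.1] at h1
    have h2 : dist (c x) (lpt k m) ≤ d * dy k + 1 * dy k := by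
      have e : c x - lpt k m = (x.1 - lpt k m) + (x.2 * τ * dy k) • u := by simp only [c]; abel
      rw [dist_eq_norm, e]
      refine (norm_add_le _ _).trans (add_le_add h1 ?_)
      rw [norm_smul, hu1, mul_one, Real.norm_of_nonneg (by positivity)]
      have : (x.2 : ℝ) ≤ N := by exact_mod_cast hx.2.le
      have : (x.2 : ℝ) * τ ≤ 1 := by nlinarith
      gcongr
    nlinarith
  set ν : Measure (Eucl d) := volume
  have hvol : (P.card : ℝ≥0∞) * (ENNReal.ofReal ((τ * dy k / 2) ^ d) * ν (ball 0 1))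
      ≤ ENNReal.ofReal (((d + 3) * dy k) ^ d) * ν (ball 0 1) := by
    rw [← measure_ball_eq ν (show 0 < (d + 3) * dy k by positivity) (lpt k m)]
    refine le_trans (le_of_eq ?_) (measure_mono (μ := ν) hsub)
    rw [measure_biUnion_finset hdisj fun _ _ => measurableSet_ball]
    simp_rw [measure_ball_eq ν (half_pos hτk)]
    rw [Finset.sum_const, nsmul_eq_mul]
  rw [← mul_assoc, ENNReal.mul_le_mul_iff_left (measure_ball_one_ne_zero ν)
    (measure_ball_one_ne_top ν), ← ENNReal.ofReal_natCast, ← ENNReal.ofReal_mul (by positivity),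
    ENNReal.ofReal_le_ofReal_iff (by positivity), Finset.card_product, Finset.card_range] at hvol
  push_cast at hvol
  have hkd : 0 < dy k ^ d := by positivity
  have h1 : (F.card * N : ℝ) * τ ^ d ≤ (2 * (d + 3)) ^ d := by
    have e1 : (F.card * N : ℝ) * (τ * dy k / 2) ^ d = ((F.card * N : ℝ) * τ ^ d) * dy k ^ d / 2 ^ d := by
      rw [div_pow, mul_pow]; ring
    rw [e1, mul_pow, div_le_iff₀ (by positivity)] at hvol
    have e2 : (2 * ((d : ℝ) + 3)) ^ d * dy k ^ d = (d + 3 : ℝ) ^ d * dy k ^ d * 2 ^ d := by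
      rw [mul_pow]; ring
    rw [← e2] at hvol
    exact le_of_mul_le_mul_right hvol hkd
  calc (F.card : ℝ) * τ ^ d ≤ (F.card : ℝ) * τ ^ d * (2 * (N * τ)) :=
        le_mul_of_one_le_right (by positivity) hN2
    _ = 2 * ((F.card * N : ℝ) * τ ^ d) * τ := by ring
    _ ≤ 2 * (2 * (d + 3)) ^ d * τ := by gcongr

/-- The image of a degenerate cube is small for every upper regular measure. -/
lemma measure_image_cube_le [MeasurableSpace W] {i w : ℕ} (hw : 1 ≤ w) {g : Eucl d → W}
    (hg : LipschitzWith 1 g)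
    {k : ℕ} {m : Fin d → ℤ} {τ : ℝ} (hτ : 0 < τ) (hτ1 : τ ≤ 1) {u : Eucl d} (hu1 : ‖u‖ = 1)
    (hu : ‖tslope g k m u‖ ≤ τ) (hD : √(Dsq i w g k m) + 2 * d * dy i ≤ τ) {σ : Measure W} {C₀ : ℝ}
    (hσ : ∀ x, ∀ t : ℝ, 0 < t → t ≤ 5 * (d + 3) → σ (closedBall x t) ≤ ENNReal.ofReal (C₀ * t ^ d))
    (hC₀ : 0 ≤ C₀) :
    σ (g '' cube k m) ≤
      ENNReal.ofReal (C₀ * (5 * (d + 3)) ^ d * (2 * (2 * (d + 3)) ^ d) * τ * dy k ^ d) := by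
  have hk := dy_pos k
  set ρ := (d + 3) * (τ * dy k) with hρ
  have hρ0 : 0 < ρ := by positivity
  obtain ⟨u, huE, hdisj, hcov⟩ := Vitali.exists_disjoint_subfamily_covering_enlargement_closedBall
    (cube k m) g (fun _ => ρ) ρ (fun _ _ => le_rfl) 5 (by norm_num)
  have hsep : ∀ v ∈ u, ∀ v' ∈ u, v ≠ v' → ρ < dist (g v) (g v') := by
    intro v hv v' hv' hne
    by_contra! hc
    exact disjoint_left.1 (hdisj hv hv' hne) (mem_closedBall_self hρ0.le) (mem_closedBall.2 hc)
  have hcard : ∀ F : Finset (Eucl d), (F : Set (Eucl d)) ⊆ u →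
      (F.card : ℝ) * τ ^ d ≤ 2 * (2 * (d + 3)) ^ d * τ := fun F hF =>
    card_mul_le_of_degenerate hw hg hτ hτ1 hu1 hu hD (fun v hv => huE (hF hv))
      fun v hv v' hv' => hsep v (hF hv) v' (hF hv')
  have hfin : u.Finite := by
    by_contra hinf
    obtain ⟨N, hN⟩ := exists_nat_gt (2 * (2 * (d + 3)) ^ d * τ / τ ^ d)
    obtain ⟨F, hF, hFc⟩ := (show u.Infinite from hinf).exists_subset_card_eq N
    have := hcard F hF
    rw [← le_div_iff₀ (by positivity), hFc] at this
    linarith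
  have hu' := hcard hfin.toFinset (by simp)
  calc σ (g '' cube k m) ≤ σ (⋃ v ∈ hfin.toFinset, closedBall (g v) (5 * ρ)) := by
        refine measure_mono ?_
        rintro _ ⟨v, hv, rfl⟩
        obtain ⟨b, hb, hs⟩ := hcov v hv
        exact mem_biUnion (by simpa using hb) (hs (mem_closedBall_self hρ0.le))
    _ ≤ ∑ v ∈ hfin.toFinset, σ (closedBall (g v) (5 * ρ)) := measure_biUnion_finset_le _ _
    _ ≤ ∑ v ∈ hfin.toFinset, ENNReal.ofReal (C₀ * (5 * ρ) ^ d) := by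
        refine Finset.sum_le_sum fun v _ => hσ _ _ (by positivity) ?_
        have : τ * dy k ≤ 1 := mul_le_one₀ hτ1 hk.le (dy_le_one k)
        rw [hρ]
        have h3 : (0 : ℝ) ≤ d + 3 := by positivity
        nlinarith
    _ = ENNReal.ofReal (hfin.toFinset.card * (C₀ * (5 * ρ) ^ d)) := by
        rw [Finset.sum_const, nsmul_eq_mul, ENNReal.ofReal_mul (Nat.cast_nonneg _), ENNReal.ofReal_natCast]
    _ ≤ _ := by
        refine ENNReal.ofReal_le_ofReal ?_
        calc (hfin.toFinset.card : ℝ) * (C₀ * (5 * ρ) ^ d)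
            = C₀ * (5 * (d + 3)) ^ d * dy k ^ d * (hfin.toFinset.card * τ ^ d) := by
              simp only [hρ, mul_pow]; ring
          _ ≤ C₀ * (5 * (d + 3)) ^ d * dy k ^ d * (2 * (2 * (d + 3)) ^ d * τ) := by gcongr
          _ = _ := by ring

end Degenerate

section GoodSet

lemma ofReal_le_of_add_le {a b : ℝ} (ha : 0 ≤ a) (hb : 0 ≤ b) {x y : ℝ≥0∞}
    (h : ENNReal.ofReal (a + b) ≤ x + y) (hx : x ≤ ENNReal.ofReal a) : ENNReal.ofReal b ≤ y := by
  rw [ENNReal.ofReal_add ha hb] at h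
  exact (ENNReal.add_le_add_iff_left ENNReal.ofReal_ne_top).1 (h.trans (add_le_add_left hx y))

variable {d : ℕ} {W : Type*} [MeasurableSpace W]

lemma abs_lt_three_of_mem_cube {k : ℕ} {m : Fin d → ℤ} (hm : m ∈ box d 2 k) {v : Eucl d}
    (hv : v ∈ cube k m) (i : Fin d) : |v i| ≤ 3 := by
  have h1 := abs_sub_lpt_idx k v i
  rw [show idx k v = m from hv] at h1
  have h2 := abs_lpt_le hm i
  have h3 := abs_sub_abs_le_abs_sub (v i) (lpt k m i)
  have := dy_le_one k
  push_cast at h2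
  linarith

/-- A family of disjoint dyadic cubes in a bounded region has bounded total volume. -/
lemma tsum_dy_pow_le {I : Set (ℕ × (Fin d → ℤ))} (hI : ∀ x ∈ I, x.2 ∈ box d 2 x.1)
    (hd : I.PairwiseDisjoint fun x => cube x.1 x.2) :
    ∑' x : I, ENNReal.ofReal (dy x.1.1 ^ d) ≤ ENNReal.ofReal ((2 * (3 * d + 1)) ^ d) := by
  set ν : Measure (Eucl d) := volume
  have hb0 := measure_ball_one_ne_zero ν
  have hbt := measure_ball_one_ne_top ν
  have h1 : (∑' x : I, ENNReal.ofReal (dy x.1.1 ^ d)) * (ENNReal.ofReal ((1 / 2) ^ d) * ν (ball 0 1))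
      ≤ ENNReal.ofReal ((3 * d + 1) ^ d) * ν (ball 0 1) := by
    rw [← ENNReal.tsum_mul_right, ← measure_ball_eq ν (show (0 : ℝ) < 3 * d + 1 by positivity) 0]
    calc _ ≤ ∑' x : I, ν (cube x.1.1 x.1.2) :=
          ENNReal.tsum_le_tsum fun x => le_measure_cube ν _ _
      _ = ν (⋃ x ∈ I, cube x.1 x.2) :=
          (measure_biUnion (to_countable I) hd fun x _ => measurableSet_cube _ _).symm
      _ ≤ _ := by
          refine measure_mono (iUnion₂_subset fun x hx v hv => ?_)
          rw [mem_ball_zero_iff]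
          have := norm_le_of_abs_le (v := v) fun i => abs_lt_three_of_mem_cube (hI x hx) hv i
          linarith
  rw [← mul_assoc, ENNReal.mul_le_mul_iff_left hb0 hbt] at h1
  have h2 : ENNReal.ofReal ((2 : ℝ) ^ d) * ENNReal.ofReal ((1 / 2) ^ d) = 1 := by
    rw [← ENNReal.ofReal_mul (by positivity), ← mul_pow]; norm_num
  calc _ = ENNReal.ofReal ((2 : ℝ) ^ d)
        * ((∑' x : I, ENNReal.ofReal (dy x.1.1 ^ d)) * ENNReal.ofReal ((1 / 2) ^ d)) := by
        rw [mul_comm (∑' x : I, _), ← mul_assoc, h2, one_mul]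
    _ ≤ ENNReal.ofReal ((2 : ℝ) ^ d) * ENNReal.ofReal ((3 * d + 1) ^ d) := by gcongr
    _ = _ := by rw [← ENNReal.ofReal_mul (by positivity), ← mul_pow]

/-- If images of degenerate cubes are small, so is the image of their union. -/
lemma measure_image_degenerate_le {σ : Measure W} {g : Eucl d → W} {deg : ℕ → (Fin d → ℤ) → Prop}
    {a : ℝ≥0∞} (h : ∀ k m, deg k m → σ (g '' cube k m) ≤ a * ENNReal.ofReal (dy k ^ d))
    {S : Set (Eucl d)} (hS : ∀ v ∈ S, ∀ i, |v i| < 2) :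
    σ (g '' {v ∈ S | ∃ k, deg k (idx k v)}) ≤ a * ENNReal.ofReal ((2 * (3 * d + 1)) ^ d) := by
  classical
  set I : Set (ℕ × (Fin d → ℤ)) := {x | x.2 ∈ box d 2 x.1 ∧ deg x.1 x.2 ∧
    ∀ v ∈ cube x.1 x.2, ∀ j < x.1, ¬ deg j (idx j v)} with hI
  have hdisj : I.PairwiseDisjoint fun x => cube x.1 x.2 := by
    rintro ⟨k, m⟩ ⟨_, hx, hx'⟩ ⟨l, m'⟩ ⟨_, hy, hy'⟩ hne
    refine disjoint_left.2 fun v hv hv' => ?_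
    simp only [cube, mem_ofPred_eq] at hv hv' hx hy hx' hy'
    rcases lt_trichotomy k l with hkl | hkl | hkl
    · exact hy' v hv' k hkl (hv ▸ hx)
    · subst hkl; exact hne (by rw [← hv, ← hv'])
    · exact hx' v hv l hkl (hv' ▸ hy)
  have hcov : {v ∈ S | ∃ k, deg k (idx k v)} ⊆ ⋃ x ∈ I, cube x.1 x.2 := by
    rintro v ⟨hv, hk⟩
    refine mem_biUnion (x := (Nat.find hk, idx (Nat.find hk) v)) ⟨idx_mem_box (by exact_mod_cast hS v hv),
      Nat.find_spec hk, fun v' hv' j hj => ?_⟩ rfl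
    rw [idx_nest hj.le (show idx _ v' = idx _ v from hv')]
    exact Nat.find_min hk hj
  calc _ ≤ σ (⋃ x ∈ I, g '' cube x.1 x.2) := by
        refine measure_mono ?_
        rw [← image_iUnion₂]
        exact image_mono hcov
    _ ≤ ∑' x : I, σ (g '' cube x.1.1 x.1.2) := measure_biUnion_le σ (to_countable I) _
    _ ≤ ∑' x : I, a * ENNReal.ofReal (dy x.1.1 ^ d) :=
        ENNReal.tsum_le_tsum fun x => h _ _ x.2.2.1
    _ = a * ∑' x : I, ENNReal.ofReal (dy x.1.1 ^ d) := ENNReal.tsum_mul_left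
    _ ≤ _ := by gcongr; exact tsum_dy_pow_le (fun x hx => hx.1) hdisj

/-- Integrating a function of the dyadic position turns into a sum over dyadic cubes. -/
lemma lintegral_tsum_idx_le (ν : Measure (Eucl d)) [ν.IsAddHaarMeasure] {S : Set (Eucl d)}
    (hSm : MeasurableSet S) (hS : ∀ v ∈ S, ∀ i, |v i| < 2) (D : ℕ → (Fin d → ℤ) → ℝ≥0∞) :
    ∫⁻ v in S, ∑' k, D k (idx k v) ∂ν ≤ (ENNReal.ofReal ((d + 1) ^ d) * ν (ball 0 1)) *
      ∑' k, ∑ m ∈ box d 2 k, ENNReal.ofReal (dy k ^ d) * D k m := by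
  have hm : ∀ k, Measurable fun v : Eucl d => D k (idx k v) := fun k =>
    (measurable_of_countable (D k)).comp (measurable_idx k)
  rw [lintegral_tsum fun k => (hm k).aemeasurable, ← ENNReal.tsum_mul_left]
  refine ENNReal.tsum_le_tsum fun k => ?_
  calc ∫⁻ v in S, D k (idx k v) ∂ν
      ≤ ∫⁻ v in S, ∑ m ∈ box d 2 k, (cube k m).indicator (fun _ => D k m) v ∂ν := by
        refine setLIntegral_mono' hSm fun v hv => ?_
        refine le_trans ?_ (Finset.single_le_sum (f := fun m => (cube k m).indicator (fun _ => D k m) v)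
          (fun _ _ => zero_le) (idx_mem_box (by exact_mod_cast hS v hv)))
        rw [indicator_of_mem (show v ∈ cube k (idx k v) from rfl)]
    _ ≤ ∫⁻ v, ∑ m ∈ box d 2 k, (cube k m).indicator (fun _ => D k m) v ∂ν := setLIntegral_le_lintegral _ _
    _ = ∑ m ∈ box d 2 k, D k m * ν (cube k m) := by
        rw [lintegral_finsetSum _ fun m _ => measurable_const.indicator (measurableSet_cube k m)]
        refine Finset.sum_congr rfl fun m _ => ?_
        rw [lintegral_indicator_const (measurableSet_cube k m)]
    _ ≤ ∑ m ∈ box d 2 k, D k m * (ENNReal.ofReal (dy k ^ d) * (ENNReal.ofReal ((d + 1) ^ d) * ν (ball 0 1))) := by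
        gcongr with m _; exact measure_cube_le ν k m
    _ = _ := by
        rw [Finset.mul_sum]
        exact Finset.sum_congr rfl fun m _ => by ring

/-- Extraction of a compact set avoiding degenerate cubes, on which the bad cubes of equal
generation have congruent indices. -/
lemma exists_good_compact (ν : Measure (Eucl d)) [ν.IsAddHaarMeasure] (C₁ : ℝ≥0∞) (hC₁ : C₁ ≠ ⊤)
    {ε θ : ℝ} (hε : 0 < ε) (hθ : 0 < θ) : ∃ η : ℝ≥0∞, η ≠ 0 ∧
    ∀ (σ : Measure W) (g : Eucl d → W), (∀ T, σ (g '' T) ≤ ν T) →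
    ∀ (deg : ℕ → (Fin d → ℤ) → Prop) (a : ℝ≥0∞),
    (∀ k m, deg k m → σ (g '' cube k m) ≤ a * ENNReal.ofReal (dy k ^ d)) →
    a * ENNReal.ofReal ((2 * (3 * d + 1)) ^ d) ≤ ENNReal.ofReal (θ / 4) →
    ∀ (D : ℕ → (Fin d → ℤ) → ℝ), ∑' k, ∑ m ∈ box d 2 k, ENNReal.ofReal (dy k ^ d * D k m) ≤ C₁ →
    ∀ S, MeasurableSet S → (∀ v ∈ S, ∀ i, |v i| < 2) → ENNReal.ofReal θ ≤ σ (g '' S) →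
    ∃ K ⊆ S, IsCompact K ∧ η ≤ ν K ∧ (∀ v ∈ K, ∀ k, ¬ deg k (idx k v)) ∧
      ∀ v ∈ K, ∀ v' ∈ K, ∀ k, ε ≤ D k (idx k v) → ε ≤ D k (idx k v') →
        ∀ i, (8 : ℤ) ∣ idx k v i - idx k v' i := by
  classical
  set c := ENNReal.ofReal ((d + 1) ^ d) * ν (ball 0 1) with hc
  have hct : c ≠ ⊤ := ENNReal.mul_ne_top ENNReal.ofReal_ne_top (measure_ball_one_ne_top ν)
  have hε0 : ENNReal.ofReal ε ≠ 0 := by simpa using hε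
  set I := c * ((ENNReal.ofReal ε)⁻¹ * C₁) with hI
  have hIt : I ≠ ⊤ := by finiteness
  have hθ4 : ENNReal.ofReal (θ / 4) ≠ 0 := by simpa using hθ
  obtain ⟨M, hM⟩ : ∃ M : ℕ, I / ENNReal.ofReal (θ / 4) < M := ENNReal.exists_nat_gt (by finiteness)
  set Γ := Fin d → ZMod 8
  have hM0 : (M : ℝ≥0∞) ≠ 0 := fun h => by simp [h] at hM
  have hΓ : ((Fintype.card Γ : ℝ≥0∞) ^ M) ≠ ⊤ := by finiteness
  refine ⟨ENNReal.ofReal (θ / 2) / (Fintype.card Γ : ℝ≥0∞) ^ M / 2, ?_, ?_⟩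
  · refine ENNReal.div_ne_zero.2 ⟨ENNReal.div_ne_zero.2 ⟨by simpa using hθ, hΓ⟩, by norm_num⟩
  intro σ g hσν deg a hdeg ha D hD S hSm hS hσS
  have hidx : ∀ (k : ℕ) (p : (Fin d → ℤ) → Prop), MeasurableSet {v : Eucl d | p (idx k v)} :=
    fun k p => measurable_idx k (MeasurableSet.of_discrete (s := {m | p m}))
  have hSf : ν S ≠ ⊤ := by
    refine ((measure_mono fun v hv => ?_).trans_lt (measure_closedBall_lt_top (μ := ν) (x := 0) (r := d * 2))).ne
    rw [mem_closedBall_zero_iff]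
    exact norm_le_of_abs_le fun i => (hS v hv i).le
  set Z := {v ∈ S | ∃ k, deg k (idx k v)} with hZ
  have hZm : MeasurableSet Z := by
    have : MeasurableSet {v : Eucl d | ∃ k, deg k (idx k v)} := by
      rw [ofPred_exists]
      exact MeasurableSet.iUnion fun k => hidx k (deg k)
    exact hSm.inter this
  have hS1 : ENNReal.ofReal (3 / 4 * θ) ≤ ν (S \ Z) := by
    refine ofReal_le_of_add_le (a := θ / 4) (by positivity) (by positivity) (x := σ (g '' Z)) ?_
      ((measure_image_degenerate_le hdeg hS).trans ha)
    rw [show θ / 4 + 3 / 4 * θ = θ by ring]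
    refine hσS.trans (le_trans ?_ (add_le_add_right (hσν (S \ Z)) _))
    refine (measure_mono ?_).trans (measure_union_le _ _)
    rw [← image_union]
    exact image_mono fun v hv => by by_cases h : v ∈ Z <;> simp [h, hv]
  set B : ℕ → (Fin d → ℤ) → ℝ≥0∞ := fun k m => if ε ≤ D k m then 1 else 0 with hB
  set N : Eucl d → ℝ≥0∞ := fun v => ∑' k, B k (idx k v) with hN
  have hNm : Measurable N := Measurable.tsum fun k =>
    (measurable_of_countable (B k)).comp (measurable_idx k)
  have hNI : ∫⁻ v in S, N v ∂ν ≤ I := by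
    refine (lintegral_tsum_idx_le ν hSm hS B).trans ?_
    rw [hI]
    gcongr
    calc _ ≤ ∑' k, ∑ m ∈ box d 2 k, (ENNReal.ofReal ε)⁻¹ * ENNReal.ofReal (dy k ^ d * D k m) := by
          refine ENNReal.tsum_le_tsum fun k => Finset.sum_le_sum fun m _ => ?_
          rw [ENNReal.ofReal_mul (pow_nonneg (dy_pos k).le _), mul_left_comm]
          gcongr
          simp only [hB]
          split_ifs with h
          · rw [← ENNReal.div_eq_inv_mul, ENNReal.le_div_iff_mul_le (Or.inl hε0) (Or.inl ENNReal.ofReal_ne_top),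
              one_mul]
            exact ENNReal.ofReal_le_ofReal h
          · exact zero_le
      _ = (ENNReal.ofReal ε)⁻¹ * ∑' k, ∑ m ∈ box d 2 k, ENNReal.ofReal (dy k ^ d * D k m) := by
          simp_rw [← Finset.mul_sum]
          rw [ENNReal.tsum_mul_left]
      _ ≤ _ := by gcongr
  set S2 := {v ∈ S \ Z | N v < M} with hS2
  have hS2m : MeasurableSet S2 := (hSm.diff hZm).inter (measurableSet_lt hNm measurable_const)
  have hS2ν : ENNReal.ofReal (θ / 2) ≤ ν S2 := by
    refine ofReal_le_of_add_le (a := θ / 4) (by positivity) (by positivity)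
      (x := ν {v ∈ S \ Z | (M : ℝ≥0∞) ≤ N v}) ?_ ?_
    · rw [show θ / 4 + θ / 2 = 3 / 4 * θ by ring]
      refine hS1.trans ((measure_mono fun v hv => ?_).trans (measure_union_le _ _))
      rcases le_or_gt (M : ℝ≥0∞) (N v) with h | h
      · exact Or.inl ⟨hv, h⟩
      · exact Or.inr ⟨hv, h⟩
    · have h1 : ν {v ∈ S \ Z | (M : ℝ≥0∞) ≤ N v} ≤ (ν.restrict S) {v | (M : ℝ≥0∞) ≤ N v} := by
        rw [Measure.restrict_apply (measurableSet_le measurable_const hNm)]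
        exact measure_mono fun v hv => ⟨hv.2, hv.1.1⟩
      refine h1.trans ((meas_ge_le_lintegral_div hNm.aemeasurable hM0 (ENNReal.natCast_ne_top M)).trans ?_)
      rw [ENNReal.div_le_iff hM0 (ENNReal.natCast_ne_top M), mul_comm]
      rw [ENNReal.div_lt_iff (Or.inl hθ4) (Or.inl ENNReal.ofReal_ne_top)] at hM
      exact hNI.trans hM.le
  obtain ⟨ω, hωm, hω⟩ := exists_coloring (ν := ν) (Γ := Γ)
    (bad := fun k => {v | ε ≤ D k (idx k v)}) (col := fun k v i => (idx k v i : ZMod 8))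
    (fun k => hidx k fun m => ε ≤ D k m) (fun k γ => hidx k fun m => (fun i => (m i : ZMod 8)) = γ)
    hS2m (ne_top_of_le_ne_top hSf (measure_mono fun v hv => hv.1.1)) (M := M) (by
      intro v hv F hF
      have h1 : (F.card : ℝ≥0∞) ≤ N v := by
        calc (F.card : ℝ≥0∞) = ∑ k ∈ F, B k (idx k v) := by
              rw [Finset.card_eq_sum_ones, Nat.cast_sum]
              refine Finset.sum_congr rfl fun k hk => ?_
              simp only [hB]
              rw [if_pos (show ε ≤ D k (idx k v) from hF k hk), Nat.cast_one]
          _ ≤ _ := ENNReal.sum_le_tsum F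
      exact_mod_cast (h1.trans_lt hv.2).le)
  set S3 := {v ∈ S2 | ∀ k, v ∈ {v | ε ≤ D k (idx k v)} → (fun i => (idx k v i : ZMod 8)) = ω k} with hS3
  have hS3ν : ENNReal.ofReal (θ / 2) / (Fintype.card Γ : ℝ≥0∞) ^ M ≤ ν S3 :=
    ENNReal.div_le_of_le_mul' (hS2ν.trans hω)
  have hlt : ENNReal.ofReal (θ / 2) / (Fintype.card Γ : ℝ≥0∞) ^ M / 2 < ν S3 := by
    refine lt_of_lt_of_le (ENNReal.half_lt_self ?_ ?_) hS3ν
    · exact ENNReal.div_ne_zero.2 ⟨by simpa using hθ, hΓ⟩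
    · exact ne_top_of_le_ne_top hSf (hS3ν.trans (measure_mono fun v hv => hv.1.1.1))
  obtain ⟨K, hKS, hKc, hKν⟩ := hωm.exists_lt_isCompact hlt
  refine ⟨K, fun v hv => (hKS hv).1.1.1, hKc, hKν.le, fun v hv k hk => (hKS hv).1.1.2 ⟨(hKS hv).1.1.1, k, hk⟩,
    fun v hv v' hv' k h h' i => ?_⟩
  have e1 := (hKS hv).2 k h
  have e2 := (hKS hv').2 k h'
  have e3 := congrFun (e1.trans e2.symm) i
  have e4 := (ZMod.intCast_eq_intCast_iff_dvd_sub _ _ 8).1 e3.symm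
  exact_mod_cast e4

end GoodSet

section Geometry

variable {d n : ℕ}

/-- The joint squared deviation of `g` and `f` from their affine interpolations. -/
def Djt (i w : ℕ) (g : Eucl d → Eucl n) (f : Eucl d → ℝ) (k : ℕ) (m : Fin d → ℤ) : ℝ :=
  Dsq i w g k m + Dsq i w f k m

lemma sqrt_Dsq_left_le (i w : ℕ) (g : Eucl d → Eucl n) (f : Eucl d → ℝ) (k : ℕ) (m : Fin d → ℤ) :
    √(Dsq i w g k m) ≤ √(Djt i w g f k m) :=
  Real.sqrt_le_sqrt (le_add_of_nonneg_right (Dsq_nonneg _ _ _ _ _))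

lemma sqrt_Dsq_right_le (i w : ℕ) (g : Eucl d → Eucl n) (f : Eucl d → ℝ) (k : ℕ) (m : Fin d → ℤ) :
    √(Dsq i w f k m) ≤ √(Djt i w g f k m) :=
  Real.sqrt_le_sqrt (le_add_of_nonneg_left (Dsq_nonneg _ _ _ _ _))

/-- The pair `(g, f)` is almost affine near the cube but `g` nearly collapses a direction. -/
def Degen (i w : ℕ) (τ : ℝ) (g : Eucl d → Eucl n) (f : Eucl d → ℝ) (k : ℕ) (m : Fin d → ℤ) : Prop :=
  Djt i w g f k m < (τ / 8) ^ 2 ∧ ∃ u : Eucl d, ‖u‖ = 1 ∧ ‖tslope g k m u‖ ≤ τ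

variable {i w : ℕ} {τ : ℝ} {g : Eucl d → Eucl n} {f : Eucl d → ℝ} {k : ℕ} {m : Fin d → ℤ}

lemma sqrt_Djt_le (hτ : 0 < τ) (hD : Djt i w g f k m < (τ / 8) ^ 2) :
    √(Djt i w g f k m) ≤ τ / 8 :=
  Real.sqrt_le_iff.2 ⟨by positivity, hD.le⟩

lemma Degen.measure_image_le (hw : 1 ≤ w) (hτ : 0 < τ) (hτ1 : τ ≤ 1) (hi : 2 * d * dy i ≤ τ / 8)
    (hg : LipschitzWith 1 g) {σ : Measure (Eucl n)} {C₀ : ℝ} (hC₀ : 0 ≤ C₀)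
    (hσ : ∀ x, ∀ t : ℝ, 0 < t → t ≤ 5 * (d + 3) → σ (closedBall x t) ≤ ENNReal.ofReal (C₀ * t ^ d))
    (h : Degen i w τ g f k m) : σ (g '' cube k m) ≤
      ENNReal.ofReal (C₀ * (5 * (d + 3)) ^ d * (2 * (2 * (d + 3)) ^ d) * τ)
        * ENNReal.ofReal (dy k ^ d) := by
  obtain ⟨hD, u, hu1, hu⟩ := h
  rw [← ENNReal.ofReal_mul (by positivity)]
  refine measure_image_cube_le (i := i) (w := w) hw hg hτ hτ1 hu1 hu ?_ hσ hC₀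
  have h1 := sqrt_Djt_le hτ hD
  have h2 := sqrt_Dsq_left_le i w g f k m
  linarith

lemma le_norm_tslope (hnd : ¬ Degen i w τ g f k m) (hD : Djt i w g f k m < (τ / 8) ^ 2) (u : Eucl d) :
    τ * ‖u‖ ≤ ‖tslope g k m u‖ := by
  by_cases hu : u = 0
  · simp [hu]
  have hu' : 0 < ‖u‖ := norm_pos_iff.2 hu
  by_contra! hc
  refine hnd ⟨hD, ‖u‖⁻¹ • u, ?_, ?_⟩
  · rw [norm_smul, norm_inv, norm_norm, inv_mul_cancel₀ hu'.ne']
  · rw [map_smul, norm_smul, norm_inv, norm_norm, inv_mul_le_iff₀ hu', mul_comm]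
    exact hc.le

/-- On a good non-degenerate cube, `g` is bi-Lipschitz at the scale of the cube. -/
lemma le_dist_of_good (hw : 5 ≤ w) (hτ : 0 < τ) (hi : 2 * d * dy i ≤ τ / 8)
    (hg : LipschitzWith 1 g) {v v' : Eucl d} (hnd : ¬ Degen i w τ g f k (idx k v))
    (hD : Djt i w g f k (idx k v) < (τ / 8) ^ 2) (h1 : ∀ j, |v j - v' j| ≤ 4 * dy k)
    (h2 : 2 * dy k ≤ ‖v - v'‖) : τ / 2 * ‖v - v'‖ ≤ dist (g v) (g v') := by
  have hk := dy_pos k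
  have hw' : (5 : ℝ) ≤ w := by exact_mod_cast hw
  have hs := sqrt_Djt_le hτ hD
  have hs2 := sqrt_Dsq_left_le i w g f k (idx k v)
  have h0 : ∀ j, |v j - lpt k (idx k v) j| ≤ w * dy k := fun j =>
    (abs_sub_lpt_idx k v j).trans (by nlinarith)
  have h0' : ∀ j, |v' j - lpt k (idx k v) j| ≤ w * dy k := fun j => by
    have e1 := abs_sub_lpt_idx k v j
    have e2 := h1 j
    have e3 := abs_sub_le (v' j) (v j) (lpt k (idx k v) j)
    rw [abs_sub_comm (v' j) (v j)] at e3
    nlinarith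
  have a1 := norm_sub_tay_le_sup (i := i) hg k (idx k v) h0
  have a2 := norm_sub_tay_le_sup (i := i) hg k (idx k v) h0'
  have a3 := le_norm_tslope hnd hD (v - v')
  rw [← tay_sub_tay] at a3
  have hle : dy k * (√(Dsq i w g k (idx k v)) + 2 * d * dy i) ≤ dy k * (τ / 4) := by
    gcongr; linarith
  have a4 : ‖tay g k (idx k v) v - tay g k (idx k v) v'‖
      ≤ ‖g v - g v'‖ + ‖g v - tay g k (idx k v) v‖ + ‖g v' - tay g k (idx k v) v'‖ := by
    have e : tay g k (idx k v) v - tay g k (idx k v) v' = (g v - g v')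
      - (g v - tay g k (idx k v) v) + (g v' - tay g k (idx k v) v') := by abel
    rw [e]
    exact (norm_add_le _ _).trans (add_le_add_left (norm_sub_le _ _) _)
  rw [dist_eq_norm]
  nlinarith

/-- The extracted set is mapped bi-Lipschitzly. -/
lemma antilipschitz_of_good (hw : 5 ≤ w) (hτ : 0 < τ) (hi : 2 * d * dy i ≤ τ / 8)
    (hg : LipschitzWith 1 g) {K : Set (Eucl d)} (hK : ∀ v ∈ K, ∀ j, |v j| < 2)
    (hnd : ∀ v ∈ K, ∀ k, ¬ Degen i w τ g f k (idx k v))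
    (hcol : ∀ v ∈ K, ∀ v' ∈ K, ∀ k, (τ / 8) ^ 2 ≤ Djt i w g f k (idx k v) →
      (τ / 8) ^ 2 ≤ Djt i w g f k (idx k v') → ∀ j, (8 : ℤ) ∣ idx k v j - idx k v' j)
    {v v' : Eucl d} (hv : v ∈ K) (hv' : v' ∈ K) : τ / 2 * ‖v - v'‖ ≤ dist (g v) (g v') := by
  by_cases hne : v = v'
  · simp [hne]
  have : ∃ j, v j ≠ v' j := by
    by_contra! hc
    exact hne (by ext j; exact hc j)
  obtain ⟨j₀, hj₀⟩ := this
  obtain ⟨j, -, hj⟩ := Finset.exists_max_image Finset.univ (fun j => |v j - v' j|) ⟨j₀, Finset.mem_univ _⟩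
  have hpos : 0 < |v j - v' j| := (abs_pos.2 (sub_ne_zero.2 hj₀)).trans_le (hj j₀ (Finset.mem_univ _))
  have hlt : |v j - v' j| ≤ 4 := by
    have e1 := hK v hv j
    have e2 := hK v' hv' j
    have e3 := abs_sub (v j) (v' j)
    linarith
  obtain ⟨k, hk1, hk2⟩ := exists_nat_pow_near_of_lt_one (x := |v j - v' j| / 4) (y := (1 / 2 : ℝ))
    (by positivity) (by linarith) (by norm_num) (by norm_num)
  change dy (k + 1) < _ at hk1
  change _ ≤ dy k at hk2
  rw [dy_succ] at hk1
  have h2 : 2 * dy k ≤ |v j - v' j| := by linarith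
  have h1 : ∀ l, |v l - v' l| ≤ 4 * dy k := fun l => (hj l (Finset.mem_univ _)).trans (by linarith)
  have h3 : 2 * dy k ≤ ‖v - v'‖ := h2.trans (abs_apply_le_norm (v - v') j)
  by_cases hD : Djt i w g f k (idx k v) < (τ / 8) ^ 2
  · exact le_dist_of_good hw hτ hi hg (hnd v hv k) hD h1 h3
  by_cases hD' : Djt i w g f k (idx k v') < (τ / 8) ^ 2
  · rw [dist_comm, norm_sub_rev]
    refine le_dist_of_good hw hτ hi hg (hnd v' hv' k) hD' (fun l => ?_) ?_
    · rw [abs_sub_comm]; exact h1 l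
    · rw [norm_sub_rev]; exact h3
  have hdvd := hcol v hv v' hv' k (not_lt.1 hD) (not_lt.1 hD') j
  have b1 := le_abs_idx_sub h2
  have b2 : |idx k v j - idx k v' j| ≤ 4 + 1 := by
    exact_mod_cast abs_idx_sub_le (c := 4) (by exact_mod_cast h1 j)
  have b3 := Int.le_of_dvd (by omega) ((dvd_abs (8 : ℤ) _).2 hdvd)
  omega

/-- On a good non-degenerate cube, the interpolation of `F ∘ g` factors through an affine map of
gradient at most `2`. -/
lemma exists_affine_of_good (hw : 1 ≤ w) (hτ : 0 < τ) (hi : 2 * d * dy i ≤ τ / 8)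
    (hg : LipschitzWith 1 g) {F : Eucl n → ℝ} (hF : LipschitzWith 1 F)
    (hnd : ¬ Degen i w τ g (fun v => F (g v)) k m)
    (hD : Djt i w g (fun v => F (g v)) k m < (τ / 8) ^ 2) :
    ∃ A : Eucl n →ᵃ[ℝ] ℝ, gradNorm A ≤ 2 ∧
      (∀ y y', |A y - A y'| ≤ 2 * ‖y - y'‖) ∧
      ∀ v, A (tay g k m v) = tay (fun v => F (g v)) k m v := by
  have hk := dy_pos k
  set f : Eucl d → ℝ := fun v => F (g v) with hf
  have hfl : LipschitzWith 1 f := by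
    have := hF.comp hg
    rwa [one_mul] at this
  have hs := sqrt_Djt_le hτ hD
  have hs1 := sqrt_Dsq_left_le i w g f k m
  have hs2 := sqrt_Dsq_right_le i w g f k m
  have hwin : ∀ u : Eucl d, ‖u‖ ≤ dy k → ∀ j, |(lpt k m + u) j - lpt k m j| ≤ w * dy k := by
    intro u hu j
    have hw' : (1 : ℝ) ≤ w := by exact_mod_cast hw
    have := abs_apply_le_norm u j
    rw [PiLp.add_apply, add_sub_cancel_left]
    nlinarith
  have herr : ∀ u : Eucl d, ‖u‖ = dy k → ‖tslope f k m u‖ ≤ ‖tslope g k m u‖ + dy k * (τ / 2) := by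
    intro u hu
    have a1 := norm_sub_tay_le_sup (i := i) hg k m (hwin u hu.le)
    have a2 := norm_sub_tay_le_sup (i := i) hfl k m (hwin u hu.le)
    rw [tay_eq_add_tslope, add_sub_cancel_left] at a1 a2
    have a3 : ‖f (lpt k m + u) - f (lpt k m)‖ ≤ ‖g (lpt k m + u) - g (lpt k m)‖ := by
      have := hF.dist_le_mul (g (lpt k m + u)) (g (lpt k m))
      rwa [NNReal.coe_one, one_mul, dist_eq_norm, dist_eq_norm] at this
    have b1 : dy k * (√(Dsq i w g k m) + 2 * d * dy i) ≤ dy k * (τ / 4) := by gcongr; linarith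
    have b2 : dy k * (√(Dsq i w f k m) + 2 * d * dy i) ≤ dy k * (τ / 4) := by gcongr; linarith
    have c1 : ‖tslope f k m u‖ ≤ ‖f (lpt k m + u) - f (lpt k m)‖
        + ‖f (lpt k m + u) - (f (lpt k m) + tslope f k m u)‖ := by
      have e : tslope f k m u = (f (lpt k m + u) - f (lpt k m))
        - (f (lpt k m + u) - (f (lpt k m) + tslope f k m u)) := by ring
      conv_lhs => rw [e]
      exact norm_sub_le _ _
    have c2 : ‖g (lpt k m + u) - g (lpt k m)‖ ≤ ‖tslope g k m u‖
        + ‖g (lpt k m + u) - (g (lpt k m) + tslope g k m u)‖ := by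
      have e : g (lpt k m + u) - g (lpt k m) = tslope g k m u
        + (g (lpt k m + u) - (g (lpt k m) + tslope g k m u)) := by abel
      conv_lhs => rw [e]
      exact norm_add_le _ _
    linarith
  have hle : ∀ u : Eucl d, ‖tslope f k m u‖ ≤ 2 * ‖tslope g k m u‖ := by
    intro u
    by_cases hu : u = 0
    · simp [hu]
    have hu' : 0 < ‖u‖ := norm_pos_iff.2 hu
    have h1 := herr ((dy k / ‖u‖) • u) (by
      rw [norm_smul, Real.norm_of_nonneg (by positivity)]; field_simp)
    rw [map_smul, map_smul, norm_smul, norm_smul, Real.norm_of_nonneg (by positivity)] at h1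
    have h2 := le_norm_tslope hnd hD u
    have h3 : dy k * (τ / 2) = dy k / ‖u‖ * (τ * ‖u‖ / 2) := by field_simp
    rw [h3, ← mul_add] at h1
    have h4 := le_of_mul_le_mul_left h1 (by positivity)
    have : 0 ≤ ‖tslope g k m u‖ := norm_nonneg _
    linarith
  have hinj : Function.Injective (tslope g k m) := by
    rw [← LinearMap.ker_eq_bot, LinearMap.ker_eq_bot']
    intro u hu
    have h2 := le_norm_tslope hnd hD u
    rw [hu, norm_zero] at h2
    have : ‖u‖ ≤ 0 := by nlinarith [norm_nonneg u]
    exact norm_le_zero_iff.1 this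
  set e := LinearEquiv.ofInjective (tslope g k m) hinj with he
  set φ : LinearMap.range (tslope g k m) →L[ℝ] ℝ :=
    ((tslope f k m) ∘ₗ e.symm.toLinearMap).mkContinuous 2 (by
      intro x
      obtain ⟨u, rfl⟩ := e.surjective x
      have h1 : ‖e u‖ = ‖tslope g k m u‖ := rfl
      rw [h1]
      simpa using hle u) with hφ
  have hφn : ‖φ‖ ≤ 2 := LinearMap.mkContinuous_norm_le _ (by norm_num) _
  have hφe : ∀ u, φ (e u) = tslope f k m u := fun u => by simp [hφ]
  obtain ⟨M, hM, hMn⟩ := exists_extension_norm_eq _ φ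
  have hM2 : ‖M‖ ≤ 2 := hMn.trans_le hφn
  have hMe : ∀ u, M (tslope g k m u) = tslope f k m u := fun u => by
    rw [← hφe, ← hM]; rfl
  refine ⟨(M : Eucl n →ₗ[ℝ] ℝ).toAffineMap + AffineMap.const ℝ (Eucl n) (f (lpt k m) - M (g (lpt k m))),
    ?_, ?_, ?_⟩
  · have : LinearMap.toContinuousLinearMap ((M : Eucl n →ₗ[ℝ] ℝ).toAffineMap
        + AffineMap.const ℝ (Eucl n) (f (lpt k m) - M (g (lpt k m)))).linear = M := by
      ext y; simp
    rw [gradNorm, this]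
    exact hM2
  · intro y y'
    have h1 : |M (y - y')| ≤ 2 * ‖y - y'‖ := by
      have := M.le_opNorm (y - y')
      rw [Real.norm_eq_abs] at this
      nlinarith [norm_nonneg (y - y')]
    simpa using h1
  · intro v
    have := hMe (v - lpt k m)
    rw [tay_eq_add_tslope, tay_eq_add_tslope, ← this]
    simp
    ring

end Geometry

section Exterior

/-- Bounded overlap: sets covering each point at most `N` times have total measure at most
`N` times the measure of a common superset. -/
lemma sum_measure_le_of_overlap {X ι : Type*} [MeasurableSpace X] (σ : Measure X) (s : Finset ι)
    (B : ι → Set X) (hB : ∀ i ∈ s, MeasurableSet (B i)) {U : Set X} (hU : MeasurableSet U)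
    (hBU : ∀ i ∈ s, B i ⊆ U) (N : ℕ)
    (hN : ∀ z, ∀ t ⊆ s, (∀ i ∈ t, z ∈ B i) → t.card ≤ N) :
    ∑ i ∈ s, σ (B i) ≤ N * σ U := by
  classical
  calc ∑ i ∈ s, σ (B i) = ∑ i ∈ s, ∫⁻ z, (B i).indicator 1 z ∂σ :=
        Finset.sum_congr rfl fun i hi => (lintegral_indicator_one (hB i hi)).symm
    _ = ∫⁻ z, ∑ i ∈ s, (B i).indicator 1 z ∂σ :=
        (lintegral_finsetSum' _ fun i hi =>
          ((measurable_one.indicator (hB i hi)).aemeasurable)).symm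
    _ ≤ ∫⁻ z, U.indicator (fun _ => (N : ℝ≥0∞)) z ∂σ := by
        refine lintegral_mono fun z => ?_
        have e : ∑ i ∈ s, (B i).indicator (1 : X → ℝ≥0∞) z = ((s.filter fun i => z ∈ B i).card : ℝ≥0∞) := by
          rw [Finset.card_filter, Nat.cast_sum]
          refine Finset.sum_congr rfl fun i _ => ?_
          by_cases h : z ∈ B i <;> simp [h]
        simp only [e]
        by_cases hz : z ∈ U
        · rw [indicator_of_mem hz]
          exact_mod_cast hN z _ (Finset.filter_subset _ _) fun i hi => (Finset.mem_filter.1 hi).2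
        · rw [indicator_of_notMem hz, nonpos_iff_eq_zero, Nat.cast_eq_zero, Finset.card_eq_zero,
            Finset.filter_eq_empty_iff]
          exact fun i hi h => hz (hBU i hi h)
    _ = N * σ U := by rw [lintegral_indicator_const hU]

variable {d n : ℕ}

lemma card_le_of_abs_sub_le {c : ℕ} (s : Finset (Fin d → ℤ))
    (h : ∀ m ∈ s, ∀ m' ∈ s, ∀ i, |m i - m' i| ≤ c) : s.card ≤ (2 * c + 1) ^ d := by
  classical
  rcases s.eq_empty_or_nonempty with rfl | ⟨m₀, hm₀⟩
  · simp
  have hs : s ⊆ Fintype.piFinset fun i => Finset.Icc (m₀ i - c) (m₀ i + c) := by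
    intro m hm
    rw [Fintype.mem_piFinset]
    intro i
    have := abs_le.1 (h m hm m₀ hm₀ i)
    rw [Finset.mem_Icc]
    constructor <;> linarith
  refine (Finset.card_le_card hs).trans ?_
  rw [Fintype.card_piFinset]
  have : ∀ i, (Finset.Icc (m₀ i - c) (m₀ i + c)).card = 2 * c + 1 := fun i => by
    rw [Int.card_Icc]; omega
  simp [this]

/-- The cube `m` of generation `j` contains a point of `K` whose image is nearest to a point of
`E` at distance about `2^{-j}`. -/
def Ind (K : Set (Eucl d)) (E : Set (Eucl n)) (g : Eucl d → Eucl n) (j : ℕ) (m : Fin d → ℤ) : Prop :=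
  ∃ v ∈ K, idx j v = m ∧ ∃ y ∈ E, dy (j + 1) < dist y (g v) ∧ dist y (g v) ≤ dy j ∧
    infDist y (g '' K) = dist y (g v)

open Classical in
lemma tsum_ind_le {K : Set (Eucl d)} {E : Set (Eucl n)} {g : Eucl d → Eucl n} {τ : ℝ} (hτ : 0 < τ)
    (hg : LipschitzWith 1 g) (hK : ∀ v ∈ K, ∀ i, |v i| < 2)
    (hbi : ∀ v ∈ K, ∀ v' ∈ K, τ / 2 * ‖v - v'‖ ≤ dist (g v) (g v'))
    {σ : Measure (Eucl n)} {c₀ : ℝ} (hc₀ : 0 < c₀)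
    (hlo : ∀ y ∈ E, ∀ t : ℝ, 0 < t → t ≤ 1 → ENNReal.ofReal (c₀ * t ^ d) ≤ σ (ball y t)) :
    ∑' j, ∑ m ∈ box d 2 j, (if Ind K E g j m then ENNReal.ofReal (dy j ^ d) else 0) ≤
      ENNReal.ofReal (8 ^ d / c₀) *
        ((((2 * (⌈6 / τ⌉₊ + 1) + 1) ^ d * 2 : ℕ) : ℝ≥0∞) * σ (closedBall (g 0) (2 * d + 2))) := by
  have hch : ∀ p : (_ : ℕ) × (Fin d → ℤ), ∃ y : Eucl n, ∃ v : Eucl d, Ind K E g p.1 p.2 → v ∈ K ∧ idx p.1 v = p.2 ∧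
      y ∈ E ∧ dy (p.1 + 1) < dist y (g v) ∧ dist y (g v) ≤ dy p.1 ∧
      infDist y (g '' K) = dist y (g v) := by
    intro p
    by_cases h : Ind K E g p.1 p.2
    · obtain ⟨v, h1, h2, y, h3⟩ := h
      exact ⟨y, v, fun _ => ⟨h1, h2, h3⟩⟩
    · exact ⟨0, 0, fun h' => absurd h' h⟩
  choose y v hyv using hch
  set B : (_ : ℕ) × (Fin d → ℤ) → Set (Eucl n) := fun p =>
    if Ind K E g p.1 p.2 then ball (y p) (dy (p.1 + 3)) else ∅ with hBdef
  have hB : ∀ p z, z ∈ B p → Ind K E g p.1 p.2 ∧ dist z (y p) < dy (p.1 + 3) := by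
    intro p z hz
    by_cases h : Ind K E g p.1 p.2
    · simp only [hBdef, if_pos h, mem_ball] at hz
      exact ⟨h, hz⟩
    · simp [hBdef, if_neg h] at hz
  have hd3 : ∀ j, dy (j + 3) = dy j / 8 := fun j => by simp only [dy_succ]; ring
  refine ENNReal.tsum_le_of_sum_range_le fun J => ?_
  have hterm : ∀ p : (_ : ℕ) × (Fin d → ℤ), (if Ind K E g p.1 p.2 then ENNReal.ofReal (dy p.1 ^ d) else 0)
      ≤ ENNReal.ofReal (8 ^ d / c₀) * σ (B p) := by
    intro p
    by_cases h : Ind K E g p.1 p.2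
    · have hp := dy_pos p.1
      have h1 := hlo _ (hyv p h).2.2.1 (dy (p.1 + 3)) (dy_pos _) (dy_le_one _)
      simp only [hBdef, if_pos h]
      calc ENNReal.ofReal (dy p.1 ^ d)
          = ENNReal.ofReal (8 ^ d / c₀) * ENNReal.ofReal (c₀ * dy (p.1 + 3) ^ d) := by
            rw [← ENNReal.ofReal_mul (by positivity), hd3, div_pow]
            congr 1
            field_simp
        _ ≤ _ := by gcongr
    · simp [h]
  calc ∑ j ∈ Finset.range J, ∑ m ∈ box d 2 j, (if Ind K E g j m then ENNReal.ofReal (dy j ^ d) else 0)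
      = ∑ p ∈ (Finset.range J).sigma (fun j => box d 2 j),
          (if Ind K E g p.1 p.2 then ENNReal.ofReal (dy p.1 ^ d) else 0) := by
        rw [Finset.sum_sigma]
    _ ≤ ∑ p ∈ (Finset.range J).sigma (fun j => box d 2 j), ENNReal.ofReal (8 ^ d / c₀) * σ (B p) :=
        Finset.sum_le_sum fun p _ => hterm p
    _ ≤ _ := by
        rw [← Finset.mul_sum]
        gcongr
        refine sum_measure_le_of_overlap σ _ B (fun p _ => ?_) measurableSet_closedBall ?_ _ ?_
        · simp only [hBdef]; split_ifs
          · exact measurableSet_ball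
          · exact MeasurableSet.empty
        · intro p _ z hz
          obtain ⟨h, hz⟩ := hB p z hz
          obtain ⟨h1, -, -, -, h2, -⟩ := hyv p h
          have e1 : ‖v p‖ ≤ d * 2 := norm_le_of_abs_le fun i => (hK _ h1 i).le
          have e2 := hg.dist_le_mul (v p) 0
          rw [NNReal.coe_one, one_mul, dist_zero_right] at e2
          have e3 := dist_triangle4 z (y p) (g (v p)) (g 0)
          have e4 := dy_le_one p.1
          have e5 := hd3 p.1
          rw [mem_closedBall]
          linarith
        · intro z t _ htz
          have hgen : ∀ p ∈ t, 3 / 8 * dy p.1 < infDist z (g '' K) ∧ infDist z (g '' K) ≤ 9 / 8 * dy p.1 := by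
            intro p hp
            obtain ⟨h, hz⟩ := hB p z (htz p hp)
            obtain ⟨-, -, -, h1, h2, h3⟩ := hyv p h
            have e1 := infDist_le_infDist_add_dist (s := g '' K) (x := z) (y := y p)
            have e2 := infDist_le_infDist_add_dist (s := g '' K) (x := y p) (y := z)
            rw [dist_comm] at e2
            rw [dy_succ] at h1
            have e5 := hd3 p.1
            constructor <;> linarith
          have hle : ∀ p ∈ t, ∀ p' ∈ t, p'.1 ≤ p.1 + 1 := by
            intro p hp p' hp'
            by_contra! hc
            have h1 := (hgen p hp).1
            have h2 := (hgen p' hp').2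
            have h3 : dy p'.1 ≤ dy (p.1 + 2) := dy_anti (by omega)
            simp only [dy_succ] at h3
            have := dy_pos p.1
            linarith
          refine (Finset.card_le_mul_card_image (f := Sigma.fst) t _ fun j _ => ?_).trans
            (Nat.mul_le_mul_left _ ?_)
          · rw [← Finset.card_image_of_injOn (f := fun p : (_ : ℕ) × (Fin d → ℤ) => p.2)]
            · refine card_le_of_abs_sub_le _ fun m hm m' hm' i => ?_
              rw [Finset.mem_image] at hm hm'
              obtain ⟨p, hp, rfl⟩ := hm
              obtain ⟨p', hp', rfl⟩ := hm'
              rw [Finset.mem_filter] at hp hp'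
              obtain ⟨h, hz⟩ := hB p z (htz p hp.1)
              obtain ⟨h', hz'⟩ := hB p' z (htz p' hp'.1)
              obtain ⟨a1, a2, -, -, a3, -⟩ := hyv p h
              obtain ⟨b1, b2, -, -, b3, -⟩ := hyv p' h'
              have hj := hp.2
              have hj' := hp'.2
              rw [← a2, ← b2, hj, hj']
              refine abs_idx_sub_le ?_
              rw [hd3, hj] at hz
              rw [hd3, hj'] at hz'
              rw [hj] at a3
              rw [hj'] at b3
              have e1 := hbi _ a1 _ b1
              have e2 := dist_triangle4 (g (v p)) (y p) z (g (v p'))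
              have e3 := dist_triangle z (y p') (g (v p'))
              rw [dist_comm (g (v p)) (y p), dist_comm (y p) z] at e2
              have e4 := abs_apply_le_norm (v p - v p') i
              have hjp := dy_pos j
              have e5 : ‖v p - v p'‖ ≤ 6 / τ * dy j := by
                rw [div_mul_eq_mul_div, le_div_iff₀ hτ]
                linarith
              refine (show |(v p) i - (v p') i| ≤ _ from e4).trans (e5.trans ?_)
              gcongr
              exact Nat.le_ceil _
            · rintro ⟨j1, m1⟩ h1 ⟨j2, m2⟩ h2 h
              simp only [Finset.coe_filter, mem_ofPred_eq] at h1 h2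
              obtain ⟨-, rfl⟩ := h1
              obtain ⟨-, rfl⟩ := h2
              simp only at h
              rw [h]
          · rcases (t.image Sigma.fst).eq_empty_or_nonempty with h0 | h0
            · simp [h0]
            · refine (Finset.card_le_card (t := {(t.image Sigma.fst).min' h0, (t.image Sigma.fst).min' h0 + 1})
                fun j hj => ?_).trans (Finset.card_le_two)
              obtain ⟨p₀, hp₀, he⟩ := Finset.mem_image.1 ((t.image Sigma.fst).min'_mem h0)
              have h1 := (t.image Sigma.fst).min'_le j hj
              obtain ⟨p, hp, rfl⟩ := Finset.mem_image.1 hj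
              have h2 := hle p₀ hp₀ p hp
              rw [he] at h2
              simp only [Finset.mem_insert, Finset.mem_singleton]
              omega

end Exterior

section Series

lemma dy_rpow (e : ℕ) (s : ℝ) : dy e ^ s = ((1 / 2 : ℝ) ^ s) ^ e := by
  unfold dy
  rw [← Real.rpow_natCast, ← Real.rpow_natCast, ← Real.rpow_mul (by norm_num),
    ← Real.rpow_mul (by norm_num), mul_comm]

lemma tsum_dy_rpow_ne_top {s : ℝ} (hs : 0 < s) : ∑' e, ENNReal.ofReal (dy e ^ s) ≠ ⊤ := by
  have h1 : (1 / 2 : ℝ) ^ s < 1 := Real.rpow_lt_one (by norm_num) (by norm_num) hs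
  simp_rw [dy_rpow]
  have e : ∀ e : ℕ, ENNReal.ofReal (((1 / 2 : ℝ) ^ s) ^ e) = ENNReal.ofReal ((1 / 2 : ℝ) ^ s) ^ e :=
    fun e => ENNReal.ofReal_pow (by positivity) e
  simp_rw [e]
  rw [ENNReal.tsum_geometric, ENNReal.inv_ne_top, ne_eq, tsub_eq_zero_iff_le, not_le]
  exact ENNReal.ofReal_lt_one.2 h1

lemma ENNReal.finsetSum_rpow_le {ι : Type*} {p : ℝ} (hp : 0 < p) (hp1 : p ≤ 1) (s : Finset ι)
    (a : ι → ℝ≥0∞) : (∑ i ∈ s, a i) ^ p ≤ ∑ i ∈ s, a i ^ p := by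
  classical
  induction s using Finset.induction_on with
  | empty => simp [hp]
  | insert i s hi ih =>
    rw [Finset.sum_insert hi, Finset.sum_insert hi]
    exact (ENNReal.rpow_add_le_add_rpow _ _ hp.le hp1).trans (by gcongr)

lemma ENNReal.tsum_rpow_le {p : ℝ} (hp : 0 < p) (hp1 : p ≤ 1) (a : ℕ → ℝ≥0∞) :
    (∑' i, a i) ^ p ≤ ∑' i, a i ^ p := by
  have h := (ENNReal.continuous_rpow_const (y := p)).continuousAt.tendsto.comp
    (ENNReal.tendsto_nat_tsum a)
  exact le_of_tendsto' h fun N =>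
    (ENNReal.finsetSum_rpow_le hp hp1 _ _).trans (ENNReal.sum_le_tsum _)

/-- Jensen's inequality for geometrically weighted series. -/
lemma tsum_dy_mul_rpow_le {ε q : ℝ} (hε : 0 < ε) (hε1 : ε < 1) (hq : 1 ≤ q) (s : ℕ → ℝ≥0∞) :
    (∑' e, ENNReal.ofReal (dy e) * s e) ^ q ≤
      (∑' e, ENNReal.ofReal (dy e ^ (1 - ε))) ^ (q - 1) *
        ∑' e, ENNReal.ofReal (dy e ^ (ε * q)) * s e ^ q := by
  have hq0 : 0 < q := by linarith
  rw [← ENNReal.le_rpow_inv_iff hq0]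
  refine ENNReal.tsum_le_of_sum_range_le fun N => ?_
  rw [ENNReal.le_rpow_inv_iff hq0]
  have h := ENNReal.inner_le_weight_mul_Lp_of_nonneg (Finset.range N) hq
    (fun e => ENNReal.ofReal (dy e ^ (1 - ε))) (fun e => ENNReal.ofReal (dy e ^ ε) * s e)
  have e1 : ∀ e, ENNReal.ofReal (dy e ^ (1 - ε)) * (ENNReal.ofReal (dy e ^ ε) * s e)
      = ENNReal.ofReal (dy e) * s e := fun e => by
    rw [← mul_assoc, ← ENNReal.ofReal_mul (by have := dy_pos e; positivity),
      ← Real.rpow_add (dy_pos e)]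
    simp
  simp_rw [e1] at h
  calc _ ≤ ((∑ e ∈ Finset.range N, ENNReal.ofReal (dy e ^ (1 - ε))) ^ (1 - q⁻¹) *
        (∑ e ∈ Finset.range N, ENNReal.ofReal (dy e ^ (1 - ε)) *
          (ENNReal.ofReal (dy e ^ ε) * s e) ^ q) ^ q⁻¹) ^ q := by gcongr
    _ = (∑ e ∈ Finset.range N, ENNReal.ofReal (dy e ^ (1 - ε))) ^ (q - 1) *
        ∑ e ∈ Finset.range N, ENNReal.ofReal (dy e ^ (1 - ε)) *
          (ENNReal.ofReal (dy e ^ ε) * s e) ^ q := by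
        rw [ENNReal.mul_rpow_of_nonneg _ _ hq0.le, ← ENNReal.rpow_mul, ← ENNReal.rpow_mul,
          inv_mul_cancel₀ hq0.ne', ENNReal.rpow_one]
        congr 2
        field_simp
    _ ≤ _ := by
        gcongr ?_ ^ _ * ?_
        · exact ENNReal.sum_le_tsum _
        · refine le_trans (Finset.sum_le_sum fun e _ => ?_) (ENNReal.sum_le_tsum _)
          rw [ENNReal.mul_rpow_of_nonneg _ _ hq0.le,
            ENNReal.ofReal_rpow_of_nonneg (by have := dy_pos e; positivity) hq0.le,
            ← Real.rpow_mul (dy_pos e).le]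
          have : ENNReal.ofReal (dy e ^ (1 - ε)) ≤ 1 := by
            rw [ENNReal.ofReal_le_one]
            exact Real.rpow_le_one (dy_pos e).le (dy_le_one e) (by linarith)
          exact mul_le_of_le_one_left' this

end Series

section Pointwise

variable {d n : ℕ}

open Classical in
/-- Squared deviations together with the indicator of the cubes seen from the exterior. -/
def DE (i w : ℕ) (K : Set (Eucl d)) (E : Set (Eucl n)) (g : Eucl d → Eucl n) (f : Eucl d → ℝ)
    (j : ℕ) (m : Fin d → ℤ) : ℝ≥0∞ :=
  ENNReal.ofReal (Djt i w g f j m) + if Ind K E g j m then 1 else 0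

lemma le_DE (i w : ℕ) (K : Set (Eucl d)) (E : Set (Eucl n)) (g : Eucl d → Eucl n) (f : Eucl d → ℝ)
    (j : ℕ) (m : Fin d → ℤ) : ENNReal.ofReal (Djt i w g f j m) ≤ DE i w K E g f j m :=
  le_self_add

lemma one_le_DE (i w : ℕ) {K : Set (Eucl d)} {E : Set (Eucl n)} {g : Eucl d → Eucl n}
    (f : Eucl d → ℝ) {j : ℕ} {m : Fin d → ℤ} (h : Ind K E g j m) : 1 ≤ DE i w K E g f j m := by
  unfold DE
  rw [if_pos h]
  exact le_add_self

/-- The cubes of generation `j` close to the cube `m` of generation `k`. -/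
def near (k : ℕ) (m : Fin d → ℤ) (j : ℕ) : Finset (Fin d → ℤ) :=
  (box d 2 j).filter fun m' => ∀ i, |idx k (lpt j m') i - m i| ≤ 2

lemma idx_mem_near {k e : ℕ} {m : Fin d → ℤ} {v : Eucl d} (hv : ∀ i, |v i| < 2)
    (h : ∀ i, |idx k v i - m i| ≤ 2) : idx (k + e) v ∈ near k m (k + e) := by
  have h1 : idx k (lpt (k + e) (idx (k + e) v)) = idx k v :=
    idx_nest (Nat.le_add_right k e) (idx_lpt _ _)
  refine Finset.mem_filter.2 ⟨idx_mem_box (B := 2) (by exact_mod_cast hv), ?_⟩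
  rwa [h1]

lemma self_mem_near {k : ℕ} {m : Fin d → ℤ} (hm : m ∈ box d 2 k) : m ∈ near k m k :=
  Finset.mem_filter.2 ⟨hm, by simp [idx_lpt]⟩

/-- The contribution at `y` of the nearby cubes `e` generations below. -/
def locSum (D : ℕ → (Fin d → ℤ) → ℝ≥0∞) (g : Eucl d → Eucl n) (q : ℝ) (k : ℕ) (m : Fin d → ℤ)
    (e : ℕ) (y : Eucl n) : ℝ≥0∞ :=
  ∑ m' ∈ near k m (k + e), D (k + e) m' ^ (q / 2) *
    (closedBall (g (lpt (k + e) m')) ((d + 1) * dy (k + e))).indicator 1 y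

lemma rpow_half_le_locSum {D : ℕ → (Fin d → ℤ) → ℝ≥0∞} {g : Eucl d → Eucl n} {q : ℝ} (hq : 0 < q)
    {k : ℕ} {m m' : Fin d → ℤ} {e : ℕ} {y : Eucl n} (hm : m' ∈ near k m (k + e))
    (hy : dist y (g (lpt (k + e) m')) ≤ (d + 1) * dy (k + e)) :
    D (k + e) m' ^ (1 / 2 : ℝ) ≤ locSum D g q k m e y ^ q⁻¹ := by
  rw [ENNReal.le_rpow_inv_iff hq, ← ENNReal.rpow_mul]
  refine le_trans ?_ (Finset.single_le_sum (f := fun m' => D (k + e) m' ^ (q / 2) *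
    (closedBall (g (lpt (k + e) m')) ((d + 1) * dy (k + e))).indicator 1 y)
    (fun _ _ => zero_le) hm)
  rw [indicator_of_mem (mem_closedBall.2 hy), Pi.one_apply, mul_one]
  apply le_of_eq
  congr 1
  ring

lemma ofReal_sqrt (x : ℝ) : ENNReal.ofReal (√x) = ENNReal.ofReal x ^ (1 / 2 : ℝ) := by
  rcases le_or_gt 0 x with h | h
  · rw [Real.sqrt_eq_rpow, ENNReal.ofReal_rpow_of_nonneg h (by norm_num)]
  · rw [Real.sqrt_eq_zero_of_nonpos h.le, ENNReal.ofReal_of_nonpos h.le]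
    simp

variable {i w : ℕ} {g : Eucl d → Eucl n} {F : Eucl n → ℝ}

lemma abs_sub_affine_le (hi : 1 ≤ i) (hw : 4 ≤ w) (hg : LipschitzWith 1 g) (hF : LipschitzWith 1 F)
    {k : ℕ} {m : Fin d → ℤ} {A : Eucl n →ᵃ[ℝ] ℝ} (hA : ∀ y y', |A y - A y'| ≤ 2 * ‖y - y'‖)
    (hAt : ∀ v, A (tay g k m v) = tay (fun v => F (g v)) k m v) {v : Eucl d}
    (hv : ∀ j, |idx k v j - m j| ≤ 2) {J : ℕ} (hJ : k ≤ J) (y : Eucl n) :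
    |F y - A y| ≤ 3 * dist y (g v) + 3 * (6 * d + 1) * (dy k * √(Djt i w g (fun v => F (g v)) k m)
      + ∑ j ∈ Finset.Ico (k + 1) (J + 1), dy j * √(Djt i w g (fun v => F (g v)) j (idx j v))
      + dy J) := by
  set f : Eucl d → ℝ := fun v => F (g v) with hf
  have hfl : LipschitzWith 1 f := by
    have := hF.comp hg
    rwa [one_mul] at this
  have a1 := norm_tay_sub_le_sum (c := 2) hi hw hg v J k m hJ (by exact_mod_cast hv)
  have a2 := norm_tay_sub_le_sum (c := 2) hi hw hfl v J k m hJ (by exact_mod_cast hv)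
  have b0 := dy_pos k
  have b1 : (dy k * √(Dsq i w g k m) + ∑ j ∈ Finset.Ico (k + 1) (J + 1),
      dy j * √(Dsq i w g j (idx j v)) + dy J) ≤ dy k * √(Djt i w g f k m)
      + ∑ j ∈ Finset.Ico (k + 1) (J + 1), dy j * √(Djt i w g f j (idx j v)) + dy J := by
    gcongr with j _
    · exact le_add_of_nonneg_right (Dsq_nonneg _ _ _ _ _)
    · exact (dy_pos j).le
    · exact le_add_of_nonneg_right (Dsq_nonneg _ _ _ _ _)
  have b2 : (dy k * √(Dsq i w f k m) + ∑ j ∈ Finset.Ico (k + 1) (J + 1),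
      dy j * √(Dsq i w f j (idx j v)) + dy J) ≤ dy k * √(Djt i w g f k m)
      + ∑ j ∈ Finset.Ico (k + 1) (J + 1), dy j * √(Djt i w g f j (idx j v)) + dy J := by
    gcongr with j _
    · exact le_add_of_nonneg_left (Dsq_nonneg _ _ _ _ _)
    · exact (dy_pos j).le
    · exact le_add_of_nonneg_left (Dsq_nonneg _ _ _ _ _)
  set X := dy k * √(Djt i w g f k m)
      + ∑ j ∈ Finset.Ico (k + 1) (J + 1), dy j * √(Djt i w g f j (idx j v)) + dy J with hX
  have hc : (2 * d * ((2 : ℕ) + 1) + 1 : ℝ) = 6 * d + 1 := by push_cast; ring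
  rw [hc] at a1 a2
  have c1 := a1.trans (mul_le_mul_of_nonneg_left b1 (by positivity))
  have c2 := a2.trans (mul_le_mul_of_nonneg_left b2 (by positivity))
  have d1 : |F y - f v| ≤ dist y (g v) := by
    have := hF.dist_le_mul y (g v)
    rwa [NNReal.coe_one, one_mul, Real.dist_eq] at this
  have d2 := hA (tay g k m v) (g v)
  have d3 := hA (g v) y
  rw [← dist_eq_norm, dist_comm] at d3
  rw [hAt] at d2
  rw [Real.norm_eq_abs, abs_sub_comm] at c2
  have e : F y - A y = (F y - f v) + (f v - tay f k m v) + (tay f k m v - A (g v)) + (A (g v) - A y) := by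
    ring
  rw [e]
  have e1 := abs_add_le ((F y - f v) + (f v - tay f k m v) + (tay f k m v - A (g v))) (A (g v) - A y)
  have e2 := abs_add_le ((F y - f v) + (f v - tay f k m v)) (tay f k m v - A (g v))
  have e3 := abs_add_le (F y - f v) (f v - tay f k m v)
  linarith

lemma sum_sqrt_le_tsum_locSum {f : Eucl d → ℝ} {K : Set (Eucl d)} {E : Set (Eucl n)} {q : ℝ}
    (hq : 0 < q) (hg : LipschitzWith 1 g)
    {k : ℕ} {m : Fin d → ℤ} (hm : m ∈ box d 2 k) {v : Eucl d} (hv2 : ∀ i, |v i| < 2)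
    (hv : ∀ j, |idx k v j - m j| ≤ 2) {J : ℕ} (hJ : k ≤ J) {y : Eucl n}
    (hy : dist y (g v) ≤ dy J) (hym : dist y (g (lpt k m)) ≤ (d + 1) * dy k) :
    ENNReal.ofReal (dy k * √(Djt i w g f k m) +
      ∑ j ∈ Finset.Ico (k + 1) (J + 1), dy j * √(Djt i w g f j (idx j v))) ≤
    ENNReal.ofReal (dy k) *
      ∑' e, ENNReal.ofReal (dy e) * locSum (DE i w K E g f) g q k m e y ^ q⁻¹ := by
  obtain ⟨N, rfl⟩ := Nat.exists_eq_add_of_le hJ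
  have hlp : ∀ e ≤ N, dist y (g (lpt (k + e) (idx (k + e) v))) ≤ (d + 1) * dy (k + e) := by
    intro e he
    have h1 := norm_sub_lpt_idx (k + e) v
    have h2 := hg.dist_le_mul v (lpt (k + e) (idx (k + e) v))
    rw [NNReal.coe_one, one_mul, dist_eq_norm v] at h2
    have h3 := dist_triangle y (g v) (g (lpt (k + e) (idx (k + e) v)))
    have h4 : dy (k + N) ≤ dy (k + e) := dy_anti (by omega)
    linarith
  have e1 : dy k * √(Djt i w g f k m) +
      ∑ j ∈ Finset.Ico (k + 1) (k + N + 1), dy j * √(Djt i w g f j (idx j v)) =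
      dy k * ∑ e ∈ Finset.range (N + 1), dy e *
        (if e = 0 then √(Djt i w g f k m) else √(Djt i w g f (k + e) (idx (k + e) v))) := by
    rw [Finset.sum_range_succ', Finset.sum_Ico_eq_sum_range, add_comm, mul_add, Finset.mul_sum]
    simp only [if_true, dy_zero, one_mul, Nat.succ_ne_zero, if_false]
    have : k + N + 1 - (k + 1) = N := by omega
    rw [this]
    congr 1
    refine Finset.sum_congr rfl fun e _ => ?_
    rw [show k + 1 + e = k + (e + 1) by ring, dy_add, mul_assoc]
  rw [e1, ENNReal.ofReal_mul (dy_pos k).le, ENNReal.ofReal_sum_of_nonneg (fun e _ => by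
    have := dy_pos e; split_ifs <;> positivity)]
  gcongr
  refine (Finset.sum_le_sum fun e he => ?_).trans (ENNReal.sum_le_tsum _)
  rw [ENNReal.ofReal_mul (dy_pos e).le]
  gcongr
  by_cases h0 : e = 0
  · subst h0
    rw [if_pos rfl, ofReal_sqrt]
    refine le_trans ?_ (rpow_half_le_locSum (m' := m) hq (self_mem_near hm) hym)
    gcongr
    exact le_DE _ _ _ _ _ _ _ _
  · rw [if_neg h0, ofReal_sqrt]
    refine le_trans ?_ (rpow_half_le_locSum (m' := idx (k + e) v) hq (idx_mem_near hv2 hv)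
      (hlp e (by rw [Finset.mem_range] at he; omega)))
    gcongr
    exact le_DE _ _ _ _ _ _ _ _

/-- The pointwise distance from `F` to the affine map attached to a good cube. -/
lemma ofReal_abs_sub_affine_le (hi : 1 ≤ i) (hw : 4 ≤ w) (hg : LipschitzWith 1 g)
    (hF : LipschitzWith 1 F) {K : Set (Eucl d)} (hKc : IsCompact K) (hK : ∀ v ∈ K, ∀ i, |v i| < 2)
    {τ : ℝ} (hτ : 0 < τ) (hτ1 : τ ≤ 1)
    (hbi : ∀ v ∈ K, ∀ v' ∈ K, τ / 2 * ‖v - v'‖ ≤ dist (g v) (g v'))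
    {E : Set (Eucl n)} {q : ℝ} (hq : 0 < q) {v₀ : Eucl d} (hv₀ : v₀ ∈ K) {k : ℕ}
    {A : Eucl n →ᵃ[ℝ] ℝ} (hA : ∀ y y', |A y - A y'| ≤ 2 * ‖y - y'‖)
    (hAt : ∀ v, A (tay g k (idx k v₀) v) = tay (fun v => F (g v)) k (idx k v₀) v)
    {y : Eucl n} (hyE : y ∈ E) (hy : dist y (g v₀) < τ / 4 * dy k) :
    ENNReal.ofReal |F y - A y| ≤ ENNReal.ofReal ((36 * d + 9) * dy k) *
      ∑' e, ENNReal.ofReal (dy e) *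
        locSum (DE i w K E g fun v => F (g v)) g q k (idx k v₀) e y ^ q⁻¹ := by
  have hk := dy_pos k
  set f : Eucl d → ℝ := fun v => F (g v) with hf
  set X := ENNReal.ofReal (dy k) *
      ∑' e, ENNReal.ofReal (dy e) * locSum (DE i w K E g f) g q k (idx k v₀) e y ^ q⁻¹ with hX
  obtain ⟨_, ⟨v, hv, rfl⟩, hdist⟩ := (hKc.image hg.continuous).exists_infDist_eq_dist
    ⟨g v₀, mem_image_of_mem g hv₀⟩ y
  have hle : dist y (g v) < τ / 4 * dy k := by
    rw [← hdist]
    exact (infDist_le_dist_of_mem (mem_image_of_mem g hv₀)).trans_lt hy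
  have hm : idx k v₀ ∈ box d 2 k := idx_mem_box (B := 2) (by exact_mod_cast hK v₀ hv₀)
  have hnear : ∀ j, |idx k v j - idx k v₀ j| ≤ 2 := by
    intro j
    have h1 := hbi v hv v₀ hv₀
    have h2 := dist_triangle_left (g v) (g v₀) y
    have h3 : ‖v - v₀‖ ≤ dy k := by
      have : τ * ‖v - v₀‖ ≤ τ * dy k := by linarith
      exact le_of_mul_le_mul_left this hτ
    have h4 := abs_apply_le_norm (v - v₀) j
    have h5 := abs_idx_sub_le (c := 1) (k := k) (v := v) (w := v₀) (i := j)
      (by rw [Nat.cast_one, one_mul]; exact h4.trans h3)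
    exact_mod_cast h5
  have hym : dist y (g (lpt k (idx k v₀))) ≤ (d + 1) * dy k := by
    have h1 := norm_sub_lpt_idx k v₀
    have h2 := hg.dist_le_mul v₀ (lpt k (idx k v₀))
    rw [NNReal.coe_one, one_mul, dist_eq_norm v₀] at h2
    have h3 := dist_triangle y (g v₀) (g (lpt k (idx k v₀)))
    nlinarith
  have hmain : ∀ J, k ≤ J → dist y (g v) ≤ dy J → ENNReal.ofReal |F y - A y| ≤
      ENNReal.ofReal (3 * (6 * d + 1)) * X + ENNReal.ofReal ((18 * d + 6) * dy J) := by
    intro J hJ hyJ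
    have h1 := abs_sub_affine_le (J := J) hi hw hg hF hA hAt hnear hJ y
    have h2 := sum_sqrt_le_tsum_locSum (i := i) (w := w) (f := f) (K := K) (E := E) hq hg hm (hK v hv)
      hnear hJ hyJ hym
    have hJp := dy_pos J
    set Y := dy k * √(Djt i w g f k (idx k v₀)) +
      ∑ j ∈ Finset.Ico (k + 1) (J + 1), dy j * √(Djt i w g f j (idx j v))
    have hY : 0 ≤ Y := by
      have : ∀ j, 0 ≤ dy j := fun j => (dy_pos j).le
      exact add_nonneg (by positivity)
        (Finset.sum_nonneg fun j _ => mul_nonneg (this j) (Real.sqrt_nonneg _))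
    calc ENNReal.ofReal |F y - A y|
        ≤ ENNReal.ofReal (3 * (6 * d + 1) * Y + (18 * d + 6) * dy J) := by
          apply ENNReal.ofReal_le_ofReal
          linarith
      _ = ENNReal.ofReal (3 * (6 * d + 1)) * ENNReal.ofReal Y + ENNReal.ofReal ((18 * d + 6) * dy J) := by
          rw [ENNReal.ofReal_add (by positivity) (by positivity), ENNReal.ofReal_mul (by positivity)]
      _ ≤ _ := by gcongr
  rw [ENNReal.ofReal_mul (by positivity), mul_assoc]
  change _ ≤ _ * X
  by_cases h0 : dist y (g v) = 0
  · have ht : Filter.Tendsto (fun N : ℕ => ENNReal.ofReal (3 * (6 * d + 1)) * X +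
        ENNReal.ofReal ((18 * d + 6) * dy (k + N))) Filter.atTop
        (nhds (ENNReal.ofReal (3 * (6 * d + 1)) * X + ENNReal.ofReal ((18 * d + 6) * 0))) := by
      refine tendsto_const_nhds.add (ENNReal.continuous_ofReal.continuousAt.tendsto.comp ?_)
      refine tendsto_const_nhds.mul ?_
      have : Filter.Tendsto (fun N : ℕ => dy k * (1 / 2 : ℝ) ^ N) Filter.atTop (nhds (dy k * 0)) :=
        tendsto_const_nhds.mul (tendsto_pow_atTop_nhds_zero_of_lt_one (by norm_num) (by norm_num))
      rw [mul_zero] at this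
      refine this.congr fun N => ?_
      rw [dy_add]; rfl
    refine (ge_of_tendsto' ht fun N => hmain (k + N) (Nat.le_add_right _ _) ?_).trans ?_
    · rw [h0]; exact (dy_pos _).le
    · rw [mul_zero, ENNReal.ofReal_zero, add_zero]
      gcongr
      linarith [(Nat.cast_nonneg d : (0 : ℝ) ≤ d)]
  · have hpos : 0 < dist y (g v) := lt_of_le_of_ne dist_nonneg (Ne.symm h0)
    obtain ⟨J, hJ1, hJ2⟩ := exists_nat_pow_near_of_lt_one (x := dist y (g v)) (y := (1 / 2 : ℝ))
      hpos (by nlinarith [dy_le_one k]) (by norm_num) (by norm_num)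
    change dy (J + 1) < _ at hJ1
    change _ ≤ dy J at hJ2
    have hkJ : k ≤ J := by
      by_contra! hc
      have h1 : dy k ≤ dy (J + 1) := dy_anti hc
      nlinarith
    have hInd : Ind K E g J (idx J v) := ⟨v, hv, rfl, y, hyE, hJ1, hJ2, hdist⟩
    have hJX : ENNReal.ofReal (dy J) ≤ X := by
      obtain ⟨e, rfl⟩ := Nat.exists_eq_add_of_le hkJ
      have hlp : dist y (g (lpt (k + e) (idx (k + e) v))) ≤ (d + 1) * dy (k + e) := by
        have h1 := norm_sub_lpt_idx (k + e) v
        have h2 := hg.dist_le_mul v (lpt (k + e) (idx (k + e) v))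
        rw [NNReal.coe_one, one_mul, dist_eq_norm v] at h2
        have h3 := dist_triangle y (g v) (g (lpt (k + e) (idx (k + e) v)))
        linarith
      rw [dy_add, ENNReal.ofReal_mul hk.le, hX]
      gcongr
      refine le_trans ?_ (ENNReal.le_tsum e)
      have h1 : (1 : ℝ≥0∞) ≤ locSum (DE i w K E g f) g q k (idx k v₀) e y ^ q⁻¹ := by
        refine le_trans ?_ (rpow_half_le_locSum (m' := idx (k + e) v) hq
          (idx_mem_near (hK v hv) hnear) hlp)
        exact ENNReal.one_le_rpow (one_le_DE _ _ _ hInd) (by norm_num)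
      calc ENNReal.ofReal (dy e) = ENNReal.ofReal (dy e) * 1 := (mul_one _).symm
        _ ≤ _ := by gcongr
    calc ENNReal.ofReal |F y - A y|
        ≤ ENNReal.ofReal (3 * (6 * d + 1)) * X + ENNReal.ofReal ((18 * d + 6) * dy J) := hmain J hkJ hJ2
      _ ≤ ENNReal.ofReal (3 * (6 * d + 1)) * X + ENNReal.ofReal (18 * d + 6) * X := by
          rw [ENNReal.ofReal_mul (by positivity : (0 : ℝ) ≤ 18 * d + 6)]
          gcongr
      _ = _ := by
          rw [← add_mul, ← ENNReal.ofReal_add (by positivity) (by positivity)]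
          congr 2; ring

end Pointwise

section LocalEstimate

variable {d n : ℕ}

/-- The squared `L^q` deviation of `F` from affine maps of gradient at most `2`, normalized by the
`d`-th power of the radius. -/
def Phi (σ : Measure (Eucl n)) (F : Eucl n → ℝ) (q : ℝ) (d : ℕ) (x : Eucl n) (t : ℝ) : ℝ≥0∞ :=
  ⨅ A : {A : Eucl n →ᵃ[ℝ] ℝ // gradNorm A ≤ 2},
    ((ENNReal.ofReal (t ^ d))⁻¹ * ∫⁻ y in ball x t, ENNReal.ofReal (|F y - A.1 y| / t) ^ q ∂σ) ^ (2 / q)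

lemma gradNorm_const (c : ℝ) : gradNorm (AffineMap.const ℝ (Eucl n) c) = 0 := by
  have : LinearMap.toContinuousLinearMap (AffineMap.const ℝ (Eucl n) c).linear = 0 := by
    ext y; simp
  rw [gradNorm, this, norm_zero]

lemma Phi_le_of_lipschitz {σ : Measure (Eucl n)} {F : Eucl n → ℝ} (hF : LipschitzWith 1 F) {q : ℝ}
    (hq : 0 < q) {x : Eucl n} {t C : ℝ} (ht : 0 < t)
    (hσ : σ (ball x t) ≤ ENNReal.ofReal (C * t ^ d)) :
    Phi σ F q d x t ≤ ENNReal.ofReal C ^ (2 / q) := by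
  refine (iInf_le _ ⟨AffineMap.const ℝ (Eucl n) (F x), by rw [gradNorm_const]; norm_num⟩).trans ?_
  have h1 : ∫⁻ y in ball x t, ENNReal.ofReal (|F y - F x| / t) ^ q ∂σ ≤ σ (ball x t) := by
    calc _ ≤ ∫⁻ y in ball x t, 1 ∂σ := by
          refine setLIntegral_mono measurable_one fun y hy => ?_
          have h2 := hF.dist_le_mul y x
          rw [NNReal.coe_one, one_mul, Real.dist_eq] at h2
          refine ENNReal.rpow_le_one ?_ hq.le
          rw [ENNReal.ofReal_le_one, div_le_one ht]
          exact h2.trans (mem_ball.1 hy).le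
      _ = σ (ball x t) := by simp
  have h3 : (ENNReal.ofReal (t ^ d))⁻¹ * ∫⁻ y in ball x t, ENNReal.ofReal (|F y - F x| / t) ^ q ∂σ
      ≤ ENNReal.ofReal C := by
    have e0 : ENNReal.ofReal (t ^ d) ≠ 0 := by
      rw [ne_eq, ENNReal.ofReal_eq_zero, not_le]; positivity
    calc _ ≤ (ENNReal.ofReal (t ^ d))⁻¹ * (ENNReal.ofReal (t ^ d) * ENNReal.ofReal C) := by
          gcongr
          rw [← ENNReal.ofReal_mul (by positivity), mul_comm (t ^ d)]
          exact h1.trans hσ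
      _ = ENNReal.ofReal C := by
          rw [← mul_assoc, ENNReal.inv_mul_cancel e0 ENNReal.ofReal_ne_top, one_mul]
  simp only [AffineMap.const_apply]
  exact ENNReal.rpow_le_rpow h3 (by positivity)

/-- The weighted sum of `D` over the nearby cubes of later generations. -/
def Hsum (D : ℕ → (Fin d → ℤ) → ℝ≥0∞) (β : ℝ) (k : ℕ) (m : Fin d → ℤ) : ℝ≥0∞ :=
  ∑' e, ENNReal.ofReal (dy e ^ β) * ∑ m' ∈ near k m (k + e), D (k + e) m'

lemma le_Hsum (D : ℕ → (Fin d → ℤ) → ℝ≥0∞) (β : ℝ) {k : ℕ} {m : Fin d → ℤ} (hm : m ∈ box d 2 k) :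
    D k m ≤ Hsum D β k m := by
  refine le_trans ?_ (ENNReal.le_tsum 0)
  rw [dy_zero, Real.one_rpow, ENNReal.ofReal_one, one_mul]
  exact Finset.single_le_sum (f := fun m' => D (k + 0) m') (fun _ _ => zero_le) (self_mem_near hm)

lemma sum_near_le (D : (Fin d → ℤ) → ℝ≥0∞) (k j : ℕ) :
    ∑ m ∈ box d 2 k, ∑ m' ∈ near k m j, D m' ≤ (9 ^ d : ℕ) * ∑ m' ∈ box d 2 j, D m' := by
  classical
  rw [Finset.sum_comm' (t' := box d 2 j)
    (s' := fun m' => (box d 2 k).filter fun m => ∀ i, |idx k (lpt j m') i - m i| ≤ 2), Finset.mul_sum]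
  · refine Finset.sum_le_sum fun m' _ => ?_
    rw [Finset.sum_const, nsmul_eq_mul]
    gcongr
    refine card_le_of_abs_sub_le (c := 4) _ fun m hm m₂ hm₂ i => ?_
    have h1 := abs_le.1 ((Finset.mem_filter.1 hm).2 i)
    have h2 := abs_le.1 ((Finset.mem_filter.1 hm₂).2 i)
    rw [abs_le]
    push_cast
    constructor <;> linarith
  · intro m m'
    simp only [near, Finset.mem_filter]
    tauto

lemma tsum_Hsum_le (D : ℕ → (Fin d → ℤ) → ℝ≥0∞) (β : ℝ) :
    ∑' k, ∑ m ∈ box d 2 k, ENNReal.ofReal (dy k ^ d) * Hsum D β k m ≤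
      ((9 ^ d : ℕ) * ∑' e, ENNReal.ofReal (dy e ^ (β - d))) *
        ∑' j, ∑ m ∈ box d 2 j, ENNReal.ofReal (dy j ^ d) * D j m := by
  set G : ℕ → ℝ≥0∞ := fun j => ∑ m ∈ box d 2 j, ENNReal.ofReal (dy j ^ d) * D j m with hG
  have h1 : ∀ k, ∑ m ∈ box d 2 k, ENNReal.ofReal (dy k ^ d) * Hsum D β k m ≤
      ∑' e, (9 ^ d : ℕ) * ENNReal.ofReal (dy e ^ (β - d)) * G (k + e) := by
    intro k
    unfold Hsum
    simp_rw [← ENNReal.tsum_mul_left]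
    rw [← Summable.tsum_finsetSum fun _ _ => ENNReal.summable]
    refine ENNReal.tsum_le_tsum fun e => ?_
    have e1 : ENNReal.ofReal (dy k ^ d) * ENNReal.ofReal (dy e ^ β) =
        ENNReal.ofReal (dy e ^ (β - d)) * ENNReal.ofReal (dy (k + e) ^ d) := by
      have := dy_pos e
      have := dy_pos k
      rw [← ENNReal.ofReal_mul (by positivity), ← ENNReal.ofReal_mul (by positivity), dy_add,
        Real.rpow_sub (dy_pos e), Real.rpow_natCast, mul_pow]
      congr 1
      field_simp
    calc ∑ m ∈ box d 2 k, ENNReal.ofReal (dy k ^ d) *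
          (ENNReal.ofReal (dy e ^ β) * ∑ m' ∈ near k m (k + e), D (k + e) m')
        = ENNReal.ofReal (dy k ^ d) * ENNReal.ofReal (dy e ^ β) *
          ∑ m ∈ box d 2 k, ∑ m' ∈ near k m (k + e), D (k + e) m' := by
          rw [Finset.mul_sum]
          exact Finset.sum_congr rfl fun m _ => by rw [mul_assoc]
      _ ≤ ENNReal.ofReal (dy e ^ (β - d)) * ENNReal.ofReal (dy (k + e) ^ d) *
          ((9 ^ d : ℕ) * ∑ m' ∈ box d 2 (k + e), D (k + e) m') := by
          rw [e1]; gcongr; exact sum_near_le _ _ _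
      _ = _ := by
          simp only [hG]
          rw [← Finset.mul_sum]
          ring
  calc _ ≤ ∑' k, ∑' e, (9 ^ d : ℕ) * ENNReal.ofReal (dy e ^ (β - d)) * G (k + e) :=
        ENNReal.tsum_le_tsum h1
    _ = ∑' e, ∑' k, (9 ^ d : ℕ) * ENNReal.ofReal (dy e ^ (β - d)) * G (k + e) := ENNReal.tsum_comm
    _ ≤ ∑' e, (9 ^ d : ℕ) * ENNReal.ofReal (dy e ^ (β - d)) * ∑' j, G j := by
        refine ENNReal.tsum_le_tsum fun e => ?_
        rw [ENNReal.tsum_mul_left]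
        refine mul_le_mul' le_rfl ?_
        exact ENNReal.tsum_comp_le_tsum_of_injective (add_left_injective e) G
    _ = _ := by rw [ENNReal.tsum_mul_right, ENNReal.tsum_mul_left]

lemma measurable_locSum (D : ℕ → (Fin d → ℤ) → ℝ≥0∞) (g : Eucl d → Eucl n) (q : ℝ) (k : ℕ)
    (m : Fin d → ℤ) (e : ℕ) : Measurable (locSum D g q k m e) :=
  Finset.measurable_fun_sum _ fun _ _ =>
    measurable_const.mul (measurable_one.indicator measurableSet_closedBall)

lemma lintegral_locSum_le {σ : Measure (Eucl n)} {C₀ : ℝ}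
    (hσ : ∀ x, ∀ t : ℝ, 0 < t → t ≤ d + 1 → σ (closedBall x t) ≤ ENNReal.ofReal (C₀ * t ^ d))
    (D : ℕ → (Fin d → ℤ) → ℝ≥0∞) (g : Eucl d → Eucl n) (q : ℝ) (k : ℕ) (m : Fin d → ℤ) (e : ℕ) :
    ∫⁻ y, locSum D g q k m e y ∂σ ≤ ENNReal.ofReal (C₀ * ((d + 1) * dy (k + e)) ^ d) *
      ∑ m' ∈ near k m (k + e), D (k + e) m' ^ (q / 2) := by
  unfold locSum
  have hms : ∀ m', Measurable fun y => D (k + e) m' ^ (q / 2) *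
      (closedBall (g (lpt (k + e) m')) ((d + 1) * dy (k + e))).indicator (1 : Eucl n → ℝ≥0∞) y :=
    fun _ => (measurable_one.indicator measurableSet_closedBall).const_mul _
  rw [lintegral_finsetSum _ fun m' _ => hms m', Finset.mul_sum]
  refine Finset.sum_le_sum fun m' _ => ?_
  rw [lintegral_const_mul _ (measurable_one.indicator measurableSet_closedBall),
    lintegral_indicator_one measurableSet_closedBall, mul_comm]
  gcongr
  have h1 := dy_pos (k + e)
  have h2 := dy_le_one (k + e)
  refine hσ _ _ (by positivity) ?_
  have : (0 : ℝ) ≤ d := Nat.cast_nonneg d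
  nlinarith

/-- The constant of the estimate of `Phi` on good cubes. -/
def locConst (d e₀ : ℕ) (ε q C₀ : ℝ) : ℝ≥0∞ :=
  (ENNReal.ofReal ((36 * d + 9) / dy e₀) ^ q *
    (∑' e, ENNReal.ofReal (dy e ^ (1 - ε))) ^ (q - 1) * ENNReal.ofReal (C₀ * (d + 1) ^ d / dy e₀ ^ d))
    ^ (2 / q)

lemma locConst_ne_top (d e₀ : ℕ) {ε q : ℝ} (hε1 : ε < 1) (hq : 2 ≤ q) (C₀ : ℝ) :
    locConst d e₀ ε q C₀ ≠ ⊤ := by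
  unfold locConst
  refine ENNReal.rpow_ne_top_of_nonneg (by positivity) ?_
  refine ENNReal.mul_ne_top (ENNReal.mul_ne_top ?_ ?_) ENNReal.ofReal_ne_top
  · exact ENNReal.rpow_ne_top_of_nonneg (by positivity) ENNReal.ofReal_ne_top
  · exact ENNReal.rpow_ne_top_of_nonneg (by linarith) (tsum_dy_rpow_ne_top (by linarith))

lemma Phi_le_of_pointwise {σ : Measure (Eucl n)} {E : Set (Eucl n)} (hσE : ∀ᵐ y ∂σ, y ∈ E)
    {C₀ : ℝ} (hC₀ : 0 ≤ C₀)
    (hσ : ∀ x, ∀ t : ℝ, 0 < t → t ≤ d + 1 → σ (closedBall x t) ≤ ENNReal.ofReal (C₀ * t ^ d))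
    {F : Eucl n → ℝ} {ε q : ℝ} (hε : 0 < ε) (hε1 : ε < 1) (hq : 2 ≤ q)
    {D : ℕ → (Fin d → ℤ) → ℝ≥0∞} {g : Eucl d → Eucl n} {k e₀ : ℕ} {m : Fin d → ℤ} {x : Eucl n}
    {A : Eucl n →ᵃ[ℝ] ℝ} (hA : gradNorm A ≤ 2)
    (h : ∀ y ∈ E, dist y x < dy (e₀ + k) → ENNReal.ofReal |F y - A y| ≤
      ENNReal.ofReal ((36 * d + 9) * dy k) * ∑' e, ENNReal.ofReal (dy e) * locSum D g q k m e y ^ q⁻¹) :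
    Phi σ F q d x (dy (e₀ + k)) ≤ locConst d e₀ ε q C₀ * Hsum D (2 * ε + 2 * d / q) k m := by
  have hq0 : 0 < q := by linarith
  have hk := dy_pos k
  have he := dy_pos e₀
  have ht := dy_pos (e₀ + k)
  refine (iInf_le _ ⟨A, hA⟩).trans ?_
  set t := dy (e₀ + k) with htdef
  set P₁ := ENNReal.ofReal ((36 * d + 9) / dy e₀) ^ q *
    (∑' e, ENNReal.ofReal (dy e ^ (1 - ε))) ^ (q - 1) with hP₁
  have hpt : ∀ y ∈ E, dist y x < t → ENNReal.ofReal (|F y - A y| / t) ^ q ≤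
      P₁ * ∑' e, ENNReal.ofReal (dy e ^ (ε * q)) * locSum D g q k m e y := by
    intro y hyE hy
    have h1 : ENNReal.ofReal (|F y - A y| / t) ≤ ENNReal.ofReal ((36 * d + 9) / dy e₀) *
        ∑' e, ENNReal.ofReal (dy e) * locSum D g q k m e y ^ q⁻¹ := by
      rw [ENNReal.ofReal_div_of_pos ht]
      refine ENNReal.div_le_of_le_mul ((h y hyE hy).trans (le_of_eq ?_))
      rw [mul_right_comm, ← ENNReal.ofReal_mul (by positivity), htdef, dy_add]
      congr 2
      field_simp
    calc _ ≤ (ENNReal.ofReal ((36 * d + 9) / dy e₀) *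
        ∑' e, ENNReal.ofReal (dy e) * locSum D g q k m e y ^ q⁻¹) ^ q := by gcongr
      _ ≤ _ := by
        rw [ENNReal.mul_rpow_of_nonneg _ _ hq0.le, hP₁, mul_assoc]
        gcongr
        refine (tsum_dy_mul_rpow_le hε hε1 (by linarith) _).trans (le_of_eq ?_)
        congr 1
        refine tsum_congr fun e => ?_
        rw [← ENNReal.rpow_mul, inv_mul_cancel₀ hq0.ne', ENNReal.rpow_one]
  have hint : ∫⁻ y in ball x t, ENNReal.ofReal (|F y - A y| / t) ^ q ∂σ ≤
      ENNReal.ofReal (t ^ d) * (P₁ * ENNReal.ofReal (C₀ * (d + 1) ^ d / dy e₀ ^ d) *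
        ∑' e, ENNReal.ofReal (dy e ^ (ε * q + d)) * ∑ m' ∈ near k m (k + e), D (k + e) m' ^ (q / 2)) := by
    calc _ ≤ ∫⁻ y in ball x t, P₁ * ∑' e, ENNReal.ofReal (dy e ^ (ε * q)) * locSum D g q k m e y ∂σ := by
          refine lintegral_mono_ae ?_
          filter_upwards [ae_restrict_of_ae hσE, ae_restrict_mem measurableSet_ball] with y hy hyb
          exact hpt y hy hyb
      _ ≤ ∫⁻ y, P₁ * ∑' e, ENNReal.ofReal (dy e ^ (ε * q)) * locSum D g q k m e y ∂σ :=
          setLIntegral_le_lintegral _ _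
      _ = P₁ * ∑' e, ENNReal.ofReal (dy e ^ (ε * q)) * ∫⁻ y, locSum D g q k m e y ∂σ := by
          have hms := measurable_locSum D g q k m
          rw [lintegral_const_mul _ (Measurable.tsum fun e => (hms e).const_mul _),
            lintegral_tsum fun e => ((hms e).const_mul _).aemeasurable]
          simp_rw [lintegral_const_mul _ (hms _)]
      _ ≤ P₁ * ∑' e, ENNReal.ofReal (dy e ^ (ε * q)) *
          (ENNReal.ofReal (C₀ * ((d + 1) * dy (k + e)) ^ d) *
            ∑ m' ∈ near k m (k + e), D (k + e) m' ^ (q / 2)) := by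
          gcongr with e
          exact lintegral_locSum_le hσ D g q k m e
      _ = _ := by
          clear_value P₁
          rw [mul_assoc P₁, mul_left_comm (ENNReal.ofReal (t ^ d)) P₁]
          congr 1
          rw [← mul_assoc, ← ENNReal.tsum_mul_left]
          refine tsum_congr fun e => ?_
          rw [← mul_assoc, ← mul_assoc]
          congr 1
          have := dy_pos e
          rw [← ENNReal.ofReal_mul (by positivity), ← ENNReal.ofReal_mul (by positivity),
            ← ENNReal.ofReal_mul (by positivity), Real.rpow_add (dy_pos e), Real.rpow_natCast, htdef,
            dy_add, dy_add]
          congr 1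
          simp only [mul_pow]
          field_simp
  have ht0 : ENNReal.ofReal (t ^ d) ≠ 0 := by
    rw [ne_eq, ENNReal.ofReal_eq_zero, not_le]; positivity
  have h2 : (ENNReal.ofReal (t ^ d))⁻¹ * ∫⁻ y in ball x t, ENNReal.ofReal (|F y - A y| / t) ^ q ∂σ ≤
      P₁ * ENNReal.ofReal (C₀ * (d + 1) ^ d / dy e₀ ^ d) *
        ∑' e, ENNReal.ofReal (dy e ^ (ε * q + d)) * ∑ m' ∈ near k m (k + e), D (k + e) m' ^ (q / 2) := by
    calc _ ≤ (ENNReal.ofReal (t ^ d))⁻¹ * (ENNReal.ofReal (t ^ d) * _) := by gcongr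
      _ = _ := by
        rw [← mul_assoc, ENNReal.inv_mul_cancel ht0 ENNReal.ofReal_ne_top, one_mul]
  have hq2 : 0 < 2 / q := by positivity
  have hq21 : 2 / q ≤ 1 := by rw [div_le_one hq0]; exact hq
  refine (ENNReal.rpow_le_rpow h2 hq2.le).trans ?_
  rw [ENNReal.mul_rpow_of_nonneg _ _ hq2.le]
  change locConst d e₀ ε q C₀ * _ ≤ _
  gcongr
  refine (ENNReal.tsum_rpow_le hq2 hq21 _).trans (ENNReal.tsum_le_tsum fun e => ?_)
  rw [ENNReal.mul_rpow_of_nonneg _ _ hq2.le, ENNReal.ofReal_rpow_of_nonneg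
    (by have := dy_pos e; positivity) hq2.le, ← Real.rpow_mul (dy_pos e).le]
  have e1 : (ε * q + d) * (2 / q) = 2 * ε + 2 * d / q := by field_simp
  rw [e1]
  gcongr
  refine (ENNReal.finsetSum_rpow_le hq2 hq21 _ _).trans (le_of_eq ?_)
  refine Finset.sum_congr rfl fun m' _ => ?_
  rw [← ENNReal.rpow_mul]
  have e2 : q / 2 * (2 / q) = 1 := by field_simp
  rw [e2, ENNReal.rpow_one]

end LocalEstimate

section UnitPiece

variable {d n : ℕ}

lemma exists_dy_le {x : ℝ} (hx : 0 < x) : ∃ k, 1 ≤ k ∧ dy k ≤ x := by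
  obtain ⟨k, hk⟩ := exists_pow_lt_of_lt_one hx (by norm_num : (1 / 2 : ℝ) < 1)
  exact ⟨k + 1, by omega, (dy_anti (Nat.le_succ k)).trans hk.le⟩

lemma isAddHaarMeasure_hausdorff (d : ℕ) : (μH[d] : Measure (Eucl d)).IsAddHaarMeasure := by
  have h : ((Module.finrank ℝ (Eucl d) : ℕ) : ℝ) = d := by simp
  have := isAddHaarMeasure_hausdorffMeasure (E := Eucl d)
  rwa [h] at this

lemma tsum_DE_le {i w : ℕ} {K : Set (Eucl d)} {E : Set (Eucl n)} {g : Eucl d → Eucl n}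
    {f : Eucl d → ℝ} :
    ∑' j, ∑ m ∈ box d 2 j, ENNReal.ofReal (dy j ^ d) * DE i w K E g f j m =
      ∑' j, ∑ m ∈ box d 2 j, ENNReal.ofReal (dy j ^ d * Djt i w g f j m) +
      ∑' j, ∑ m ∈ box d 2 j, (open Classical in if Ind K E g j m then ENNReal.ofReal (dy j ^ d) else 0) := by
  rw [← ENNReal.tsum_add]
  refine tsum_congr fun j => ?_
  rw [← Finset.sum_add_distrib]
  refine Finset.sum_congr rfl fun m _ => ?_
  have := dy_pos j
  rw [DE, mul_add, ← ENNReal.ofReal_mul (by positivity)]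
  congr 1
  split_ifs <;> simp

lemma hausdorffMeasure_le_of_antilipschitz {g : Eucl d → Eucl n} {K : Set (Eucl d)} {τ : ℝ}
    (hτ : 0 < τ) (hbi : ∀ v ∈ K, ∀ v' ∈ K, τ / 2 * ‖v - v'‖ ≤ dist (g v) (g v')) :
    μH[d] K ≤ ENNReal.ofReal (2 / τ) ^ d * μH[d] (g '' K) := by
  classical
  have hinj : InjOn g K := by
    intro v hv v' hv' h
    have h1 := hbi v hv v' hv'
    rw [h, dist_self] at h1
    have h2 : ‖v - v'‖ ≤ 0 := by
      by_contra! h3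
      have : 0 < τ / 2 * ‖v - v'‖ := by positivity
      linarith
    exact sub_eq_zero.1 (norm_le_zero_iff.1 h2)
  have hL : LipschitzOnWith (Real.toNNReal (2 / τ)) (Function.invFunOn g K) (g '' K) := by
    refine LipschitzOnWith.of_dist_le_mul ?_
    rintro _ ⟨v, hv, rfl⟩ _ ⟨v', hv', rfl⟩
    rw [hinj.leftInvOn_invFunOn hv, hinj.leftInvOn_invFunOn hv', Real.coe_toNNReal _ (by positivity),
      dist_eq_norm]
    have := hbi v hv v' hv'
    calc ‖v - v'‖ = 2 / τ * (τ / 2 * ‖v - v'‖) := by field_simp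
      _ ≤ _ := by gcongr
  have h1 := hL.hausdorffMeasure_image_le (d := d) (Nat.cast_nonneg d)
  rw [hinj.leftInvOn_invFunOn.image_image, ENNReal.rpow_natCast] at h1
  exact h1

lemma Phi_le_of_good {i w e₀ : ℕ} {g : Eucl d → Eucl n} {F : Eucl n → ℝ} {τ : ℝ} (hi1 : 1 ≤ i)
    (hw : 4 ≤ w) (hi : 2 * d * dy i ≤ τ / 8) (he₀ : dy e₀ ≤ τ / 4) (hτ : 0 < τ) (hτ1 : τ ≤ 1)
    (hg : LipschitzWith 1 g) (hF : LipschitzWith 1 F) {K : Set (Eucl d)} (hKc : IsCompact K)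
    (hK : ∀ v ∈ K, ∀ j, |v j| < 2)
    (hnd : ∀ v ∈ K, ∀ k, ¬ Degen i w τ g (fun v => F (g v)) k (idx k v))
    (hbi : ∀ v ∈ K, ∀ v' ∈ K, τ / 2 * ‖v - v'‖ ≤ dist (g v) (g v'))
    {σ : Measure (Eucl n)} {E : Set (Eucl n)} (hσE : ∀ᵐ y ∂σ, y ∈ E) {C₀ : ℝ} (hC₀ : 0 ≤ C₀)
    (hσ : ∀ x, ∀ t : ℝ, 0 < t → t ≤ d + 1 → σ (closedBall x t) ≤ ENNReal.ofReal (C₀ * t ^ d))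
    {ε q : ℝ} (hε : 0 < ε) (hε1 : ε < 1) (hq : 2 ≤ q) {v : Eucl d} (hv : v ∈ K) (k : ℕ) :
    Phi σ F q d (g v) (dy (e₀ + k)) ≤
      (locConst d e₀ ε q C₀ + ENNReal.ofReal C₀ ^ (2 / q) * (ENNReal.ofReal ((τ / 8) ^ 2))⁻¹) *
      Hsum (DE i w K E g fun v => F (g v)) (2 * ε + 2 * d / q) k (idx k v) := by
  have hq0 : 0 < q := by linarith
  have hk := dy_pos k
  rw [add_mul]
  rcases lt_or_ge (Djt i w g (fun v => F (g v)) k (idx k v)) ((τ / 8) ^ 2) with hD | hD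
  · obtain ⟨A, hA, hA2, hAt⟩ := exists_affine_of_good (by omega) hτ hi hg hF (hnd v hv k) hD
    refine le_add_right (Phi_le_of_pointwise (g := g) hσE hC₀ hσ hε hε1 hq hA fun y hyE hy => ?_)
    refine ofReal_abs_sub_affine_le hi1 hw hg hF hKc hK hτ hτ1 hbi hq0 hv hA2 hAt hyE ?_
    rw [dy_add] at hy
    exact hy.trans_le (by gcongr)
  · refine le_add_left ?_
    have h1 : Phi σ F q d (g v) (dy (e₀ + k)) ≤ ENNReal.ofReal C₀ ^ (2 / q) := by
      refine Phi_le_of_lipschitz hF hq0 (dy_pos _) ?_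
      refine (measure_mono ball_subset_closedBall).trans (hσ _ _ (dy_pos _) ?_)
      have := dy_le_one (e₀ + k)
      have : (0 : ℝ) ≤ d := Nat.cast_nonneg d
      linarith
    have h0 : ENNReal.ofReal ((τ / 8) ^ 2) ≠ 0 := by
      rw [ne_eq, ENNReal.ofReal_eq_zero, not_le]; positivity
    calc _ ≤ ENNReal.ofReal C₀ ^ (2 / q) * 1 := by rwa [mul_one]
      _ = ENNReal.ofReal C₀ ^ (2 / q) * (ENNReal.ofReal ((τ / 8) ^ 2))⁻¹ * ENNReal.ofReal ((τ / 8) ^ 2) := by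
          rw [mul_assoc, ENNReal.inv_mul_cancel h0 ENNReal.ofReal_ne_top]
      _ ≤ _ := by
          gcongr
          refine (ENNReal.ofReal_le_ofReal hD).trans ((le_DE i w K E g _ k _).trans (le_Hsum _ _ ?_))
          exact idx_mem_box (fun j => by simpa using hK v hv j)

lemma exists_compact_tsum_le (ν : Measure (Eucl d)) [ν.IsAddHaarMeasure] {K : Set (Eucl d)}
    (hK : MeasurableSet K) (hK2 : ∀ v ∈ K, ∀ i, |v i| < 2) {η X : ℝ≥0∞} (hη : η ≠ 0) (hηt : η ≠ ⊤)
    (hX : X ≠ ⊤) (hηK : η ≤ ν K) (H : ℕ → (Fin d → ℤ) → ℝ≥0∞)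
    (hH : (ENNReal.ofReal ((d + 1) ^ d) * ν (ball 0 1)) *
      ∑' k, ∑ m ∈ box d 2 k, ENNReal.ofReal (dy k ^ d) * H k m ≤ X) :
    ∃ K' ⊆ K, IsCompact K' ∧ η / 4 ≤ ν K' ∧ ∀ v ∈ K', ∑' k, H k (idx k v) ≤ 2 * (X + 1) / η := by
  set s : Eucl d → ℝ≥0∞ := fun v => ∑' k, H k (idx k v)
  have hs : Measurable s := Measurable.tsum fun k =>
    (Measurable.of_discrete (f := H k)).comp (measurable_idx k)
  have hm0 : 2 * (X + 1) / η ≠ 0 := by simp [hηt]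
  have hmt : 2 * (X + 1) / η ≠ ⊤ :=
    ENNReal.div_ne_top (ENNReal.mul_ne_top (by simp) (ENNReal.add_ne_top.2 ⟨hX, by simp⟩)) hη
  have h1 : (ν.restrict K) {v | 2 * (X + 1) / η ≤ s v} ≤ η / 2 := by
    refine (meas_ge_le_lintegral_div hs.aemeasurable hm0 hmt).trans ?_
    refine ENNReal.div_le_of_le_mul ?_
    calc ∫⁻ v in K, s v ∂ν ≤ X := (lintegral_tsum_idx_le ν hK hK2 H).trans hH
      _ ≤ X + 1 := le_self_add
      _ = η / 2 * (2 * (X + 1) / η) := by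
        rw [div_eq_mul_inv, div_eq_mul_inv,
          show η * 2⁻¹ * (2 * (X + 1) * η⁻¹) = (η * η⁻¹) * (2⁻¹ * 2) * (X + 1) by ring,
          ENNReal.mul_inv_cancel hη hηt, ENNReal.inv_mul_cancel (by simp) (by simp)]
        simp
  have hms : MeasurableSet {v | 2 * (X + 1) / η ≤ s v} := measurableSet_le measurable_const hs
  rw [Measure.restrict_apply hms] at h1
  have h2 : η / 4 < ν (K \ {v | 2 * (X + 1) / η ≤ s v}) := by
    have h3 : ν K ≤ η / 2 + ν (K \ {v | 2 * (X + 1) / η ≤ s v}) := by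
      rw [← measure_inter_add_sdiff K hms, inter_comm]
      gcongr
    have h4 : η / 2 ≤ ν (K \ {v | 2 * (X + 1) / η ≤ s v}) := by
      have h5 : η / 2 + η / 2 ≤ η / 2 + ν (K \ {v | 2 * (X + 1) / η ≤ s v}) := by
        rw [ENNReal.add_halves]; exact hηK.trans h3
      exact (ENNReal.add_le_add_iff_left (ENNReal.div_ne_top hηt (by simp))).1 h5
    refine lt_of_lt_of_le ?_ h4
    exact ENNReal.div_lt_div_left hη hηt (by norm_num)
  obtain ⟨K', hK'K, hK'c, hlt⟩ := (hK.diff hms).exists_lt_isCompact h2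
  exact ⟨K', hK'K.trans sdiff_subset, hK'c, hlt.le, fun v hv => (not_le.1 (hK'K hv).2).le⟩

lemma exists_beta {q : ℝ} (hq : 2 ≤ q) (hq2 : d * (1 - 2 / q) < 2) :
    ∃ ε : ℝ, 0 < ε ∧ ε < 1 ∧ (d : ℝ) < 2 * ε + 2 * d / q := by
  have h0 : 0 ≤ d * (1 - 2 / q) := by
    have : 2 / q ≤ 1 := by rw [div_le_one (by linarith)]; exact hq
    have : (0 : ℝ) ≤ d := Nat.cast_nonneg d
    have : 0 ≤ 1 - 2 / q := by linarith
    positivity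
  refine ⟨(d * (1 - 2 / q) + 2) / 4, by linarith, by linarith, ?_⟩
  have : 2 * (d : ℝ) / q = d * (2 / q) := by ring
  rw [this]
  linarith

lemma exists_small_slope {c θ : ℝ} (hc : 0 ≤ c) (hθ : 0 < θ) :
    ∃ τ : ℝ, 0 < τ ∧ τ ≤ 1 ∧ c * τ ≤ θ := by
  refine ⟨min 1 (θ / (c + 1)), by positivity, min_le_left _ _, ?_⟩
  calc c * min 1 (θ / (c + 1)) ≤ c * (θ / (c + 1)) := by gcongr; exact min_le_right _ _
    _ = c / (c + 1) * θ := by ring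
    _ ≤ 1 * θ := by gcongr; rw [div_le_one (by linarith)]; linarith
    _ = θ := one_mul _

/-- On a big piece of a Lipschitz image at unit scale, there is a compact subset of large measure on
which the sum of the squared deviations is bounded. -/
lemma exists_unit_piece (n d : ℕ) {q C₀ c₀ θ : ℝ} (hq : 2 ≤ q) (hq2 : d * (1 - 2 / q) < 2)
    (hC₀ : 0 ≤ C₀) (hc₀ : 0 < c₀) (hθ : 0 < θ) :
    ∃ e₀ : ℕ, ∃ η : ℝ≥0∞, η ≠ 0 ∧ ∃ N : ℝ≥0∞, N ≠ ⊤ ∧ ∀ E : Set (Eucl n), MeasurableSet E →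
      ∀ σ : Measure (Eucl n), σ = μH[d].restrict E →
      (∀ x, ∀ t : ℝ, 0 < t → t ≤ 5 * (d + 3) → σ (closedBall x t) ≤ ENNReal.ofReal (C₀ * t ^ d)) →
      (∀ y ∈ E, ∀ t : ℝ, 0 < t → t ≤ 1 → ENNReal.ofReal (c₀ * t ^ d) ≤ σ (ball y t)) →
      ∀ F : Eucl n → ℝ, LipschitzWith 1 F → ∀ g : Eucl d → Eucl n, LipschitzWith 1 g →
      ∀ A ⊆ E, MeasurableSet A → ENNReal.ofReal θ ≤ σ (A ∩ g '' ball 0 1) →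
      ∃ G ⊆ A, IsCompact G ∧ η ≤ σ G ∧ ∀ y ∈ G, ∑' k, Phi σ F q d y (dy (e₀ + k)) ≤ N := by
  classical
  have := isAddHaarMeasure_hausdorff d
  set ν : Measure (Eucl d) := μH[d] with hν
  obtain ⟨ε, hε, hε1, hβ⟩ := exists_beta hq hq2
  have hd : (0 : ℝ) ≤ d := Nat.cast_nonneg d
  obtain ⟨τ, hτ, hτ1, hτθ⟩ := exists_small_slope (θ := θ / 4)
    (c := C₀ * (5 * (d + 3)) ^ d * (2 * (2 * (d + 3)) ^ d) * (2 * (3 * d + 1)) ^ d)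
    (by positivity) (by positivity)
  obtain ⟨i, hi1, hi'⟩ := exists_dy_le (x := τ / 8 / (2 * d + 1)) (by positivity)
  have hi : 2 * d * dy i ≤ τ / 8 := by
    calc 2 * d * dy i ≤ (2 * d + 1) * (τ / 8 / (2 * d + 1)) := by
          have := dy_pos i
          gcongr
          linarith
      _ = τ / 8 := by field_simp
  obtain ⟨e₀, -, he₀⟩ := exists_dy_le (x := τ / 4) (by positivity)
  obtain ⟨C₂, hC₂, htr⟩ := exists_translate (d := d) n i 8 2
  obtain ⟨η₁, hη₁, hgood⟩ := exists_good_compact (W := Eucl n) ν (ENNReal.ofReal C₂) ENNReal.ofReal_ne_top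
    (ε := (τ / 8) ^ 2) (by positivity) hθ
  set η := min η₁ 1 with hη
  have hη0 : η ≠ 0 := by rw [hη]; exact (lt_min (pos_iff_ne_zero.2 hη₁) one_pos).ne'
  have hηt : η ≠ ⊤ := (min_le_right η₁ 1 |>.trans_lt ENNReal.one_lt_top).ne
  set T : ℝ≥0∞ := ENNReal.ofReal C₂ + ENNReal.ofReal (8 ^ d / c₀) *
    ((((2 * (⌈6 / τ⌉₊ + 1) + 1) ^ d * 2 : ℕ) : ℝ≥0∞) * ENNReal.ofReal (C₀ * (2 * d + 2) ^ d)) with hT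
  have hTt : T ≠ ⊤ := ENNReal.add_ne_top.2 ⟨ENNReal.ofReal_ne_top, ENNReal.mul_ne_top
    ENNReal.ofReal_ne_top (ENNReal.mul_ne_top (ENNReal.natCast_ne_top _) ENNReal.ofReal_ne_top)⟩
  set β := 2 * ε + 2 * d / q
  set X : ℝ≥0∞ := (ENNReal.ofReal ((d + 1) ^ d) * ν (ball 0 1)) *
    (((9 ^ d : ℕ) * ∑' e, ENNReal.ofReal (dy e ^ (β - d))) * T) with hX
  have hXt : X ≠ ⊤ := ENNReal.mul_ne_top
    (ENNReal.mul_ne_top ENNReal.ofReal_ne_top (measure_ball_one_ne_top ν))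
    (ENNReal.mul_ne_top (ENNReal.mul_ne_top (ENNReal.natCast_ne_top _)
      (tsum_dy_rpow_ne_top (by linarith))) hTt)
  set P : ℝ≥0∞ := locConst d e₀ ε q C₀ + ENNReal.ofReal C₀ ^ (2 / q) *
    (ENNReal.ofReal ((τ / 8) ^ 2))⁻¹ with hP
  have hPt : P ≠ ⊤ := by
    refine ENNReal.add_ne_top.2 ⟨locConst_ne_top d e₀ hε1 hq C₀, ENNReal.mul_ne_top
      (ENNReal.rpow_ne_top_of_nonneg (by positivity) ENNReal.ofReal_ne_top) (ENNReal.inv_ne_top.2 ?_)⟩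
    rw [ne_eq, ENNReal.ofReal_eq_zero, not_le]; positivity
  have hpt : ENNReal.ofReal (2 / τ) ^ d ≠ ⊤ := ENNReal.pow_ne_top ENNReal.ofReal_ne_top
  refine ⟨e₀, η / 4 / ENNReal.ofReal (2 / τ) ^ d, ?_, P * (2 * (X + 1) / η), ?_, ?_⟩
  · refine (ENNReal.div_pos (ENNReal.div_pos hη0 (by simp)).ne' hpt).ne'
  · exact ENNReal.mul_ne_top hPt (ENNReal.div_ne_top
      (ENNReal.mul_ne_top (by simp) (ENNReal.add_ne_top.2 ⟨hXt, by simp⟩)) hη0)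
  intro E hE σ hσdef hup hlo F hF g₀ hg₀ A hAE hA hθA
  have hσE : ∀ᵐ y ∂σ, y ∈ E := by rw [hσdef]; exact ae_restrict_mem hE
  obtain ⟨z, hz, htr'⟩ := htr g₀ (fun v => F (g₀ v)) hg₀ (by simpa [Function.comp_def] using hF.comp hg₀)
  set g : Eucl d → Eucl n := fun v => g₀ (v + z) with hgdef
  have hg : LipschitzWith 1 g := by
    refine LipschitzWith.of_dist_le_mul fun v v' => ?_
    simpa using hg₀.dist_le_mul (v + z) (v' + z)
  have hup' : ∀ x, ∀ t : ℝ, 0 < t → t ≤ d + 1 → σ (closedBall x t) ≤ ENNReal.ofReal (C₀ * t ^ d) :=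
    fun x t ht htd => hup x t ht (by linarith)
  set S : Set (Eucl d) := {v | ‖v + z‖ < 1} ∩ g ⁻¹' A with hS
  have hSm : MeasurableSet S := by
    refine MeasurableSet.inter ?_ (hg.continuous.measurable hA)
    exact (isOpen_lt (by fun_prop) continuous_const).measurableSet
  have hS2 : ∀ v ∈ S, ∀ j, |v j| < 2 := by
    intro v hv j
    have h1 : ‖v + z‖ < 1 := hv.1
    have h2 : ‖v‖ ≤ ‖v + z‖ + ‖z‖ := by
      calc ‖v‖ = ‖(v + z) - z‖ := by simp
        _ ≤ _ := norm_sub_le _ _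
    have h3 := abs_apply_le_norm v j
    linarith
  have hgS : ENNReal.ofReal θ ≤ σ (g '' S) := by
    refine hθA.trans (measure_mono ?_)
    rintro _ ⟨hyA, v, hv, rfl⟩
    refine ⟨v - z, ⟨?_, ?_⟩, ?_⟩
    · simpa using hv
    · simpa [hgdef] using hyA
    · simp [hgdef]
  have hσν : ∀ B, σ (g '' B) ≤ ν B := by
    intro B
    rw [hσdef]
    refine (Measure.restrict_apply_le _ _).trans ?_
    have := hg.hausdorffMeasure_image_le (d := d) (Nat.cast_nonneg d) B
    simpa using this
  obtain ⟨K, hKS, hKc, hKη, hnd, hcol⟩ := hgood σ g hσν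
    (Degen i 8 τ g fun v => F (g v))
    (ENNReal.ofReal (C₀ * (5 * (d + 3)) ^ d * (2 * (2 * (d + 3)) ^ d) * τ))
    (fun k m h => h.measure_image_le (by norm_num) hτ hτ1 hi hg hC₀ hup)
    (by
      rw [← ENNReal.ofReal_mul (by positivity)]
      refine ENNReal.ofReal_le_ofReal (le_trans (le_of_eq ?_) hτθ)
      ring)
    (Djt i 8 g fun v => F (g v)) htr' S hSm hS2 hgS
  have hK2 : ∀ v ∈ K, ∀ j, |v j| < 2 := fun v hv => hS2 v (hKS hv)
  have hbi : ∀ v ∈ K, ∀ v' ∈ K, τ / 2 * ‖v - v'‖ ≤ dist (g v) (g v') := fun v hv v' hv' =>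
    antilipschitz_of_good (by norm_num) hτ hi hg hK2 hnd hcol hv hv'
  have hDE : ∑' j, ∑ m ∈ box d 2 j, ENNReal.ofReal (dy j ^ d) * DE i 8 K E g (fun v => F (g v)) j m ≤ T := by
    rw [tsum_DE_le]
    refine add_le_add htr' ((tsum_ind_le hτ hg hK2 hbi hc₀ hlo).trans ?_)
    gcongr
    exact hup _ _ (by positivity) (by linarith)
  obtain ⟨K', hK'K, hK'c, hK'η, hK'N⟩ := exists_compact_tsum_le ν hKc.measurableSet hK2 hη0 hηt hXt
    ((min_le_left _ _).trans hKη) (Hsum (DE i 8 K E g fun v => F (g v)) β) (by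
      rw [hX]
      gcongr
      exact (tsum_Hsum_le _ _).trans (by gcongr))
  have hGA : g '' K' ⊆ A := by
    rintro _ ⟨v, hv, rfl⟩
    exact (hKS (hK'K hv)).2
  refine ⟨g '' K', hGA, hK'c.image hg.continuous, ?_, ?_⟩
  · refine ENNReal.div_le_of_le_mul' (hK'η.trans ?_)
    have h1 := hausdorffMeasure_le_of_antilipschitz hτ fun v hv v' hv' =>
      hbi v (hK'K hv) v' (hK'K hv')
    rwa [hσdef, Measure.restrict_apply (hK'c.image hg.continuous).measurableSet,
      inter_eq_left.2 (hGA.trans hAE)]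
  · rintro _ ⟨v, hv, rfl⟩
    calc ∑' k, Phi σ F q d (g v) (dy (e₀ + k))
        ≤ ∑' k, P * Hsum (DE i 8 K E g fun v => F (g v)) β k (idx k v) :=
          ENNReal.tsum_le_tsum fun k => Phi_le_of_good hi1 (by norm_num) hi he₀ hτ hτ1 hg hF hKc hK2
            hnd hbi hσE hC₀ hup' hε hε1 hq (hK'K hv) k
      _ = P * ∑' k, Hsum (DE i 8 K E g fun v => F (g v)) β k (idx k v) := ENNReal.tsum_mul_left
      _ ≤ _ := by gcongr; exact hK'N v hv

end UnitPiece

section Scaling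

variable {d n : ℕ}

open scoped Pointwise in
lemma hausdorffMeasure_preimage_smul {s : ℝ} (hs : 0 < s) (B : Set (Eucl n)) :
    μH[d] B = ENNReal.ofReal (s ^ d) * μH[d] ((fun y : Eucl n => s • y) ⁻¹' B) := by
  have h := Measure.hausdorffMeasure_smul₀ (d := (d : ℝ)) (Nat.cast_nonneg d) hs.ne'
    ((fun y : Eucl n => s • y) ⁻¹' B)
  have h2 : s • ((fun y : Eucl n => s • y) ⁻¹' B) = B := by
    change (fun y : Eucl n => s • y) '' _ = B
    exact image_preimage_eq _ (Homeomorph.smulOfNeZero s hs.ne').surjective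
  rw [h2, NNReal.rpow_natCast] at h
  rw [h, ENNReal.smul_def, smul_eq_mul]
  congr 1
  rw [ENNReal.ofReal_pow hs.le, ENNReal.coe_pow]
  congr 1
  rw [← enorm_eq_nnnorm, Real.enorm_eq_ofReal hs.le]

lemma restrict_eq_smul_map {s : ℝ} (hs : 0 < s) {E : Set (Eucl n)} (hE : MeasurableSet E) :
    (μH[d] : Measure (Eucl n)).restrict E = ENNReal.ofReal (s ^ d) •
      Measure.map (Homeomorph.smulOfNeZero s hs.ne').toMeasurableEquiv
        ((μH[d] : Measure (Eucl n)).restrict ((fun y : Eucl n => s • y) ⁻¹' E)) := by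
  have hm : Measurable fun y : Eucl n => s • y := measurable_const_smul s
  ext B hB
  rw [Measure.smul_apply, MeasurableEquiv.map_apply, Measure.restrict_apply hB, smul_eq_mul,
    Measure.restrict_apply' (hm hE), hausdorffMeasure_preimage_smul hs (B ∩ E)]
  rfl

lemma restrict_apply_smul {s : ℝ} (hs : 0 < s) {E : Set (Eucl n)} (hE : MeasurableSet E)
    (B : Set (Eucl n)) :
    (μH[d] : Measure (Eucl n)).restrict E B = ENNReal.ofReal (s ^ d) *
      (μH[d] : Measure (Eucl n)).restrict ((fun y : Eucl n => s • y) ⁻¹' E)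
        ((fun y : Eucl n => s • y) ⁻¹' B) := by
  rw [restrict_eq_smul_map hs hE, Measure.smul_apply, MeasurableEquiv.map_apply, smul_eq_mul]
  rfl

lemma preimage_smul_ball {s : ℝ} (hs : 0 < s) (x : Eucl n) (t : ℝ) :
    (fun y : Eucl n => s • y) ⁻¹' ball (s • x) (s * t) = ball x t := by
  ext y
  rw [mem_preimage, mem_ball, mem_ball, dist_smul₀, Real.norm_of_nonneg hs.le,
    mul_lt_mul_iff_right₀ hs]

lemma preimage_smul_closedBall {s : ℝ} (hs : 0 < s) (x : Eucl n) (t : ℝ) :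
    (fun y : Eucl n => s • y) ⁻¹' closedBall (s • x) (s * t) = closedBall x t := by
  ext y
  rw [mem_preimage, mem_closedBall, mem_closedBall, dist_smul₀, Real.norm_of_nonneg hs.le,
    mul_le_mul_iff_right₀ hs]

/-- The affine map `y ↦ s A(y / s)`. -/
def rescaleAffine (s : ℝ) (A : Eucl n →ᵃ[ℝ] ℝ) : Eucl n →ᵃ[ℝ] ℝ :=
  s • A.comp (s⁻¹ • LinearMap.id (R := ℝ) (M := Eucl n)).toAffineMap

lemma rescaleAffine_smul {s : ℝ} (hs : 0 < s) (A : Eucl n →ᵃ[ℝ] ℝ) (y : Eucl n) :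
    rescaleAffine s A (s • y) = s * A y := by
  simp [rescaleAffine, smul_smul, hs.ne']

lemma gradNorm_rescaleAffine {s : ℝ} (hs : 0 < s) (A : Eucl n →ᵃ[ℝ] ℝ) :
    gradNorm (rescaleAffine s A) = gradNorm A := by
  have : (rescaleAffine s A).linear = A.linear := by
    ext y
    simp [rescaleAffine, hs.ne']
  rw [gradNorm, gradNorm, this]

lemma setLIntegral_map_measurableEquiv {X Y : Type*} [MeasurableSpace X] [MeasurableSpace Y]
    (e : X ≃ᵐ Y) (μ : Measure X) (f : Y → ℝ≥0∞) (S : Set Y) :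
    ∫⁻ y in S, f y ∂(Measure.map e μ) = ∫⁻ x in e ⁻¹' S, f (e x) ∂μ := by
  rw [MeasurableEquiv.restrict_map, lintegral_map_equiv]

lemma setLIntegral_ball_smul {s : ℝ} (hs : 0 < s) {E : Set (Eucl n)} (hE : MeasurableSet E)
    (f : Eucl n → ℝ≥0∞) (x : Eucl n) (t : ℝ) :
    ∫⁻ y in ball (s • x) (s * t), f y ∂((μH[d] : Measure (Eucl n)).restrict E) =
      ENNReal.ofReal (s ^ d) * ∫⁻ y in ball x t, f (s • y)
        ∂((μH[d] : Measure (Eucl n)).restrict ((fun y : Eucl n => s • y) ⁻¹' E)) := by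
  rw [restrict_eq_smul_map hs hE, Measure.restrict_smul, lintegral_smul_measure, smul_eq_mul,
    setLIntegral_map_measurableEquiv, ← preimage_smul_ball hs x t]
  rfl

lemma Phi_smul_le {s : ℝ} (hs : 0 < s) {E : Set (Eucl n)} (hE : MeasurableSet E) (F : Eucl n → ℝ)
    (q : ℝ) (x : Eucl n) (t : ℝ) :
    Phi ((μH[d] : Measure (Eucl n)).restrict E) F q d (s • x) (s * t) ≤
      Phi ((μH[d] : Measure (Eucl n)).restrict ((fun y : Eucl n => s • y) ⁻¹' E))
        (fun y => F (s • y) / s) q d x t := by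
  refine le_iInf fun A => (iInf_le _ ⟨rescaleAffine s A.1, by
    rw [gradNorm_rescaleAffine hs]; exact A.2⟩).trans (le_of_eq ?_)
  congr 1
  have e1 : ∀ y, |F (s • y) - rescaleAffine s A.1 (s • y)| / (s * t) = |F (s • y) / s - A.1 y| / t := by
    intro y
    rw [rescaleAffine_smul hs, show F (s • y) - s * A.1 y = s * (F (s • y) / s - A.1 y) by field_simp,
      abs_mul, abs_of_pos hs, mul_div_mul_left _ _ hs.ne']
  have h0 : ENNReal.ofReal (s ^ d) ≠ 0 := by
    rw [ne_eq, ENNReal.ofReal_eq_zero, not_le]; positivity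
  rw [setLIntegral_ball_smul hs hE, mul_pow, ENNReal.ofReal_mul (by positivity),
    ENNReal.mul_inv (Or.inl h0)
    (Or.inl ENNReal.ofReal_ne_top), mul_comm (ENNReal.ofReal (s ^ d))⁻¹, mul_assoc,
    ← mul_assoc (ENNReal.ofReal (s ^ d))⁻¹, ENNReal.inv_mul_cancel h0 ENNReal.ofReal_ne_top, one_mul]
  simp_rw [e1]

/-- On a big piece of a Lipschitz image at scale `s`, there is a compact subset of large measure on
which the sum of the squared deviations is bounded. -/
lemma exists_piece (n d : ℕ) {q C₀ c₀ θ : ℝ} (hq : 2 ≤ q) (hq2 : d * (1 - 2 / q) < 2)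
    (hC₀ : 0 ≤ C₀) (hc₀ : 0 < c₀) (hθ : 0 < θ) :
    ∃ e₀ : ℕ, ∃ η : ℝ≥0∞, η ≠ 0 ∧ ∃ N : ℝ≥0∞, N ≠ ⊤ ∧ ∀ E : Set (Eucl n), MeasurableSet E →
      ∀ σ : Measure (Eucl n), σ = μH[d].restrict E →
      (∀ x, ∀ t : ℝ, 0 < t → σ (closedBall x t) ≤ ENNReal.ofReal (C₀ * t ^ d)) →
      ∀ s : ℝ, 0 < s →
      (∀ y ∈ E, ∀ t : ℝ, 0 < t → t ≤ s → ENNReal.ofReal (c₀ * t ^ d) ≤ σ (ball y t)) →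
      ∀ F : Eucl n → ℝ, LipschitzWith 1 F → ∀ g : Eucl d → Eucl n, LipschitzWith 1 g →
      ∀ A ⊆ E, MeasurableSet A → ENNReal.ofReal (θ * s ^ d) ≤ σ (A ∩ g '' ball 0 s) →
      ∃ G ⊆ A, IsCompact G ∧ ENNReal.ofReal (s ^ d) * η ≤ σ G ∧
        ∀ y ∈ G, ∑' k, Phi σ F q d y (s * dy (e₀ + k)) ≤ N := by
  obtain ⟨e₀, η, hη, N, hN, h⟩ := exists_unit_piece n d hq hq2 hC₀ hc₀ hθ
  refine ⟨e₀, η, hη, N, hN, ?_⟩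
  rintro E hE σ rfl hup s hs hlo F hF g hg A hAE hA hθA
  have hm : Measurable fun y : Eucl n => s • y := measurable_const_smul s
  have h0 : ENNReal.ofReal (s ^ d) ≠ 0 := by
    rw [ne_eq, ENNReal.ofReal_eq_zero, not_le]; positivity
  have hcancel : ∀ {c : ℝ} {Y : ℝ≥0∞}, 0 ≤ c →
      (ENNReal.ofReal (s ^ d) * Y ≤ ENNReal.ofReal (c * s ^ d) ↔ Y ≤ ENNReal.ofReal c) := by
    intro c Y hc
    rw [mul_comm c, ENNReal.ofReal_mul (by positivity),
      ENNReal.mul_le_mul_iff_right h0 ENNReal.ofReal_ne_top]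
  have hcancel2 : ∀ {c : ℝ} {Y : ℝ≥0∞}, 0 ≤ c →
      (ENNReal.ofReal (c * s ^ d) ≤ ENNReal.ofReal (s ^ d) * Y ↔ ENNReal.ofReal c ≤ Y) := by
    intro c Y hc
    rw [mul_comm c, ENNReal.ofReal_mul (by positivity),
      ENNReal.mul_le_mul_iff_right h0 ENNReal.ofReal_ne_top]
  have hup' : ∀ x, ∀ t : ℝ, 0 < t → t ≤ 5 * (d + 3) →
      (μH[d] : Measure (Eucl n)).restrict ((fun y : Eucl n => s • y) ⁻¹' E) (closedBall x t) ≤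
        ENNReal.ofReal (C₀ * t ^ d) := by
    intro x t ht _
    rw [← hcancel (by positivity), ← preimage_smul_closedBall hs, ← restrict_apply_smul hs hE]
    refine (hup _ _ (by positivity)).trans (le_of_eq ?_)
    rw [mul_pow]; ring_nf
  have hlo' : ∀ y ∈ (fun y : Eucl n => s • y) ⁻¹' E, ∀ t : ℝ, 0 < t → t ≤ 1 →
      ENNReal.ofReal (c₀ * t ^ d) ≤
        (μH[d] : Measure (Eucl n)).restrict ((fun y : Eucl n => s • y) ⁻¹' E) (ball y t) := by
    intro y hy t ht ht1
    rw [← hcancel2 (by positivity), ← preimage_smul_ball hs, ← restrict_apply_smul hs hE]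
    refine (le_of_eq ?_).trans (hlo _ hy (s * t) (by positivity) (by nlinarith))
    rw [mul_pow]; ring_nf
  have hF' : LipschitzWith 1 fun y : Eucl n => F (s • y) / s := by
    refine LipschitzWith.of_dist_le_mul fun y y' => ?_
    have h1 := hF.dist_le_mul (s • y) (s • y')
    rw [dist_smul₀, Real.norm_of_nonneg hs.le, NNReal.coe_one, one_mul] at h1
    rw [Real.dist_eq, ← sub_div, abs_div, abs_of_pos hs, div_le_iff₀ hs, ← Real.dist_eq, NNReal.coe_one,
      one_mul, mul_comm]
    exact h1
  have hg' : LipschitzWith 1 fun v : Eucl d => s⁻¹ • g (s • v) := by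
    refine LipschitzWith.of_dist_le_mul fun y y' => ?_
    have h1 := hg.dist_le_mul (s • y) (s • y')
    rw [dist_smul₀, Real.norm_of_nonneg hs.le, NNReal.coe_one, one_mul] at h1
    rw [dist_smul₀, norm_inv, Real.norm_of_nonneg hs.le, NNReal.coe_one, one_mul, inv_mul_le_iff₀ hs]
    exact h1
  have hθA' : ENNReal.ofReal θ ≤
      (μH[d] : Measure (Eucl n)).restrict ((fun y : Eucl n => s • y) ⁻¹' E)
        ((fun y : Eucl n => s • y) ⁻¹' A ∩ (fun v : Eucl d => s⁻¹ • g (s • v)) '' ball 0 1) := by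
    rw [← hcancel2 hθ.le]
    refine hθA.trans ?_
    rw [restrict_apply_smul hs hE]
    gcongr
    rintro y ⟨hyA, v, hv, hvy⟩
    refine ⟨hyA, s⁻¹ • v, ?_, ?_⟩
    · rw [mem_ball_zero_iff] at hv ⊢
      rw [norm_smul, norm_inv, Real.norm_of_nonneg hs.le, inv_mul_lt_iff₀ hs, mul_one]
      exact hv
    · simp only [smul_smul, mul_inv_cancel₀ hs.ne', one_smul, hvy, inv_mul_cancel₀ hs.ne']
  obtain ⟨G, hGA, hGc, hGη, hGN⟩ := h _ (hm hE) _ rfl hup' hlo' _ hF' _ hg' _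
    (preimage_mono hAE) (hm hA) hθA'
  refine ⟨(fun y : Eucl n => s • y) '' G, ?_, hGc.image (continuous_const_smul s), ?_, ?_⟩
  · rw [image_subset_iff]; exact hGA
  · have hinj : Function.Injective fun y : Eucl n => s • y := smul_right_injective _ hs.ne'
    rw [restrict_apply_smul hs hE, preimage_image_eq _ hinj]
    gcongr
  · rintro _ ⟨y, hy, rfl⟩
    refine le_trans (ENNReal.tsum_le_tsum fun k => ?_) (hGN y hy)
    exact Phi_smul_le hs hE F q y _

end Scaling

section Regularity

variable {d n : ℕ}

lemma Phi_le_mul_Phi {σ : Measure (Eucl n)} {F : Eucl n → ℝ} {q : ℝ} (hq : 0 < q) {ξ ζ : Eucl n}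
    {t T : ℝ} (ht : 0 < t) (hT : 0 < T) (hsub : ball ξ t ⊆ ball ζ T) (hTt : T ≤ 4 * t) :
    Phi σ F q d ξ t ≤ (ENNReal.ofReal (4 ^ d) * ENNReal.ofReal 4 ^ q) ^ (2 / q) * Phi σ F q d ζ T := by
  have hc : (ENNReal.ofReal (4 ^ d) * ENNReal.ofReal 4 ^ q) ^ (2 / q) ≠ 0 := by
    have h1 : ENNReal.ofReal (4 ^ d) ≠ 0 := by
      rw [ne_eq, ENNReal.ofReal_eq_zero, not_le]; positivity
    have h2 : ENNReal.ofReal 4 ^ q ≠ 0 :=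
      (ENNReal.rpow_pos (ENNReal.ofReal_pos.2 (by norm_num)) ENNReal.ofReal_ne_top).ne'
    have h3 : ENNReal.ofReal (4 ^ d) * ENNReal.ofReal 4 ^ q ≠ ⊤ := ENNReal.mul_ne_top
      ENNReal.ofReal_ne_top (ENNReal.rpow_ne_top_of_nonneg hq.le ENNReal.ofReal_ne_top)
    exact (ENNReal.rpow_pos (pos_iff_ne_zero.2 (mul_ne_zero h1 h2)) h3).ne'
  have hct : (ENNReal.ofReal (4 ^ d) * ENNReal.ofReal 4 ^ q) ^ (2 / q) ≠ ⊤ :=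
    ENNReal.rpow_ne_top_of_nonneg (by positivity) (ENNReal.mul_ne_top ENNReal.ofReal_ne_top
      (ENNReal.rpow_ne_top_of_nonneg hq.le ENNReal.ofReal_ne_top))
  unfold Phi
  rw [ENNReal.mul_iInf_of_ne hc hct]
  refine iInf_mono fun A => ?_
  rw [← ENNReal.mul_rpow_of_nonneg _ _ (by positivity : 0 ≤ 2 / q)]
  refine ENNReal.rpow_le_rpow ?_ (by positivity)
  have h1 : (ENNReal.ofReal (t ^ d))⁻¹ ≤ ENNReal.ofReal (4 ^ d) * (ENNReal.ofReal (T ^ d))⁻¹ := by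
    rw [← ENNReal.ofReal_inv_of_pos (by positivity), ← ENNReal.ofReal_inv_of_pos (by positivity),
      ← ENNReal.ofReal_mul (by positivity)]
    refine ENNReal.ofReal_le_ofReal ?_
    rw [inv_le_iff_one_le_mul₀ (by positivity), mul_assoc, inv_mul_eq_div, mul_div_assoc',
      le_div_iff₀ (by positivity), one_mul, ← mul_pow]
    gcongr
  have h2 : ∫⁻ y in ball ξ t, ENNReal.ofReal (|F y - A.1 y| / t) ^ q ∂σ ≤
      ENNReal.ofReal 4 ^ q * ∫⁻ y in ball ζ T, ENNReal.ofReal (|F y - A.1 y| / T) ^ q ∂σ := by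
    rw [← lintegral_const_mul' _ _ (ENNReal.rpow_ne_top_of_nonneg hq.le ENNReal.ofReal_ne_top)]
    refine (lintegral_mono_set hsub).trans (lintegral_mono fun y => ?_)
    rw [← ENNReal.mul_rpow_of_nonneg _ _ hq.le, ← ENNReal.ofReal_mul (by norm_num)]
    refine ENNReal.rpow_le_rpow (ENNReal.ofReal_le_ofReal ?_) hq.le
    rw [div_le_iff₀ ht, mul_div_assoc', div_mul_eq_mul_div, le_div_iff₀ hT]
    have := abs_nonneg (F y - A.1 y)
    nlinarith
  calc _ ≤ ENNReal.ofReal (4 ^ d) * (ENNReal.ofReal (T ^ d))⁻¹ *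
        (ENNReal.ofReal 4 ^ q * ∫⁻ y in ball ζ T, ENNReal.ofReal (|F y - A.1 y| / T) ^ q ∂σ) := by
        gcongr
    _ = _ := by ring

/-- Upper regularity at all points and all scales of a bounded Ahlfors regular set. -/
lemma exists_measure_closedBall_le (n : ℕ) : ∃ N : ℕ, ∀ (d : ℕ) (CA : ℝ) (E : Set (Eucl n)),
    AhlforsRegular E d CA → 0 < diam E → ∀ x, ∀ t : ℝ, 0 < t →
      (μH[d] : Measure (Eucl n)).restrict E (closedBall x t) ≤
        ENNReal.ofReal (CA * 3 ^ d * (N + 1) * t ^ d) := by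
  obtain ⟨T, -, hTf, hT⟩ := (isCompact_closedBall (0 : Eucl n) 1).finite_cover_balls
    (show (0 : ℝ) < 1 / 4 by norm_num)
  refine ⟨hTf.toFinset.card, ?_⟩
  intro d CA E hE hD x t ht
  obtain ⟨hCA, hE⟩ := hE
  have hb : Bornology.IsBounded E := by
    by_contra h
    rw [diam_eq_zero_of_unbounded h] at hD
    exact lt_irrefl _ hD
  rw [Measure.restrict_apply measurableSet_closedBall, inter_comm]
  rcases (E ∩ closedBall x t).eq_empty_or_nonempty with h | ⟨y, hyE, hy⟩
  · rw [h, measure_empty]; exact zero_le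
  rw [mem_closedBall] at hy
  set D := diam E
  rcases le_or_gt (3 * t) D with h3 | h3
  · calc μH[d] (E ∩ closedBall x t) ≤ μH[d] (E ∩ ball y (3 * t)) := by
          refine measure_mono (inter_subset_inter_right _ fun w hw => ?_)
          rw [mem_closedBall] at hw
          rw [mem_ball]
          have := dist_triangle_right w y x
          linarith
      _ ≤ _ := (hE y hyE _ (by positivity) h3).2
      _ ≤ _ := by
          refine ENNReal.ofReal_le_ofReal ?_
          rw [mul_pow]
          have : (0 : ℝ) ≤ hTf.toFinset.card := Nat.cast_nonneg _
          have : 0 ≤ CA * 3 ^ d * t ^ d * hTf.toFinset.card := by positivity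
          nlinarith
  · have hcov : E ⊆ ⋃ p ∈ hTf.toFinset, E ∩ ball (y + D • p) (D / 4) := by
      intro w hw
      have h1 : D⁻¹ • (w - y) ∈ closedBall (0 : Eucl n) 1 := by
        rw [mem_closedBall_zero_iff, norm_smul, norm_inv, Real.norm_of_nonneg hD.le,
          inv_mul_le_iff₀ hD, mul_one, ← dist_eq_norm]
        exact dist_le_diam_of_mem hb hw hyE
      have h2 := hT h1
      simp only [mem_iUnion, exists_prop] at h2 ⊢
      obtain ⟨p, hp, hp2⟩ := h2
      refine ⟨p, hTf.mem_toFinset.2 hp, hw, ?_⟩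
      rw [mem_ball, dist_eq_norm] at hp2 ⊢
      have h4 : w - (y + D • p) = D • (D⁻¹ • (w - y) - p) := by
        rw [smul_sub, smul_smul, mul_inv_cancel₀ hD.ne', one_smul]; abel
      rw [h4, norm_smul, Real.norm_of_nonneg hD.le]
      nlinarith
    have hpc : ∀ p : Eucl n, μH[d] (E ∩ ball (y + D • p) (D / 4)) ≤ ENNReal.ofReal (CA * D ^ d) := by
      intro p
      rcases (E ∩ ball (y + D • p) (D / 4)).eq_empty_or_nonempty with h | ⟨w, hwE, hw⟩
      · rw [h, measure_empty]; exact zero_le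
      refine (measure_mono ?_).trans (hE w hwE D hD le_rfl).2
      refine inter_subset_inter_right _ fun u hu => ?_
      rw [mem_ball] at hu hw ⊢
      have := dist_triangle_right u w (y + D • p)
      linarith
    calc μH[d] (E ∩ closedBall x t) ≤ μH[d] E := measure_mono inter_subset_left
      _ ≤ μH[d] (⋃ p ∈ hTf.toFinset, E ∩ ball (y + D • p) (D / 4)) := measure_mono hcov
      _ ≤ ∑ p ∈ hTf.toFinset, μH[d] (E ∩ ball (y + D • p) (D / 4)) := measure_biUnion_finset_le _ _
      _ ≤ ∑ p ∈ hTf.toFinset, ENNReal.ofReal (CA * D ^ d) := Finset.sum_le_sum fun p _ => hpc p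
      _ = ENNReal.ofReal (hTf.toFinset.card * (CA * D ^ d)) := by
          rw [Finset.sum_const, nsmul_eq_mul, ENNReal.ofReal_mul (Nat.cast_nonneg _), ENNReal.ofReal_natCast]
      _ ≤ _ := by
          refine ENNReal.ofReal_le_ofReal ?_
          calc hTf.toFinset.card * (CA * D ^ d) ≤ (hTf.toFinset.card + 1) * (CA * (3 * t) ^ d) := by
                gcongr
                linarith
            _ = _ := by rw [mul_pow]; ring

/-- A Borel set carrying the same restricted Hausdorff measure. -/
lemma exists_borel_hull {E : Set (Eucl n)} (hE : (μH[d] : Measure (Eucl n)) E ≠ ⊤) :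
    ∃ E', MeasurableSet E' ∧ E ⊆ E' ∧ E' ⊆ closure E ∧
      (μH[d] : Measure (Eucl n)).restrict E = (μH[d] : Measure (Eucl n)).restrict E' := by
  refine ⟨toMeasurable μH[d] E ∩ closure E, (measurableSet_toMeasurable _ _).inter
    isClosed_closure.measurableSet, subset_inter (subset_toMeasurable _ _) subset_closure,
    inter_subset_right, ?_⟩
  refine le_antisymm (Measure.restrict_mono_set _
    (subset_inter (subset_toMeasurable _ _) subset_closure)) ?_
  calc _ ≤ (μH[d] : Measure (Eucl n)).restrict (toMeasurable μH[d] E) :=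
        Measure.restrict_mono_set _ inter_subset_left
    _ = _ := Measure.restrict_toMeasurable hE

lemma AhlforsRegular.le_measure_ball {E : Set (Eucl n)} {CA : ℝ} (hE : AhlforsRegular E d CA)
    {y : Eucl n} (hy : y ∈ closure E) {t : ℝ} (ht : 0 < t) (htD : t ≤ diam E) :
    ENNReal.ofReal (CA⁻¹ / 2 ^ d * t ^ d) ≤ (μH[d] : Measure (Eucl n)).restrict E (ball y t) := by
  obtain ⟨y', hy'E, hy'⟩ := Metric.mem_closure_iff.1 hy (t / 2) (by positivity)
  rw [Measure.restrict_apply measurableSet_ball, inter_comm]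
  calc _ = ENNReal.ofReal (CA⁻¹ * (t / 2) ^ d) := by rw [div_pow]; ring_nf
    _ ≤ μH[d] (E ∩ ball y' (t / 2)) := (hE.2 y' hy'E _ (by positivity) (by linarith)).1
    _ ≤ _ := by
      refine measure_mono (inter_subset_inter_right _ fun u hu => ?_)
      rw [mem_ball] at hu ⊢
      have := dist_triangle_right u y y'
      linarith

end Regularity

section Pieces

variable {d n : ℕ}

lemma exists_bigPieces (n d : ℕ) {CA θ LUR q : ℝ} (hCA : 1 ≤ CA) (hθ : 0 < θ) (hL : 0 < LUR)
    (hq : 2 ≤ q) (hq2 : d * (1 - 2 / q) < 2) :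
    ∃ l₀ c₀ : ℕ, ∃ Q M C : ℝ≥0∞, 1 ≤ Q ∧ Q ≠ ⊤ ∧ M ≠ ⊤ ∧ C ≠ ⊤ ∧
      ∀ E : Set (Eucl n), UniformlyRectifiable E d CA θ LUR → ∀ F : Eucl n → ℝ, LipschitzWith 1 F →
      ∀ R : ℝ, 0 < R → R < 2 * diam E →
        BigPieces ((μH[d] : Measure (Eucl n)).restrict E) E
          (fun x k => Phi ((μH[d] : Measure (Eucl n)).restrict E) F q d x (R * dy k)) R l₀ c₀ Q M C := by
  have hq0 : 0 < q := by linarith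
  obtain ⟨N, hN⟩ := exists_measure_closedBall_le n
  set C₀ : ℝ := CA * 3 ^ d * (N + 1) with hC₀
  have hC₀0 : 0 ≤ C₀ := by positivity
  obtain ⟨a, -, ha⟩ := exists_dy_le (x := 1 / LUR) (by positivity)
  have hda := dy_pos a
  obtain ⟨e₀, η, hη, M, hM, hpiece⟩ := exists_piece n d (c₀ := CA⁻¹ / 2 ^ d) (θ := θ * dy a ^ d) hq hq2
    hC₀0 (by positivity) (by positivity)
  set η' := min η 1
  have hη' : η' ≠ 0 := (lt_min (pos_iff_ne_zero.2 hη) one_pos).ne'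
  have hη't : η' ≠ ⊤ := (min_le_right η 1 |>.trans_lt ENNReal.one_lt_top).ne
  set C₄ : ℝ≥0∞ := (ENNReal.ofReal (4 ^ d) * ENNReal.ofReal 4 ^ q) ^ (2 / q)
  have hC₄ : C₄ ≠ ⊤ := ENNReal.rpow_ne_top_of_nonneg (by positivity) (ENNReal.mul_ne_top
    ENNReal.ofReal_ne_top (ENNReal.rpow_ne_top_of_nonneg hq0.le ENNReal.ofReal_ne_top))
  refine ⟨a + 2, e₀, 1 + ENNReal.ofReal (C₀ * 5 ^ d) / η', M, ENNReal.ofReal C₀ ^ (2 / q) + C₄,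
    le_self_add, ENNReal.add_ne_top.2 ⟨by simp, ENNReal.div_ne_top ENNReal.ofReal_ne_top hη'⟩, hM,
    ENNReal.add_ne_top.2 ⟨ENNReal.rpow_ne_top_of_nonneg (by positivity) ENNReal.ofReal_ne_top, hC₄⟩, ?_⟩
  intro E hUR F hF R hR hRE
  have hD : 0 < diam E := by linarith
  obtain ⟨hAR, -, -, hbp⟩ := hUR
  have hup : ∀ x, ∀ t : ℝ, 0 < t →
      (μH[d] : Measure (Eucl n)).restrict E (closedBall x t) ≤ ENNReal.ofReal (C₀ * t ^ d) :=
    fun x t ht => hN d CA E hAR hD x t ht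
  refine ⟨hR, ?_, ?_, ?_, ?_⟩
  · intro A B hA hB hAB
    rw [Measure.restrict_apply hA, Measure.restrict_apply hB]
    exact measure_mono (subset_inter hAB inter_subset_right)
  · intro x k
    have ht : 0 < R * dy k := mul_pos hR (dy_pos k)
    exact le_add_right (Phi_le_of_lipschitz hF hq0 ht
      ((measure_mono ball_subset_closedBall).trans (hup x _ ht)))
  · intro x y k hxy
    have hk := dy_pos k
    rw [add_mul]
    refine le_add_left (Phi_le_mul_Phi hq0 (mul_pos hR (dy_pos _)) (mul_pos hR hk) ?_ ?_)
    · refine ball_subset_ball' ?_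
      rw [dy_succ] at hxy ⊢
      linarith
    · rw [dy_succ]
      nlinarith
  · intro x hx l hl
    have hl0 := dy_pos l
    set r := R * dy l with hr
    have hr0 : 0 < r := mul_pos hR hl0
    set s := r / dy a with hs
    have hs0 : 0 < s := div_pos hr0 hda
    have hrs : r ≤ s := by
      rw [hs, le_div_iff₀ hda]
      have := dy_le_one a
      nlinarith
    have hsD : s < diam E := by
      rw [hs, div_lt_iff₀ hda, hr]
      have h1 : dy l ≤ dy a / 2 / 2 := by
        rw [← dy_succ, ← dy_succ]; exact dy_anti hl
      calc R * dy l ≤ R * (dy a / 2 / 2) := by gcongr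
        _ < 2 * diam E * (dy a / 2 / 2) := by gcongr
        _ ≤ diam E * dy a := by nlinarith [mul_pos hD hda]
    have hfin : (μH[d] : Measure (Eucl n)) E ≠ ⊤ := by
      have hb : Bornology.IsBounded E := by
        by_contra h
        rw [diam_eq_zero_of_unbounded h] at hD
        exact lt_irrefl _ hD
      have h1 := hup x (diam E) hD
      rw [Measure.restrict_apply measurableSet_closedBall,
        inter_eq_right.2 fun w hw => mem_closedBall.2 (dist_le_diam_of_mem hb hw hx)] at h1
      exact (h1.trans_lt ENNReal.ofReal_lt_top).ne
    obtain ⟨E', hE'm, hEE', hE'c, hE'⟩ := exists_borel_hull hfin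
    obtain ⟨ρ, hρ, hρb⟩ := hbp x hx r hr0 (hrs.trans_lt hsD)
    have hg : LipschitzWith 1 fun v => ρ (dy a • v) := by
      refine LipschitzWith.of_dist_le_mul fun v v' => (hρ.dist_le_mul _ _).trans ?_
      rw [dist_smul₀, Real.norm_of_nonneg hda.le, Real.coe_toNNReal _ hL.le, NNReal.coe_one, ← mul_assoc]
      gcongr
      calc LUR * dy a ≤ LUR * (1 / LUR) := by gcongr
        _ = 1 := by field_simp
    obtain ⟨G, hGA, hGc, hGη, hGM⟩ := hpiece E' hE'm _ hE' hup s hs0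
      (fun y hy t ht hts => hAR.le_measure_ball (hE'c hy) ht (hts.trans hsD.le)) F hF _ hg
      (E' ∩ ball x r) inter_subset_left (hE'm.inter measurableSet_ball) (by
        rw [hE', Measure.restrict_apply' hE'm]
        have e1 : θ * dy a ^ d * s ^ d = θ * r ^ d := by
          rw [mul_assoc, ← mul_pow, hs, mul_div_cancel₀ _ hda.ne']
        rw [e1]
        refine hρb.trans (measure_mono ?_)
        rintro _ ⟨⟨hyE, hyb⟩, v, hv, rfl⟩
        refine ⟨⟨⟨hEE' hyE, hyb⟩, (dy a)⁻¹ • v, ?_, ?_⟩, hEE' hyE⟩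
        · rw [mem_ball_zero_iff] at hv ⊢
          rw [norm_smul, norm_inv, Real.norm_of_nonneg hda.le, inv_mul_eq_div]
          exact div_lt_div_of_pos_right hv hda
        · simp only [smul_smul, mul_inv_cancel₀ hda.ne', one_smul])
    refine ⟨G, hGc, (hGA.trans inter_subset_right).trans ball_subset_closedBall, ?_, fun y hy => ?_⟩
    · calc _ ≤ ENNReal.ofReal (C₀ * (5 * r) ^ d) := hup x _ (by positivity)
        _ = ENNReal.ofReal (C₀ * 5 ^ d) / η' * (ENNReal.ofReal (r ^ d) * η') := by
          rw [mul_comm (ENNReal.ofReal (r ^ d)) η', ← mul_assoc (_ / η'), ENNReal.div_mul_cancel hη' hη't,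
            ← ENNReal.ofReal_mul (by positivity), mul_pow 5 r, mul_assoc C₀]
        _ ≤ (1 + ENNReal.ofReal (C₀ * 5 ^ d) / η') * (ENNReal.ofReal (s ^ d) * η) := by
          gcongr
          · exact le_add_self
          · exact min_le_left _ _
        _ ≤ _ := by gcongr
    · refine le_trans ?_ (hGM y hy)
      have e2 : ∀ k, R * dy (l + e₀ + k) = s * dy (e₀ + (k + a)) := by
        intro k
        rw [hs, hr]
        simp only [dy_add]
        field_simp
      simp_rw [e2]
      exact ENNReal.tsum_comp_le_tsum_of_injective (add_left_injective a)
        fun k => Phi ((μH[d] : Measure (Eucl n)).restrict E) F q d y (s * dy (e₀ + k))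

end Pieces

section Comparison

variable {X : Type*} [MeasurableSpace X]

lemma aeEq_of_eqOn_restrict {ν : Measure X} {E B : Set X} (hB : MeasurableSet B) {u v : X → ℝ}
    (huv : EqOn u v E) (hv : Measurable v)
    (hu : AEStronglyMeasurable u ((ν.restrict E).restrict B)) :
    u =ᵐ[(ν.restrict E).restrict B] v := by
  obtain ⟨w, hw, huw⟩ := hu
  set μ := (ν.restrict E).restrict B with hμ
  set T := toMeasurable μ {y | ¬ u y = w y} with hT
  have hT0 : μ T = 0 := by
    rw [hT, measure_toMeasurable]
    exact ae_iff.1 huw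
  have hTm : MeasurableSet T := measurableSet_toMeasurable _ _
  have hS : MeasurableSet {y | ¬ w y = v y} := (measurableSet_eq_fun hw.measurable hv).compl
  have h0 : μ {y | ¬ w y = v y} = 0 := by
    rw [hμ, Measure.restrict_apply hS, Measure.restrict_apply (hS.inter hB)]
    rw [hμ, Measure.restrict_apply hTm, Measure.restrict_apply (hTm.inter hB)] at hT0
    refine measure_mono_null ?_ hT0
    rintro y ⟨⟨hy, hyB⟩, hyE⟩
    refine ⟨⟨subset_toMeasurable _ _ fun h => hy ?_, hyB⟩, hyE⟩
    rw [← h, huv hyE]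
  exact huw.trans (ae_iff.2 h0)

lemma ofReal_setIntegral_le_of_eqOn {ν : Measure X} {E B : Set X} (hB : MeasurableSet B)
    {u v : X → ℝ} (huv : EqOn u v E) (hv : Measurable v) (hv0 : 0 ≤ v) :
    ENNReal.ofReal (∫ y in B, u y ∂ν.restrict E) ≤ ∫⁻ y in B, ENNReal.ofReal (v y) ∂ν.restrict E := by
  by_cases hu : AEStronglyMeasurable u ((ν.restrict E).restrict B)
  · rw [integral_congr_ae (aeEq_of_eqOn_restrict hB huv hv hu)]
    refine (Real.ofReal_le_enorm _).trans ((enorm_integral_le_lintegral_enorm _).trans_eq ?_)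
    exact lintegral_congr fun y => Real.enorm_of_nonneg (hv0 y)
  · rw [integral_non_aestronglyMeasurable hu]
    simp

lemma lintegral_average_rpow_le {μ : Measure X} (h0 : μ univ ≠ 0) (ht : μ univ ≠ ⊤) {g : X → ℝ}
    (hg : Measurable g) (hg0 : 0 ≤ g) {p q : ℝ} (hq : 0 < q) (hqp : q ≤ p) :
    ((μ univ)⁻¹ * ∫⁻ y, ENNReal.ofReal (g y) ^ q ∂μ) ^ (1 / q) ≤
      ((μ univ)⁻¹ * ∫⁻ y, ENNReal.ofReal (g y) ^ p ∂μ) ^ (1 / p) := by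
  have : IsProbabilityMeasure ((μ univ)⁻¹ • μ) := ⟨by
    rw [Measure.smul_apply, smul_eq_mul, ENNReal.inv_mul_cancel h0 ht]⟩
  have h := eLpNorm'_le_eLpNorm'_of_exponent_le hq hqp ((μ univ)⁻¹ • μ) hg.aestronglyMeasurable
  simpa only [eLpNorm'_eq_lintegral_enorm, lintegral_smul_measure, smul_eq_mul,
    fun y => Real.enorm_of_nonneg (hg0 y)] using h

end Comparison

section Omega

variable {n : ℕ}

lemma Omega_nonneg {σ : Measure (Eucl n)} {f : Eucl n → ℝ} {q : ℝ} {c : Eucl n} {r : ℝ} (hr : 0 < r)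
    {A : Eucl n →ᵃ[ℝ] ℝ} : 0 ≤ Omega σ f q c r A := by
  unfold Omega
  refine Real.rpow_nonneg ?_ _
  rw [average_eq]
  exact smul_nonneg (by positivity) (integral_nonneg fun y => by positivity)

lemma OmegaN_nonneg {σ : Measure (Eucl n)} {f : Eucl n → ℝ} {q N : ℝ} {c : Eucl n} {r : ℝ}
    (hr : 0 < r) : 0 ≤ OmegaN σ f q N c r :=
  Real.iInf_nonneg fun _ => Omega_nonneg hr

lemma gradNorm_smul (L : ℝ) (A : Eucl n →ᵃ[ℝ] ℝ) : gradNorm (L • A) = |L| * gradNorm A := by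
  unfold gradNorm
  rw [← Real.norm_eq_abs, ← norm_smul]
  congr 1

lemma ofReal_Omega_smul_le {ν : Measure (Eucl n)} {E : Set (Eucl n)} {f F : Eucl n → ℝ} {L : ℝ}
    (hL : 0 < L) (hfF : EqOn f (fun y => L * F y) E) (hF : Continuous F) {p q : ℝ} (hq : 0 < q)
    (hqp : q ≤ p) {ξ : Eucl n} {t : ℝ} (ht : 0 < t)
    (h0 : ν.restrict E (ball ξ t) ≠ 0) (h1 : ν.restrict E (ball ξ t) ≠ ⊤) (A : Eucl n →ᵃ[ℝ] ℝ) :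
    ENNReal.ofReal (Omega (ν.restrict E) f q ξ t (L • A)) ≤ ENNReal.ofReal L *
      ((ν.restrict E (ball ξ t))⁻¹ *
        ∫⁻ y in ball ξ t, ENNReal.ofReal (|F y - A y| / t) ^ p ∂ν.restrict E) ^ (1 / p) := by
  have hA : Continuous A := A.continuous_of_finiteDimensional
  have hg : Measurable fun y => |F y - A y| / t := by fun_prop
  have hg0 : (0 : Eucl n → ℝ) ≤ fun y => |F y - A y| / t := fun y => by
    simp only [Pi.zero_apply]; positivity
  set σ := ν.restrict E with hσ
  have hJ := lintegral_average_rpow_le (μ := σ.restrict (ball ξ t)) (by simpa using h0)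
    (by simpa using h1) hg hg0 hq hqp
  rw [Measure.restrict_apply_univ] at hJ
  refine le_trans ?_ (mul_le_mul_right hJ _)
  have key : ENNReal.ofReal (∫ y in ball ξ t, (|f y - (L • A) y| / t) ^ q ∂σ) ≤
      ∫⁻ y in ball ξ t, ENNReal.ofReal ((L * (|F y - A y| / t)) ^ q) ∂σ := by
    refine ofReal_setIntegral_le_of_eqOn measurableSet_ball (fun y hy => ?_)
      ((hg.const_mul L).pow_const q) fun y => by simp only [Pi.zero_apply]; positivity
    have e : f y - (L • A) y = L * (F y - A y) := by
      rw [hfF hy]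
      simp [mul_sub]
    simp only [e, abs_mul, abs_of_pos hL, mul_div_assoc]
  have e1 : ∀ y, ENNReal.ofReal ((L * (|F y - A y| / t)) ^ q) =
      ENNReal.ofReal L ^ q * ENNReal.ofReal (|F y - A y| / t) ^ q := fun y => by
    rw [← ENNReal.ofReal_rpow_of_nonneg (by positivity) hq.le, ENNReal.ofReal_mul hL.le,
      ENNReal.mul_rpow_of_nonneg _ _ hq.le]
  have hLq : ENNReal.ofReal L ^ q ≠ ⊤ := by finiteness
  simp only [e1] at key
  rw [lintegral_const_mul' _ _ hLq] at key
  unfold Omega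
  rw [average_eq, smul_eq_mul, measureReal_restrict_apply_univ,
    ← ENNReal.ofReal_rpow_of_nonneg (mul_nonneg (by positivity)
      (integral_nonneg fun y => by positivity)) (by positivity), ENNReal.ofReal_mul (by positivity),
    measureReal_def, ENNReal.ofReal_inv_of_pos (ENNReal.toReal_pos h0 h1), ENNReal.ofReal_toReal h1]
  calc _ ≤ ((σ (ball ξ t))⁻¹ * (ENNReal.ofReal L ^ q *
        ∫⁻ y in ball ξ t, ENNReal.ofReal (|F y - A y| / t) ^ q ∂σ)) ^ (1 / q) := by gcongr
    _ = _ := by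
      rw [mul_left_comm, ENNReal.mul_rpow_of_nonneg _ _ (by positivity), ← ENNReal.rpow_mul,
        mul_one_div_cancel hq.ne', ENNReal.rpow_one]

lemma ofReal_OmegaN_sq_le {d : ℕ} {ν : Measure (Eucl n)} {E : Set (Eucl n)} {f F : Eucl n → ℝ} {L : ℝ}
    (hL : 0 < L) (hfF : EqOn f (fun y => L * F y) E) (hF : Continuous F) {p q : ℝ} (hq : 0 < q)
    (hqp : q ≤ p) {ξ : Eucl n} {c t : ℝ} (ht : 0 < t) (hc : 0 < c)
    (h0 : ENNReal.ofReal (c * t ^ d) ≤ ν.restrict E (ball ξ t))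
    (h1 : ν.restrict E (ball ξ t) ≠ ⊤) :
    ENNReal.ofReal (OmegaN (ν.restrict E) f q (2 * L) ξ t ^ 2) ≤
      ENNReal.ofReal L ^ 2 * (ENNReal.ofReal c)⁻¹ ^ (2 / p) * Phi (ν.restrict E) F p d ξ t := by
  have hp : 0 < p := hq.trans_le hqp
  have hc0 : ENNReal.ofReal c ≠ 0 := (ENNReal.ofReal_pos.2 hc).ne'
  unfold Phi
  rw [ENNReal.mul_iInf_of_ne]
  rotate_left
  · refine mul_ne_zero (pow_ne_zero _ (ENNReal.ofReal_pos.2 hL).ne') ?_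
    exact (ENNReal.rpow_pos (ENNReal.inv_pos.2 ENNReal.ofReal_ne_top)
      (ENNReal.inv_ne_top.2 hc0)).ne'
  · have : (ENNReal.ofReal c)⁻¹ ≠ ⊤ := ENNReal.inv_ne_top.2 hc0
    have h2 : 0 ≤ 2 / p := by positivity
    finiteness
  refine le_iInf fun A => ?_
  have hA : gradNorm (L • A.1) ≤ 2 * L := by
    rw [gradNorm_smul, abs_of_pos hL, mul_comm]
    gcongr
    exact A.2
  have hle : OmegaN (ν.restrict E) f q (2 * L) ξ t ≤ Omega (ν.restrict E) f q ξ t (L • A.1) :=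
    ciInf_le ⟨0, by rintro _ ⟨A, rfl⟩; exact Omega_nonneg ht⟩
      (⟨L • A.1, hA⟩ : {A : Eucl n →ᵃ[ℝ] ℝ // gradNorm A ≤ 2 * L})
  have h00 : ν.restrict E (ball ξ t) ≠ 0 :=
    ((ENNReal.ofReal_pos.2 (by positivity)).trans_le h0).ne'
  rw [ENNReal.ofReal_pow (OmegaN_nonneg ht)]
  calc _ ≤ (ENNReal.ofReal L * ((ν.restrict E (ball ξ t))⁻¹ *
        ∫⁻ y in ball ξ t, ENNReal.ofReal (|F y - A.1 y| / t) ^ p ∂ν.restrict E) ^ (1 / p)) ^ 2 := by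
        gcongr
        exact (ENNReal.ofReal_le_ofReal hle).trans (ofReal_Omega_smul_le hL hfF hF hq hqp ht h00 h1 A.1)
    _ ≤ (ENNReal.ofReal L * ((ENNReal.ofReal (c * t ^ d))⁻¹ *
        ∫⁻ y in ball ξ t, ENNReal.ofReal (|F y - A.1 y| / t) ^ p ∂ν.restrict E) ^ (1 / p)) ^ 2 := by
        gcongr
    _ = _ := by
        rw [mul_pow, ← ENNReal.rpow_natCast (_ ^ (1 / p)), ← ENNReal.rpow_mul, mul_assoc,
          ← ENNReal.mul_rpow_of_nonneg _ _ (by positivity), ← mul_assoc (ENNReal.ofReal c)⁻¹,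
          ← ENNReal.mul_inv (Or.inl hc0) (Or.inl ENNReal.ofReal_ne_top), ← ENNReal.ofReal_mul hc.le]
        congr 2
        push_cast
        ring

end Omega

lemma lintegral_div_le_tsum {φ : ℝ → ℝ≥0∞} {a : ℕ → ℝ≥0∞} {R : ℝ} (hR : 0 < R)
    (h : ∀ k, ∀ t ∈ Ioc (R * dy (k + 1)) (R * dy k), φ t ≤ a k) :
    ∫⁻ t in Ioc 0 R, φ t / ENNReal.ofReal t ≤ ∑' k, a k := by
  have hsub : Ioc 0 R ⊆ ⋃ k, Ioc (R * dy (k + 1)) (R * dy k) := by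
    rintro t ⟨ht0, htR⟩
    obtain ⟨k, hk1, hk2⟩ := exists_nat_pow_near_of_lt_one (x := t / R) (y := (1 / 2 : ℝ))
      (by positivity) ((div_le_one hR).2 htR) (by norm_num) (by norm_num)
    rw [lt_div_iff₀' hR] at hk1
    rw [div_le_iff₀' hR] at hk2
    exact mem_iUnion.2 ⟨k, hk1, hk2⟩
  refine (lintegral_mono_set hsub).trans ((lintegral_iUnion_le _ _).trans (ENNReal.tsum_le_tsum fun k => ?_))
  have hpos : 0 < R * dy (k + 1) := mul_pos hR (dy_pos _)
  calc ∫⁻ t in Ioc (R * dy (k + 1)) (R * dy k), φ t / ENNReal.ofReal t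
      ≤ ∫⁻ _ in Ioc (R * dy (k + 1)) (R * dy k), a k / ENNReal.ofReal (R * dy (k + 1)) :=
        setLIntegral_mono' measurableSet_Ioc fun t ht =>
          ENNReal.div_le_div (h k t ht) (ENNReal.ofReal_le_ofReal ht.1.le)
    _ = a k := by
        rw [setLIntegral_const, Real.volume_Ioc,
          show R * dy k - R * dy (k + 1) = R * dy (k + 1) by rw [dy_succ]; ring,
          ENNReal.div_mul_cancel (ENNReal.ofReal_pos.2 hpos).ne' ENNReal.ofReal_ne_top]

/-- The infimum of a function over the balls of a fixed radius. -/
def ballInf {X : Type*} [PseudoMetricSpace X] (Φ : X → ℝ≥0∞) (s : ℝ) (ξ : X) : ℝ≥0∞ :=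
  ⨅ ζ : ball ξ s, Φ ζ

lemma measurable_ballInf {X : Type*} [PseudoMetricSpace X] [MeasurableSpace X] [OpensMeasurableSpace X]
    (Φ : X → ℝ≥0∞) (s : ℝ) : Measurable (ballInf Φ s) := by
  refine measurable_of_Iio fun c => ?_
  have : ballInf Φ s ⁻¹' Iio c = ⋃ ζ ∈ {ζ | Φ ζ < c}, ball ζ s := by
    ext ξ
    simp only [ballInf, mem_preimage, mem_Iio, iInf_lt_iff, mem_iUnion, Subtype.exists, mem_ofPred_eq,
      mem_ball, exists_prop]
    exact exists_congr fun ζ => by rw [and_comm, dist_comm]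
  rw [this]
  exact (isOpen_biUnion fun _ _ => isOpen_ball).measurableSet

lemma ballInf_le {X : Type*} [PseudoMetricSpace X] {Φ : X → ℝ≥0∞} {s : ℝ} (hs : 0 < s) (ξ : X) :
    ballInf Φ s ξ ≤ Φ ξ :=
  iInf_le (fun ζ : ball ξ s => Φ ζ) ⟨ξ, mem_ball_self hs⟩

/-- The constant comparing `Phi` at comparable scales. -/
def scaleConst (d : ℕ) (q : ℝ) : ℝ≥0∞ := (ENNReal.ofReal (4 ^ d) * ENNReal.ofReal 4 ^ q) ^ (2 / q)

lemma scaleConst_ne_top (d : ℕ) {q : ℝ} (hq : 0 < q) : scaleConst d q ≠ ⊤ := by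
  have h : 0 ≤ 2 / q := by positivity
  unfold scaleConst
  finiteness

lemma scaleConst_ne_zero (d : ℕ) (q : ℝ) : scaleConst d q ≠ 0 := by
  have h2 : ENNReal.ofReal 4 ^ q ≠ ⊤ := by finiteness
  refine (ENNReal.rpow_pos (ENNReal.mul_pos ?_ ?_) (ENNReal.mul_ne_top ENNReal.ofReal_ne_top h2)).ne'
  · exact (ENNReal.ofReal_pos.2 (by positivity)).ne'
  · exact (ENNReal.rpow_pos (ENNReal.ofReal_pos.2 (by norm_num)) ENNReal.ofReal_ne_top).ne'

section Final

variable {n d : ℕ}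

lemma Phi_le_ballInf {σ : Measure (Eucl n)} {F : Eucl n → ℝ} {q : ℝ} (hq : 0 < q) {ξ : Eucl n} {R : ℝ}
    (hR : 0 < R) {k : ℕ} {t : ℝ} (ht : t ∈ Ioc (R * dy (k + 1)) (R * dy k)) :
    Phi σ F q d ξ t ≤
      scaleConst d q * ballInf (fun ζ => Phi σ F q d ζ (2 * R * dy k)) (R * dy k) ξ := by
  unfold ballInf
  rw [ENNReal.mul_iInf_of_ne (scaleConst_ne_zero d q) (scaleConst_ne_top d hq)]
  refine le_iInf fun ζ => ?_
  have h0 : 0 < R * dy (k + 1) := mul_pos hR (dy_pos _)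
  refine Phi_le_mul_Phi hq (h0.trans ht.1) (by have := dy_pos k; positivity) ?_ ?_
  · refine ball_subset_ball' ?_
    have := mem_ball'.1 ζ.2
    linarith [ht.2]
  · have := ht.1.le
    rw [dy_succ] at this
    linarith

lemma lintegral_tsum_ballInf_le {σ : Measure (Eucl n)} {E : Set (Eucl n)} {Φ : Eucl n → ℕ → ℝ≥0∞}
    {R : ℝ} {l₀ c₀ : ℕ} {Q M C : ℝ≥0∞} (h : BigPieces σ E Φ (2 * R) l₀ c₀ Q M C) (hR : 0 < R)
    (hQ : 1 ≤ Q) (hQt : Q ≠ ⊤) (hCt : C ≠ ⊤) {x : Eucl n} (hx : σ (ball x (3 * R)) ≠ ⊤) :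
    ∫⁻ ξ in ball x R, ∑' k, ballInf (fun ζ => Φ ζ k) (R * dy k) ξ ∂σ ≤
      2 * Q * stepConst l₀ c₀ M C * σ (ball x (3 * R)) := by
  rw [lintegral_tsum fun k => (measurable_ballInf _ _).aemeasurable]
  refine ENNReal.tsum_le_of_sum_range_le fun N => ?_
  rw [← lintegral_finsetSum _ fun k _ => measurable_ballInf _ _]
  refine le_trans ?_ (h.carleson hQ hQt hCt N isOpen_ball hx)
  refine (setLIntegral_mono' measurableSet_ball fun ξ hξ => ?_).trans
    (lintegral_mono_set (ball_subset_ball (by linarith : R ≤ 3 * R)))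
  refine (Finset.sum_le_sum fun k _ => ballInf_le (mul_pos hR (dy_pos k)) ξ).trans
    (Finset.sum_le_sum_of_subset fun k hk => mem_admGen.2 ⟨Finset.mem_range.1 hk, ?_⟩)
  refine ball_subset_ball' ?_
  have h1 := mul_le_mul_of_nonneg_left (dy_le_one k) hR.le
  have := mem_ball.1 hξ
  nlinarith

lemma enorm_integral_OmegaN_le {ν : Measure (Eucl n)} {E : Set (Eucl n)} {f F : Eucl n → ℝ} {L : ℝ}
    (hL : 0 < L) (hfF : EqOn f (fun y => L * F y) E) (hF : Continuous F) {p q : ℝ} (hq : 0 < q)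
    (hqp : q ≤ p) {ξ : Eucl n} {c R : ℝ} (hR : 0 < R) (hc : 0 < c)
    (h0 : ∀ t, 0 < t → t ≤ R → ENNReal.ofReal (c * t ^ d) ≤ ν.restrict E (ball ξ t))
    (h1 : ∀ t, 0 < t → ν.restrict E (ball ξ t) ≠ ⊤) :
    ‖∫ t in Ioc 0 R, OmegaN (ν.restrict E) f q (2 * L) ξ t ^ 2 / t‖ₑ ≤
      ENNReal.ofReal L ^ 2 * (ENNReal.ofReal c)⁻¹ ^ (2 / p) * scaleConst d p *
        ∑' k, ballInf (fun ζ => Phi (ν.restrict E) F p d ζ (2 * R * dy k)) (R * dy k) ξ := by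
  have hp := hq.trans_le hqp
  refine (enorm_integral_le_lintegral_enorm _).trans ?_
  rw [← ENNReal.tsum_mul_left]
  refine le_trans (setLIntegral_mono' measurableSet_Ioc fun t ht => ?_)
    (lintegral_div_le_tsum (φ := fun t => ENNReal.ofReal L ^ 2 * (ENNReal.ofReal c)⁻¹ ^ (2 / p) *
      Phi (ν.restrict E) F p d ξ t) hR fun k t ht => ?_)
  · rw [Real.enorm_of_nonneg (div_nonneg (sq_nonneg _) ht.1.le), ENNReal.ofReal_div_of_pos ht.1]
    exact ENNReal.div_le_div_right (ofReal_OmegaN_sq_le hL hfF hF hq hqp ht.1 hc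
      (h0 t ht.1 ht.2) (h1 t ht.1)) _
  · rw [mul_assoc _ (scaleConst d p)]
    gcongr
    exact Phi_le_ballInf hp hR ht

lemma exponent_condition {d : ℕ} {q : ℝ} (hq : 2 ≤ q)
    (h : d ≤ 2 ∨ q < 2 * (d : ℝ) / ((d : ℝ) - 2)) : (d : ℝ) * (1 - 2 / q) < 2 := by
  have hq0 : 0 < q := by linarith
  rcases le_or_gt d 2 with hd | hd
  · have hd' : (d : ℝ) ≤ 2 := by exact_mod_cast hd
    have h1 : 0 < 2 / q := by positivity
    have h2 : 2 / q ≤ 1 := (div_le_one hq0).2 hq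
    nlinarith
  · have hd' : (2 : ℝ) < d := by exact_mod_cast hd
    have h1 := h.resolve_left (by omega)
    rw [lt_div_iff₀ (by linarith)] at h1
    have e : (d : ℝ) * (1 - 2 / q) = (d * q - 2 * d) / q := by field_simp
    rw [e, div_lt_iff₀ hq0]
    linarith

lemma setIntegral_OmegaN_le {c C₀ p q L R : ℝ} {E : Set (Eucl n)} {B : ℝ≥0∞} {f F : Eucl n → ℝ}
    (hL : 0 < L) (hfF : EqOn f (fun y => L * F y) E) (hF : Continuous F) (hq : 0 < q) (hqp : q ≤ p)
    {l₀ c₀ : ℕ} {Q M C : ℝ≥0∞}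
    (h : BigPieces ((μH[d] : Measure (Eucl n)).restrict E) E
      (fun x k => Phi ((μH[d] : Measure (Eucl n)).restrict E) F p d x (2 * R * dy k))
      (2 * R) l₀ c₀ Q M C) (hR : 0 < R)
    (hQ : 1 ≤ Q) (hQt : Q ≠ ⊤) (hCt : C ≠ ⊤) (hc : 0 < c) (hC₀ : 0 ≤ C₀)
    (hlow : ∀ ξ ∈ closure E, ∀ t, 0 < t → t ≤ R →
      ENNReal.ofReal (c * t ^ d) ≤ (μH[d] : Measure (Eucl n)).restrict E (ball ξ t))
    (hup : ∀ ξ, ∀ t : ℝ, 0 < t →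
      (μH[d] : Measure (Eucl n)).restrict E (closedBall ξ t) ≤ ENNReal.ofReal (C₀ * t ^ d))
    (hB : B = (ENNReal.ofReal c)⁻¹ ^ (2 / p) * scaleConst d p *
      (2 * Q * stepConst l₀ c₀ M C * ENNReal.ofReal (C₀ * 3 ^ d))) (hBt : B ≠ ⊤) (x : Eucl n) :
    ∫ ξ in ball x R, (∫ t in Ioc 0 R,
        OmegaN ((μH[d] : Measure (Eucl n)).restrict E) f q (2 * L) ξ t ^ 2 / t)
          ∂(μH[d] : Measure (Eucl n)).restrict E ≤ B.toReal * L ^ 2 * R ^ d := by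
  set σ := (μH[d] : Measure (Eucl n)).restrict E with hσ
  have hball : ∀ ξ, ∀ t : ℝ, 0 < t → σ (ball ξ t) ≤ ENNReal.ofReal (C₀ * t ^ d) := fun ξ t ht =>
    (measure_mono ball_subset_closedBall).trans (hup ξ t ht)
  have hfin : ∀ ξ, ∀ t : ℝ, 0 < t → σ (ball ξ t) ≠ ⊤ := fun ξ t ht =>
    ((hball ξ t ht).trans_lt ENNReal.ofReal_lt_top).ne
  have hae : ∀ᵐ ξ ∂σ.restrict (ball x R), ξ ∈ closure E := by
    refine ae_restrict_of_ae (ae_mono (Measure.restrict_mono_set _ subset_closure) ?_)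
    exact ae_restrict_mem isClosed_closure.measurableSet
  have hp := hq.trans_le hqp
  set K := ENNReal.ofReal L ^ 2 * (ENNReal.ofReal c)⁻¹ ^ (2 / p) * scaleConst d p with hK
  have hKt : K ≠ ⊤ := by
    have h1 : (ENNReal.ofReal c)⁻¹ ≠ ⊤ := ENNReal.inv_ne_top.2 (ENNReal.ofReal_pos.2 hc).ne'
    have h2 := scaleConst_ne_top d hp
    have h3 : 0 ≤ 2 / p := by positivity
    finiteness
  have hR3 : 0 < 3 * R := by positivity
  have key : ENNReal.ofReal (∫ ξ in ball x R,
      (∫ t in Ioc 0 R, OmegaN σ f q (2 * L) ξ t ^ 2 / t) ∂σ) ≤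
      ENNReal.ofReal (B.toReal * L ^ 2 * R ^ d) :=
    calc _ ≤ ∫⁻ ξ in ball x R, ‖∫ t in Ioc 0 R, OmegaN σ f q (2 * L) ξ t ^ 2 / t‖ₑ ∂σ :=
          (Real.ofReal_le_enorm _).trans (enorm_integral_le_lintegral_enorm _)
      _ ≤ ∫⁻ ξ in ball x R, K *
          ∑' k, ballInf (fun ζ => Phi σ F p d ζ (2 * R * dy k)) (R * dy k) ξ ∂σ :=
          lintegral_mono_ae (hae.mono fun ξ hξ => enorm_integral_OmegaN_le hL hfF hF hq hqp hR hc
            (hlow ξ hξ) (hfin ξ))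
      _ ≤ K * (2 * Q * stepConst l₀ c₀ M C * ENNReal.ofReal (C₀ * (3 * R) ^ d)) := by
          rw [lintegral_const_mul' _ _ hKt]
          gcongr
          refine (lintegral_tsum_ballInf_le h hR hQ hQt hCt (hfin x _ hR3)).trans ?_
          gcongr
          exact hball x _ hR3
      _ = B * ENNReal.ofReal L ^ 2 * ENNReal.ofReal (R ^ d) := by
          rw [hK, hB, mul_pow, ← mul_assoc C₀, ENNReal.ofReal_mul (by positivity)]
          ring
      _ = _ := by
          rw [ENNReal.ofReal_mul (by positivity), ENNReal.ofReal_mul ENNReal.toReal_nonneg,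
            ENNReal.ofReal_toReal hBt, ENNReal.ofReal_pow hL.le]
  exact (ENNReal.ofReal_le_ofReal_iff (by positivity)).1 key

end Final

/-- **David–Semmes Carleson measure estimate for Lipschitz functions on UR sets.**
Let `E ⊆ ℝⁿ` be uniformly `d`-rectifiable and `f : E → ℝ` `L`-Lipschitz, `L > 0`, and
`1 ≤ q < 2d/(d−2)` (any `q ≥ 1` if `d ≤ 2`). Then `Ω^{q,2L}_f(x,r)² dσ(x) dr/r` is a
`C·L²`-Carleson measure: for every ball `B(x,R)` centered on `E` with `R < diam E`,
`∫_{B(x,R)} ∫_0^R Ω^{q,2L}_f(ξ,t)² dt/t dσ(ξ) ≤ C L² R^d`. -/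
theorem DS_carleson_omega {n d : ℕ} (CA θ LUR q : ℝ) (hq1 : 1 ≤ q)
    (hq2 : d ≤ 2 ∨ q < 2 * (d : ℝ) / ((d : ℝ) - 2)) :
    ∃ C : ℝ, 0 < C ∧
      ∀ (E : Set (Eucl n)), UniformlyRectifiable E d CA θ LUR →
      ∀ (σ : Measure (Eucl n)), σ = μH[d].restrict E →
      ∀ (f : Eucl n → ℝ) (L : ℝ), 0 < L → LipschitzOnWith (Real.toNNReal L) f E →
      ∀ x ∈ E, ∀ R : ℝ, 0 < R → R < Metric.diam E →
        ∫ ξ in Metric.ball x R,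
            (∫ t in Set.Ioc (0 : ℝ) R, (OmegaN σ f q (2 * L) ξ t) ^ 2 / t) ∂σ
          ≤ C * L ^ 2 * R ^ d := by
  by_cases hpar : 1 ≤ CA ∧ 0 < θ ∧ 0 < LUR
  swap
  · exact ⟨1, one_pos, fun E hE => (hpar ⟨hE.1.1, hE.2.1, hE.2.2.1⟩).elim⟩
  obtain ⟨hCA, hθ, hLUR⟩ := hpar
  set p := max q 2 with hp
  have hp2 : 2 ≤ p := le_max_right _ _
  have hp0 : 0 < p := by linarith
  have hexp : (d : ℝ) * (1 - 2 / p) < 2 := by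
    refine exponent_condition hp2 (hq2.imp_right fun h => max_lt h ?_)
    by_contra! hcon
    have hd : (0 : ℝ) < d - 2 := by
      by_contra! hd0
      have : 2 * (d : ℝ) / (d - 2) ≤ 0 := div_nonpos_of_nonneg_of_nonpos (by positivity) hd0
      linarith
    rw [div_le_iff₀ hd] at hcon
    linarith
  obtain ⟨l₀, c₀, Q, M, C, hQ, hQt, hMt, hCt, hBP⟩ := exists_bigPieces n d hCA hθ hLUR hp2 hexp
  obtain ⟨N, hN⟩ := exists_measure_closedBall_le n
  set c : ℝ := CA⁻¹ / 2 ^ d with hc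
  set C₀ : ℝ := CA * 3 ^ d * (N + 1) with hC₀
  have hc0 : 0 < c := by positivity
  have hC₀0 : 0 ≤ C₀ := by positivity
  set B : ℝ≥0∞ := (ENNReal.ofReal c)⁻¹ ^ (2 / p) * scaleConst d p *
      (2 * Q * stepConst l₀ c₀ M C * ENNReal.ofReal (C₀ * 3 ^ d)) with hB
  have hBt : B ≠ ⊤ := by
    have h1 : (ENNReal.ofReal c)⁻¹ ≠ ⊤ := ENNReal.inv_ne_top.2 (ENNReal.ofReal_pos.2 hc0).ne'
    have h2 := scaleConst_ne_top d hp0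
    have h3 : 0 ≤ 2 / p := by positivity
    have h4 : stepConst l₀ c₀ M C ≠ ⊤ := by
      unfold stepConst
      finiteness
    finiteness
  refine ⟨B.toReal + 1, by positivity, ?_⟩
  rintro E hE σ rfl f L hL hf x - R hR hRD
  obtain ⟨G, hG, hfG⟩ := hf.extend_real
  have hD : 0 < diam E := hR.trans hRD
  have hF : LipschitzWith 1 fun y => L⁻¹ * G y := by
    refine LipschitzWith.of_dist_le_mul fun y z => ?_
    have h1 := hG.dist_le_mul y z
    rw [Real.coe_toNNReal _ hL.le] at h1
    rw [Real.dist_eq, ← mul_sub, abs_mul, abs_of_pos (inv_pos.2 hL), ← Real.dist_eq,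
      inv_mul_le_iff₀ hL]
    simpa using h1
  have hmain := setIntegral_OmegaN_le hL
    (fun y hy => show f y = L * (L⁻¹ * G y) by rw [hfG hy, mul_inv_cancel_left₀ hL.ne'])
    hF.continuous (by linarith : 0 < q) (le_max_left q 2) (hBP E hE _ hF (2 * R) (by positivity)
      (by linarith)) hR hQ hQt hCt hc0 hC₀0
    (fun ξ hξ t ht htR => hE.1.le_measure_ball hξ ht (htR.trans hRD.le))
    (fun ξ t ht => hN d CA E hE.1 hD ξ t ht) hB hBt x
  refine hmain.trans ?_
  gcongr
  linarith
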